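/- Let n ≥ 2, let v : (0,∞) → [0,∞) be measurable with v(r) ≤ n ω_n r^{n-1} for H^1-a.e. r, and let E ⊂ ℝⁿ be a spherically v-distributed set of finite perimeter and finite volume. Then v ∈ BV(0,∞), the spherical symmetral F_v is a set of finite perimeter, and P(F_v; Φ(B × S^{n-1})) ≤ P(E; Φ(B × S^{n-1})) for every Borel set B ⊂ (0,∞). -/

import Mathlib

/- Common definitions: geometric measure theory notions (density points, essential
boundary, perimeter, reduced boundary and measure-theoretic outer unit normal),
spherical and circular symmetrisation, BV and Sobolev-type notions. -/

open MeasureTheory Metric Set Filter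
open scoped ENNReal NNReal Topology RealInnerProductSpace

noncomputable section

/-- Euclidean space `ℝⁿ`. -/
abbrev Euc (n : ℕ) : Type := EuclideanSpace ℝ (Fin n)

/-- `ω_k`: the volume of the unit ball of `ℝ^k`. -/
def omegaBall (k : ℕ) : ℝ := (volume (ball (0 : Euc k) 1)).toReal

/-- The radial unit vector `x̂ = x/|x|`. -/
def hatv {n : ℕ} (x : Euc n) : Euc n := ‖x‖⁻¹ • x

/-- The first vector of the canonical basis. -/
def e1 (n : ℕ) (hn : 0 < n) : Euc n := EuclideanSpace.single ⟨0, hn⟩ 1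

/-- `E` has `n`-dimensional density `t` at `x`. -/
def DensityAt {n : ℕ} (E : Set (Euc n)) (x : Euc n) (t : ℝ≥0∞) : Prop :=
  Tendsto (fun ρ : ℝ => volume (E ∩ ball x ρ) / volume (ball x ρ)) (𝓝[>] (0:ℝ)) (𝓝 t)

/-- The essential boundary `∂ᵉE`: points of density neither `0` nor `1`. -/
def essBoundary {n : ℕ} (E : Set (Euc n)) : Set (Euc n) :=
  {x | ¬ DensityAt E x 0 ∧ ¬ DensityAt E x 1}

/-- The perimeter of `E` relative to `A`: `P(E;A) = H^{n-1}(∂ᵉE ∩ A)`. -/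
def perim {n : ℕ} (E A : Set (Euc n)) : ℝ≥0∞ := μH[(n : ℝ) - 1] (essBoundary E ∩ A)

/-- `ν` is the measure-theoretic outer unit normal of `E` at `x`: the blow-up of `E`
at `x` is the half space `{y : (y-x)·ν ≤ 0}` in density. -/
def HasMTNormal {n : ℕ} (E : Set (Euc n)) (x ν : Euc n) : Prop :=
  ‖ν‖ = 1 ∧
    Tendsto (fun ρ : ℝ =>
        volume ({y | y ∈ E ∧ 0 < ⟪y - x, ν⟫} ∩ ball x ρ) / volume (ball x ρ))
      (𝓝[>] (0:ℝ)) (𝓝 0) ∧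
    Tendsto (fun ρ : ℝ =>
        volume ({y | y ∉ E ∧ ⟪y - x, ν⟫ < 0} ∩ ball x ρ) / volume (ball x ρ))
      (𝓝[>] (0:ℝ)) (𝓝 0)

/-- The reduced boundary `∂*E`. -/
def redBoundary {n : ℕ} (E : Set (Euc n)) : Set (Euc n) := {x | ∃ ν, HasMTNormal E x ν}

/-- The measure-theoretic outer unit normal `ν^E`. -/
def mtNormal {n : ℕ} (E : Set (Euc n)) (x : Euc n) : Euc n :=
  haveI := Classical.propDecidable (∃ ν, HasMTNormal E x ν)
  if h : ∃ ν, HasMTNormal E x ν then h.choose else 0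

/-- The tangential component `ν∥^E(x) = ν^E(x) - (ν^E(x)·x̂)x̂` of the normal along
the sphere `∂B(|x|)`. -/
def nuPar {n : ℕ} (E : Set (Euc n)) (x : Euc n) : Euc n :=
  mtNormal E x - ⟪mtNormal E x, hatv x⟫ • hatv x

/-- The open geodesic ball (spherical cap) `B_β(r p)` in the sphere `∂B(0,r)`. -/
def capSet {n : ℕ} (p : Euc n) (r β : ℝ) : Set (Euc n) :=
  {x | x ∈ sphere (0 : Euc n) r ∧ Real.arccos ⟪hatv x, p⟫ < β}

/-- The geodesic sphere `S_β(r p)` in the sphere `∂B(0,r)`. -/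
def capSphere {n : ℕ} (p : Euc n) (r β : ℝ) : Set (Euc n) :=
  {x | x ∈ sphere (0 : Euc n) r ∧ Real.arccos ⟪hatv x, p⟫ = β}

/-- `E ⊆ ℝⁿ` is spherically `v`-distributed: `H^{n-1}(E ∩ ∂B(0,r)) = v r` for a.e. `r > 0`. -/
def SphDistrib {n : ℕ} (v : ℝ → ℝ) (E : Set (Euc n)) : Prop :=
  ∀ᵐ r ∂(volume.restrict (Ioi (0:ℝ))),
    μH[(n : ℝ) - 1] (E ∩ sphere (0 : Euc n) r) = ENNReal.ofReal (v r)

/-- The spherical symmetral `F_v` (determined by the angle function `α = α_v` and the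
direction `p`). -/
def sphSymm (n : ℕ) (α : ℝ → ℝ) (p : Euc n) : Set (Euc n) :=
  {x : Euc n | x ≠ 0 ∧ Real.arccos ⟪hatv x, p⟫ < α ‖x‖}

/-- `Φ(B × S^{n-1})`, for `B ⊆ (0,∞)`. -/
def sphShell (n : ℕ) (B : Set ℝ) : Set (Euc n) := {x : Euc n | x ≠ 0 ∧ ‖x‖ ∈ B}

/-- `v ∈ BV(0,∞)`: `v` is integrable on `(0,∞)` and has a representative of bounded
pointwise variation there. -/
def BVIoi (v : ℝ → ℝ) : Prop :=
  IntegrableOn v (Ioi (0:ℝ)) volume ∧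
    ∃ w : ℝ → ℝ, (∀ᵐ r ∂(volume.restrict (Ioi (0:ℝ))), w r = v r) ∧
      BoundedVariationOn w (Ioi (0:ℝ))

/-- `f ∈ W^{1,1}_loc(I)` for `I ⊆ ℝ`: `f` has a representative `w` which is locally
absolutely continuous on `I`, i.e. `w b - w a = ∫_a^b g` with `g` locally integrable on `I`. -/
def W11locOn (f : ℝ → ℝ) (I : Set ℝ) : Prop :=
  ∃ w g : ℝ → ℝ, (∀ᵐ r ∂(volume.restrict I), w r = f r) ∧
    LocallyIntegrableOn g I volume ∧
    ∀ a b : ℝ, uIcc a b ⊆ I → w b - w a = ∫ t in a..b, g t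

/-- `S ⊆ ℝ` has one-dimensional density `0` at `x`. -/
def RDensity0 (S : Set ℝ) (x : ℝ) : Prop :=
  Tendsto (fun ρ : ℝ => volume (S ∩ ball x ρ) / volume (ball x ρ)) (𝓝[>] (0:ℝ)) (𝓝 0)

/-- The approximate upper limit `f^∨(x)` (for bounded `f`). -/
def apSup (f : ℝ → ℝ) (x : ℝ) : ℝ := sInf {t : ℝ | RDensity0 {y | t < f y} x}

/-- The approximate lower limit `f^∧(x)` (for bounded `f`). -/
def apInf (f : ℝ → ℝ) (x : ℝ) : ℝ := sSup {t : ℝ | RDensity0 {y | f y < t} x}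

/-- `t` is the approximate limit of `f` at `x` with respect to `A`. -/
def apLimOn (f : ℝ → ℝ) (A : Set ℝ) (x t : ℝ) : Prop :=
  ∀ ε : ℝ, 0 < ε → RDensity0 ({y | ε < |f y - t|} ∩ A) x

/-- Density (with value `t`) at `x` of a subset `A` of the sphere `∂B(0,r)`,
with respect to the measure `H^{n-1}` on the sphere. -/
def SphDensityAt {n : ℕ} (A : Set (Euc n)) (r : ℝ) (x : Euc n) (t : ℝ≥0∞) : Prop :=
  Tendsto (fun ρ : ℝ =>
      μH[(n : ℝ) - 1] (A ∩ ball x ρ) / μH[(n : ℝ) - 1] (sphere (0 : Euc n) r ∩ ball x ρ))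
    (𝓝[>] (0:ℝ)) (𝓝 t)

/-- The essential boundary, within the sphere `∂B(0,r)`, of a subset `A` of that sphere. -/
def sphEssBoundary {n : ℕ} (A : Set (Euc n)) (r : ℝ) : Set (Euc n) :=
  {x | x ∈ sphere (0 : Euc n) r ∧ ¬ SphDensityAt A r x 0 ∧ ¬ SphDensityAt A r x 1}

/-- A pair of mutually singular measures `(σp, σm)` supported in `(0,∞)`, locally finite
there, representing the distributional derivative `Dξ = σp - σm` of `ξ` on `(0,∞)`. -/
def RepDeriv (ξ : ℝ → ℝ) (σp σm : Measure ℝ) : Prop :=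
  σp (Iic (0:ℝ)) = 0 ∧ σm (Iic (0:ℝ)) = 0 ∧
    (∀ K : Set ℝ, K ⊆ Ioi (0:ℝ) → IsCompact K → σp K < ⊤ ∧ σm K < ⊤) ∧
    σp.MutuallySingular σm ∧
    ∀ φ : ℝ → ℝ, ContDiff ℝ 1 φ → HasCompactSupport φ → tsupport φ ⊆ Ioi (0:ℝ) →
      (∫ r in Ioi (0:ℝ), ξ r * deriv φ r) = (∫ r, φ r ∂σm) - ∫ r, φ r ∂σp

/-- The density `ξ'` of the absolutely continuous part of `Dξ = σp - σm`. -/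
def acDeriv (σp σm : Measure ℝ) (r : ℝ) : ℝ :=
  (σp.rnDeriv volume r).toReal - (σm.rnDeriv volume r).toReal

/-- `p_E(r) = H^{n-2}(∂*E ∩ ∂B(0,r))` (as a real number). -/
def pSlice {n : ℕ} (E : Set (Euc n)) (r : ℝ) : ℝ :=
  (μH[(n : ℝ) - 2] (redBoundary E ∩ sphere (0 : Euc n) r)).toReal

/-- The projection `x ↦ x₁₂` onto the plane of the first two coordinates. -/
def pr12 {n : ℕ} (hn : 2 ≤ n) (x : Euc n) : Euc 2 :=
  (EuclideanSpace.equiv (Fin 2) ℝ).symm fun i => x ⟨i.1, lt_of_lt_of_le i.2 hn⟩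

/-- The projection `x ↦ x'` onto the remaining `n - 2` coordinates. -/
def prC {n : ℕ} (hn : 2 ≤ n) (x : Euc n) : Euc (n - 2) :=
  (EuclideanSpace.equiv (Fin (n - 2)) ℝ).symm fun i => x ⟨i.1 + 2, by have := i.2; omega⟩

/-- The circle `∂B((0,x'),r) ∩ Π_{x'}`, for `p = (r, x')`. -/
def circFiber {n : ℕ} (hn : 2 ≤ n) (p : ℝ × Euc (n - 2)) : Set (Euc n) :=
  {y : Euc n | prC hn y = p.2 ∧ ‖pr12 hn y‖ = p.1}

/-- The circular slice `E_{(r,x')}`, for `p = (r, x')`. -/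
def cslice {n : ℕ} (hn : 2 ≤ n) (E : Set (Euc n)) (p : ℝ × Euc (n - 2)) : Set (Euc n) :=
  E ∩ circFiber hn p

/-- `E` is circularly `ℓ`-distributed. -/
def CircDistrib {n : ℕ} (hn : 2 ≤ n) (ℓ : ℝ × Euc (n - 2) → ℝ) (E : Set (Euc n)) : Prop :=
  ∀ᵐ p ∂(volume.restrict ((Ioi (0:ℝ)) ×ˢ (univ : Set (Euc (n - 2))))),
    μH[(1:ℝ)] (cslice hn E p) = ENNReal.ofReal (ℓ p)

/-- The circular symmetral `F^ℓ`. -/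
def circSymm {n : ℕ} (hn : 2 ≤ n) (ℓ : ℝ × Euc (n - 2) → ℝ) : Set (Euc n) :=
  {x : Euc n | pr12 hn x ≠ 0 ∧
    Real.arccos ⟪hatv (pr12 hn x), e1 2 (by norm_num)⟫
      < ℓ (‖pr12 hn x‖, prC hn x) / (2 * ‖pr12 hn x‖)}

/-- `Φ₁₂(B × S¹)`, for `B ⊆ (0,∞) × ℝ^{n-2}`. -/
def cylSet {n : ℕ} (hn : 2 ≤ n) (B : Set (ℝ × Euc (n - 2))) : Set (Euc n) :=
  {x : Euc n | pr12 hn x ≠ 0 ∧ (‖pr12 hn x‖, prC hn x) ∈ B}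

/-- The component `ν₁₂∥^E(x) = ν₁₂^E(x) - (ν^E(x)·x̂₁₂)x̂₁₂` of the normal. -/
def nu12par {n : ℕ} (hn : 2 ≤ n) (E : Set (Euc n)) (x : Euc n) : Euc 2 :=
  pr12 hn (mtNormal E x) - ⟪pr12 hn (mtNormal E x), hatv (pr12 hn x)⟫ • hatv (pr12 hn x)

/-- Density (with value `t`) at `x` of a subset `A` of the circle `circFiber hn p`,
with respect to the measure `H¹` on that circle. -/
def CircDensityAt {n : ℕ} (hn : 2 ≤ n) (A : Set (Euc n)) (p : ℝ × Euc (n - 2)) (x : Euc n)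
    (t : ℝ≥0∞) : Prop :=
  Tendsto (fun ρ : ℝ => μH[(1:ℝ)] (A ∩ ball x ρ) / μH[(1:ℝ)] (circFiber hn p ∩ ball x ρ))
    (𝓝[>] (0:ℝ)) (𝓝 t)

/-- The essential boundary, within the circle `circFiber hn p`, of a subset `A`. -/
def circEssBoundary {n : ℕ} (hn : 2 ≤ n) (A : Set (Euc n)) (p : ℝ × Euc (n - 2)) :
    Set (Euc n) :=
  {x | x ∈ circFiber hn p ∧ ¬ CircDensityAt hn A p x 0 ∧ ¬ CircDensityAt hn A p x 1}

/-- `f` has locally bounded variation on the open set `Ω`: on every open `U` compactly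
contained in `Ω` the distributional gradient of `f` has finite total variation. -/
def BVlocOn {W : Type*} [NormedAddCommGroup W] [NormedSpace ℝ W] [MeasureSpace W]
    (f : W → ℝ) (Ω : Set W) : Prop :=
  LocallyIntegrableOn f Ω volume ∧
    ∀ U : Set W, IsOpen U → IsCompact (closure U) → closure U ⊆ Ω →
      ∃ C : ℝ, ∀ g : W → W, ContDiff ℝ 1 g → HasCompactSupport g → tsupport g ⊆ U →
        (∀ x, ‖g x‖ ≤ 1) →
        (∫ x in U, f x * LinearMap.trace ℝ W (fderiv ℝ g x).toLinearMap) ≤ C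

/-- `f ∈ W^{1,1}_loc(Ω)` for `Ω ⊆ (0,∞) × ℝ^m`: `f` has a locally integrable weak
gradient `(g1, g2)` on `Ω`. -/
def W11locProd {m : ℕ} (f : ℝ × Euc m → ℝ) (Ω : Set (ℝ × Euc m)) : Prop :=
  ∃ (g1 : ℝ × Euc m → ℝ) (g2 : ℝ × Euc m → Euc m),
    LocallyIntegrableOn f Ω volume ∧ LocallyIntegrableOn g1 Ω volume ∧
      LocallyIntegrableOn g2 Ω volume ∧
      ∀ φ : ℝ × Euc m → ℝ, ContDiff ℝ 1 φ → HasCompactSupport φ → tsupport φ ⊆ Ω →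
        ∀ y : ℝ × Euc m,
          (∫ x in Ω, f x * fderiv ℝ φ x y) = -∫ x in Ω, φ x * (g1 x * y.1 + ⟪g2 x, y.2⟫)

/-- A pair of mutually singular measures `(σp, σm)` supported in `Ω₀ = (0,∞) × ℝ^m`,
locally finite there, representing the partial distributional derivative
`D_r ξ = σp - σm` of `ξ` in the radial variable. -/
def RepDerivR {m : ℕ} (ξ : ℝ × Euc m → ℝ) (σp σm : Measure (ℝ × Euc m)) : Prop :=
  σp ((Ioi (0:ℝ)) ×ˢ (univ : Set (Euc m)))ᶜ = 0 ∧
    σm ((Ioi (0:ℝ)) ×ˢ (univ : Set (Euc m)))ᶜ = 0 ∧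
    (∀ K : Set (ℝ × Euc m), K ⊆ (Ioi (0:ℝ)) ×ˢ univ → IsCompact K → σp K < ⊤ ∧ σm K < ⊤) ∧
    σp.MutuallySingular σm ∧
    ∀ φ : ℝ × Euc m → ℝ, ContDiff ℝ 1 φ → HasCompactSupport φ →
      tsupport φ ⊆ (Ioi (0:ℝ)) ×ˢ (univ : Set (Euc m)) →
      (∫ x in (Ioi (0:ℝ)) ×ˢ (univ : Set (Euc m)), ξ x * fderiv ℝ φ x ((1:ℝ), (0 : Euc m)))
        = (∫ x, φ x ∂σm) - ∫ x, φ x ∂σp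

/-- A polar representation `(τ, h)` (with `‖h‖ = 1` `τ`-a.e.) of the distributional
gradient `D_{x'} f = h τ` of `f` in the `x'` variables, on `Ω₀ = (0,∞) × ℝ^m`. -/
def RepDerivX {m : ℕ} (f : ℝ × Euc m → ℝ) (τ : Measure (ℝ × Euc m))
    (h : ℝ × Euc m → Euc m) : Prop :=
  τ ((Ioi (0:ℝ)) ×ˢ (univ : Set (Euc m)))ᶜ = 0 ∧
    (∀ K : Set (ℝ × Euc m), K ⊆ (Ioi (0:ℝ)) ×ˢ univ → IsCompact K → τ K < ⊤) ∧
    (∀ᵐ x ∂τ, ‖h x‖ = 1) ∧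
    ∀ φ : ℝ × Euc m → ℝ, ContDiff ℝ 1 φ → HasCompactSupport φ →
      tsupport φ ⊆ (Ioi (0:ℝ)) ×ˢ (univ : Set (Euc m)) →
      ∀ y : Euc m,
        (∫ x in (Ioi (0:ℝ)) ×ˢ (univ : Set (Euc m)), f x * fderiv ℝ φ x ((0:ℝ), y))
          = -∫ x, φ x * ⟪h x, y⟫ ∂τ

/-- The barycentre function `b_E(r) = r^{1-n} ∫_{E_r} x̂ dH^{n-1}`. -/
def bary (n : ℕ) (E : Set (Euc n)) (r : ℝ) : Euc n :=
  (r ^ (n - 1))⁻¹ • ∫ x in E ∩ sphere (0 : Euc n) r, hatv x ∂μH[(n : ℝ) - 1]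

/-- The average direction `d_E(r)` of the slice `E_r`. -/
def avgDir (n : ℕ) (α : ℝ → ℝ) (E : Set (Euc n)) (r : ℝ) : Euc n :=
  (omegaBall (n - 1) * Real.sin (α r) ^ (n - 1) * r ^ (n - 1))⁻¹ •
    ∫ x in E ∩ sphere (0 : Euc n) r, hatv x ∂μH[(n : ℝ) - 1]

end


section SecA1
open MeasureTheory Metric Set Filter
open scoped ENNReal NNReal Topology RealInnerProductSpace
set_option linter.all false
set_option linter.deprecated false

/-- Density zero (quantitative form). -/
def DZ {Z : Type*} [PseudoMetricSpace Z] [MeasurableSpace Z] (μ : Measure Z) (d : ℕ)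
    (E : Set Z) (x : Z) : Prop :=
  ∀ ε : ℝ, 0 < ε → ∃ δ : ℝ, 0 < δ ∧ ∀ ρ : ℝ, 0 < ρ → ρ < δ →
    μ (E ∩ ball x ρ) ≤ ENNReal.ofReal (ε * ρ ^ d)

section DZgen
variable {Z : Type*} [PseudoMetricSpace Z] [MeasurableSpace Z] {μ : Measure Z} {d : ℕ}
  {E F : Set Z} {x : Z}

theorem DZ.mono_ae (h : DZ μ d E x) (hs : ∀ᵐ y ∂μ, y ∈ F → y ∈ E) : DZ μ d F x := by
  intro ε hε
  obtain ⟨δ, hδ, H⟩ := h ε hε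
  refine ⟨δ, hδ, fun ρ h1 h2 => le_trans (measure_mono_ae ?_) (H ρ h1 h2)⟩
  filter_upwards [hs] with y hy hyF
  exact ⟨hy hyF.1, hyF.2⟩

theorem DZ.mono (h : DZ μ d E x) (hs : F ⊆ E) : DZ μ d F x :=
  h.mono_ae (Eventually.of_forall hs)

theorem DZ.union (h : DZ μ d E x) (h' : DZ μ d F x) : DZ μ d (E ∪ F) x := by
  intro ε hε
  obtain ⟨δ, hδ, H⟩ := h (ε/2) (by positivity)
  obtain ⟨δ', hδ', H'⟩ := h' (ε/2) (by positivity)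
  refine ⟨min δ δ', lt_min hδ hδ', fun ρ h1 h2 => ?_⟩
  rw [union_inter_distrib_right]
  calc μ (E ∩ ball x ρ ∪ F ∩ ball x ρ) ≤ _ := measure_union_le _ _
    _ ≤ ENNReal.ofReal (ε/2 * ρ^d) + ENNReal.ofReal (ε/2 * ρ^d) :=
      add_le_add (H ρ h1 (h2.trans_le (min_le_left _ _))) (H' ρ h1 (h2.trans_le (min_le_right _ _)))
    _ = ENNReal.ofReal (ε * ρ^d) := by
      rw [← ENNReal.ofReal_add (by positivity) (by positivity)]; congr 1; ring

/-- local version -/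
theorem DZ.mono_loc (h : DZ μ d E x) {r : ℝ} (hr : 0 < r)
    (hs : ∀ᵐ y ∂μ, y ∈ ball x r → y ∈ F → y ∈ E) : DZ μ d F x := by
  intro ε hε
  obtain ⟨δ, hδ, H⟩ := h ε hε
  refine ⟨min δ r, lt_min hδ hr, fun ρ h1 h2 => le_trans (measure_mono_ae ?_) (H ρ h1 (h2.trans_le (min_le_left _ _)))⟩
  filter_upwards [hs] with y hy hyF
  exact ⟨hy (ball_subset_ball (h2.le.trans (min_le_right _ _)) hyF.2) hyF.1, hyF.2⟩

theorem DZ.of_empty_loc {r : ℝ} (hr : 0 < r)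
    (hs : ∀ᵐ y ∂μ, y ∈ ball x r → y ∉ F) : DZ μ d F x := by
  have : DZ μ d (∅ : Set Z) x := fun ε hε => ⟨1, one_pos, by simp⟩
  refine this.mono_loc hr ?_
  filter_upwards [hs] with y hy h1 h2
  exact absurd h2 (hy h1)

/-- The closed pieces of the set of density zero points. -/
def CZ (μ : Measure Z) (d : ℕ) (E : Set Z) (ε δ : ℝ) : Set Z :=
  {x | ∀ ρ : ℝ, 0 < ρ → ρ < δ → μ (E ∩ ball x ρ) ≤ ENNReal.ofReal (ε * ρ ^ d)}

theorem isClosed_CZ (ε δ : ℝ) : IsClosed (CZ μ d E ε δ) := by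
  rw [← isSeqClosed_iff_isClosed]
  intro xs x hxs hx ρ h1 h2
  have hU : E ∩ ball x ρ = ⋃ k : ℕ, E ∩ ball x (ρ - 1/((k:ℝ)+1)) := by
    rw [← inter_iUnion]; congr 1
    apply Subset.antisymm
    · intro y hy
      obtain ⟨k, hk⟩ := exists_nat_one_div_lt (sub_pos.2 (mem_ball.1 hy))
      exact mem_iUnion.2 ⟨k, by rw [mem_ball]; linarith⟩
    · exact iUnion_subset fun k => ball_subset_ball (by
        have : (0:ℝ) ≤ 1/((k:ℝ)+1) := by positivity
        linarith)
  have hm : Monotone (fun k : ℕ => E ∩ ball x (ρ - 1/((k:ℝ)+1))) := by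
    intro a b hab
    apply inter_subset_inter_right
    apply ball_subset_ball
    have : 1/((b:ℝ)+1) ≤ 1/((a:ℝ)+1) := Nat.one_div_le_one_div hab
    linarith
  rw [hU, hm.measure_iUnion]
  refine iSup_le fun k => ?_
  have hpos : (0:ℝ) < 1/((k:ℝ)+1) := by positivity
  obtain ⟨N, hN⟩ := (Metric.tendsto_atTop.1 hx) _ hpos
  refine le_trans (measure_mono ?_) (hxs N ρ h1 h2)
  apply inter_subset_inter_right
  apply ball_subset_ball'
  rw [dist_comm]
  have := hN N le_rfl
  linarith

theorem DZ_iff_CZ : DZ μ d E x ↔ ∀ k : ℕ, ∃ j : ℕ, x ∈ CZ μ d E (1/((k:ℝ)+1)) (1/((j:ℝ)+1)) := by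
  constructor
  · intro h k
    obtain ⟨δ, hδ, H⟩ := h (1/((k:ℝ)+1)) (by positivity)
    obtain ⟨j, hj⟩ := exists_nat_one_div_lt hδ
    exact ⟨j, fun ρ h1 h2 => H ρ h1 (h2.trans hj)⟩
  · intro h ε hε
    obtain ⟨k, hk⟩ := exists_nat_one_div_lt hε
    obtain ⟨j, hj⟩ := h k
    refine ⟨_, by positivity, fun ρ h1 h2 => (hj ρ h1 h2).trans ?_⟩
    gcongr

theorem measurableSet_DZ [OpensMeasurableSpace Z] : MeasurableSet {x | DZ μ d E x} := by
  have : {x | DZ μ d E x} = ⋂ k : ℕ, ⋃ j : ℕ, CZ μ d E (1/((k:ℝ)+1)) (1/((j:ℝ)+1)) := by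
    ext x; simp only [mem_setOf_eq, DZ_iff_CZ, mem_iInter, mem_iUnion]
  rw [this]
  exact MeasurableSet.iInter fun k => MeasurableSet.iUnion fun j => (isClosed_CZ _ _).measurableSet
end DZgen

section DZnorm
variable {Z : Type*} [NormedAddCommGroup Z] [NormedSpace ℝ Z] [FiniteDimensional ℝ Z]
  [MeasurableSpace Z] [BorelSpace Z] {μ : Measure Z} [μ.IsAddHaarMeasure] {E : Set Z} {x : Z}
open Module

theorem ball_one_ne_top : μ (ball (0:Z) 1) ≠ ⊤ := measure_ball_lt_top.ne
theorem ball_one_ne_zero : μ (ball (0:Z) 1) ≠ 0 := (measure_ball_pos μ 0 one_pos).ne'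

theorem DZ_of_ratio (h : ∀ ε : ℝ, 0 < ε → ∃ δ : ℝ, 0 < δ ∧ ∀ ρ : ℝ, 0 < ρ → ρ < δ →
    μ (E ∩ ball x ρ) ≤ ENNReal.ofReal ε * μ (ball x ρ)) : DZ μ (finrank ℝ Z) E x := by
  intro ε hε
  set c := (μ (ball (0:Z) 1)).toReal with hc
  have hc0 : 0 < c := ENNReal.toReal_pos ball_one_ne_zero ball_one_ne_top
  obtain ⟨δ, hδ, H⟩ := h (ε / c) (by positivity)
  refine ⟨δ, hδ, fun ρ h1 h2 => (H ρ h1 h2).trans ?_⟩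
  rw [Measure.addHaar_ball_of_pos μ x h1, ← ENNReal.ofReal_toReal (ball_one_ne_top (μ := μ) (Z := Z)), ← hc,
    ← ENNReal.ofReal_mul (by positivity), ← ENNReal.ofReal_mul (by positivity)]
  apply le_of_eq; congr 1; field_simp

theorem DZ.ratio (h : DZ μ (finrank ℝ Z) E x) : ∀ ε : ℝ, 0 < ε → ∃ δ : ℝ, 0 < δ ∧ ∀ ρ : ℝ, 0 < ρ → ρ < δ →
    μ (E ∩ ball x ρ) ≤ ENNReal.ofReal ε * μ (ball x ρ) := by
  intro ε hε
  set c := (μ (ball (0:Z) 1)).toReal with hc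
  have hc0 : 0 < c := ENNReal.toReal_pos ball_one_ne_zero ball_one_ne_top
  obtain ⟨δ, hδ, H⟩ := h (ε * c) (by positivity)
  refine ⟨δ, hδ, fun ρ h1 h2 => (H ρ h1 h2).trans ?_⟩
  rw [Measure.addHaar_ball_of_pos μ x h1, ← ENNReal.ofReal_toReal (ball_one_ne_top (μ := μ) (Z := Z)), ← hc,
    ← ENNReal.ofReal_mul (by positivity), ← ENNReal.ofReal_mul (by positivity)]
  apply le_of_eq; congr 1; ring

theorem DZ_iff_tendsto : DZ μ (finrank ℝ Z) E x ↔
    Tendsto (fun ρ : ℝ => μ (E ∩ ball x ρ) / μ (ball x ρ)) (𝓝[>] (0:ℝ)) (𝓝 0) := by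
  constructor
  · intro h
    rw [ENNReal.tendsto_nhds_zero]
    intro ε hε
    obtain ⟨e, he0, he⟩ : ∃ e : ℝ, 0 < e ∧ ENNReal.ofReal e ≤ ε := by
      rcases eq_or_ne ε ⊤ with rfl | ht
      · exact ⟨1, one_pos, le_top⟩
      · exact ⟨ε.toReal, ENNReal.toReal_pos hε.ne' ht, by rw [ENNReal.ofReal_toReal ht]⟩
    obtain ⟨δ, hδ, H⟩ := h.ratio e he0
    filter_upwards [Ioo_mem_nhdsGT hδ] with ρ hρ
    refine le_trans ?_ he
    exact ENNReal.div_le_of_le_mul (H ρ hρ.1 hρ.2)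
  · intro h
    apply DZ_of_ratio
    intro ε hε
    rw [ENNReal.tendsto_nhds_zero] at h
    have := h (ENNReal.ofReal ε) (by simpa using hε)
    obtain ⟨δ, hδ, H⟩ := (mem_nhdsGT_iff_exists_Ioo_subset).1 this
    refine ⟨δ, hδ, fun ρ h1 h2 => ?_⟩
    have h3 : μ (E ∩ ball x ρ) / μ (ball x ρ) ≤ ENNReal.ofReal ε := H ⟨h1, h2⟩
    rwa [ENNReal.div_le_iff_le_mul (Or.inl (measure_ball_pos μ x h1).ne') (Or.inl measure_ball_lt_top.ne)] at h3

theorem DZ_excl (h : DZ μ (finrank ℝ Z) E x) (h' : DZ μ (finrank ℝ Z) Eᶜ x) : False := by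
  obtain ⟨δ, hδ, H⟩ := h.ratio (1/4) (by norm_num)
  obtain ⟨δ', hδ', H'⟩ := h'.ratio (1/4) (by norm_num)
  set ρ := min δ δ' / 2 with hρ
  have hm : 0 < min δ δ' := lt_min hδ hδ'
  have h0 : 0 < ρ := by positivity
  have h1 := H ρ h0 (lt_of_lt_of_le (by linarith) (min_le_left δ δ'))
  have h2 := H' ρ h0 (lt_of_lt_of_le (by linarith) (min_le_right δ δ'))
  have h3 : μ (ball x ρ) ≤ ENNReal.ofReal (1/2) * μ (ball x ρ) := by
    calc μ (ball x ρ) ≤ μ (E ∩ ball x ρ) + μ (Eᶜ ∩ ball x ρ) := by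
          refine le_trans (measure_mono ?_) (measure_union_le _ _)
          intro y hy
          by_cases hyE : y ∈ E
          · exact Or.inl ⟨hyE, hy⟩
          · exact Or.inr ⟨hyE, hy⟩
      _ ≤ _ := add_le_add h1 h2
      _ = _ := by rw [← add_mul, ← ENNReal.ofReal_add (by norm_num) (by norm_num)]; norm_num
  have hp := (measure_ball_pos μ x h0).ne'
  have ht : μ (ball x ρ) ≠ ⊤ := measure_ball_lt_top.ne
  have : ENNReal.ofReal (1/2) * μ (ball x ρ) < 1 * μ (ball x ρ) := by
    rw [ENNReal.mul_lt_mul_iff_left hp ht]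
    simp
  rw [one_mul] at this
  exact absurd h3 (not_le.2 this)

theorem ae_DZ_of_notMem (hE : MeasurableSet E) : ∀ᵐ x ∂μ, x ∉ E → DZ μ (finrank ℝ Z) E x := by
  filter_upwards [Besicovitch.ae_tendsto_measure_inter_div_of_measurableSet μ hE] with x hx hxE
  simp only [hxE, not_false_eq_true, indicator_of_notMem] at hx
  apply DZ_of_ratio
  intro ε hε
  rw [ENNReal.tendsto_nhds_zero] at hx
  have := hx (ENNReal.ofReal ε) (by simpa using hε)
  obtain ⟨δ, hδ, H⟩ := (mem_nhdsGT_iff_exists_Ioo_subset).1 this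
  refine ⟨δ, hδ, fun ρ h1 h2 => ?_⟩
  have h3 : μ (E ∩ closedBall x ρ) / μ (closedBall x ρ) ≤ ENNReal.ofReal ε := H ⟨h1, h2⟩
  rw [ENNReal.div_le_iff_le_mul (Or.inl (measure_closedBall_pos μ x h1).ne') (Or.inl measure_closedBall_lt_top.ne),
    Measure.addHaar_closedBall μ x h1.le, ← Measure.addHaar_ball_of_pos μ x h1] at h3
  exact (measure_mono (inter_subset_inter_right _ ball_subset_closedBall)).trans h3

theorem ae_DZ_of_mem (hE : MeasurableSet E) : ∀ᵐ x ∂μ, x ∈ E → DZ μ (finrank ℝ Z) Eᶜ x := by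
  filter_upwards [ae_DZ_of_notMem (μ := μ) hE.compl] with x hx hxE
  exact hx (by simpa using hxE)
end DZnorm

section Eucl
variable {n : ℕ} {E : Set (Euc n)} {x : Euc n}

theorem densityAt_zero_iff : DensityAt E x 0 ↔ DZ volume n E x := by
  have := DZ_iff_tendsto (μ := (volume : Measure (Euc n))) (E := E) (x := x)
  rw [finrank_euclideanSpace_fin] at this
  exact this.symm

theorem densityAt_one_iff (hE : MeasurableSet E) : DensityAt E x 1 ↔ DZ volume n Eᶜ x := by
  rw [← densityAt_zero_iff]
  have key : ∀ ρ : ℝ, 0 < ρ → volume (E ∩ ball x ρ) / volume (ball x ρ) +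
      volume (Eᶜ ∩ ball x ρ) / volume (ball x ρ) = 1 := by
    intro ρ hρ
    rw [← ENNReal.add_div, inter_comm E, inter_comm Eᶜ, ← diff_eq, measure_inter_add_diff _ hE]
    exact ENNReal.div_self (measure_ball_pos _ x hρ).ne' measure_ball_lt_top.ne
  have key1 : ∀ ρ : ℝ, 0 < ρ → volume (E ∩ ball x ρ) / volume (ball x ρ) = 1 - 
      volume (Eᶜ ∩ ball x ρ) / volume (ball x ρ) := by
    intro ρ hρ
    have := key ρ hρ
    refine ENNReal.eq_sub_of_add_eq ?_ this
    exact ne_top_of_le_ne_top ENNReal.one_ne_top (this ▸ le_add_self)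
  have key2 : ∀ ρ : ℝ, 0 < ρ → volume (Eᶜ ∩ ball x ρ) / volume (ball x ρ) = 1 - 
      volume (E ∩ ball x ρ) / volume (ball x ρ) := by
    intro ρ hρ
    have := key ρ hρ
    refine ENNReal.eq_sub_of_add_eq ?_ ((add_comm _ _).trans this)
    exact ne_top_of_le_ne_top ENNReal.one_ne_top (this ▸ le_self_add)
  constructor
  · intro h
    have h1 := ENNReal.Tendsto.sub (tendsto_const_nhds (x := (1:ℝ≥0∞)) (f := 𝓝[>] (0:ℝ))) h (Or.inl ENNReal.one_ne_top)
    simp only [tsub_self] at h1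
    refine h1.congr' ?_
    filter_upwards [self_mem_nhdsWithin] with ρ hρ
    exact (key2 ρ hρ).symm
  · intro h
    have h1 := ENNReal.Tendsto.sub (tendsto_const_nhds (x := (1:ℝ≥0∞)) (f := 𝓝[>] (0:ℝ))) h (Or.inl ENNReal.one_ne_top)
    simp only [tsub_zero] at h1
    refine h1.congr' ?_
    filter_upwards [self_mem_nhdsWithin] with ρ hρ
    exact (key1 ρ hρ).symm

theorem mem_essBoundary_iff (hE : MeasurableSet E) :
    x ∈ essBoundary E ↔ ¬ DZ volume n E x ∧ ¬ DZ volume n Eᶜ x := by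
  rw [essBoundary, mem_setOf_eq, densityAt_zero_iff, densityAt_one_iff hE]

theorem notMem_essBoundary_iff (hE : MeasurableSet E) :
    x ∉ essBoundary E ↔ DZ volume n E x ∨ DZ volume n Eᶜ x := by
  rw [mem_essBoundary_iff hE]; tauto

theorem measurableSet_essBoundary (hE : MeasurableSet E) : MeasurableSet (essBoundary E) := by
  have : essBoundary E = {x | DZ volume n E x}ᶜ ∩ {x | DZ volume n Eᶜ x}ᶜ := by
    ext x; rw [mem_essBoundary_iff hE]; rfl
  rw [this]
  exact measurableSet_DZ.compl.inter measurableSet_DZ.compl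

theorem DZ_excl' (h : DZ volume n E x) (h' : DZ volume n Eᶜ x) : False := by
  have := DZ_excl (μ := (volume : Measure (Euc n))) (E := E) (x := x)
  rw [finrank_euclideanSpace_fin] at this
  exact this h h'

theorem ae_DZ_iff (hE : MeasurableSet E) : ∀ᵐ x : Euc n, (x ∉ E ↔ DZ volume n E x) ∧
    (x ∈ E ↔ DZ volume n Eᶜ x) := by
  have h1 := ae_DZ_of_notMem (μ := (volume : Measure (Euc n))) hE
  have h2 := ae_DZ_of_mem (μ := (volume : Measure (Euc n))) hE
  rw [finrank_euclideanSpace_fin] at h1 h2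
  filter_upwards [h1, h2] with x h1 h2
  refine ⟨⟨h1, fun h hx => DZ_excl' h (h2 hx)⟩, ⟨h2, fun h => ?_⟩⟩
  by_contra hx
  exact DZ_excl' (h1 hx) h
end Eucl

end SecA1

section SecA2
open MeasureTheory Metric Set Filter
open scoped ENNReal NNReal Topology RealInnerProductSpace
set_option linter.all false
set_option linter.deprecated false

/-- Topological lemma on an interval. -/
theorem baire_interval (a b : ℝ) (P : Bool → ℝ → Prop) (C : Bool → ℕ → Set ℝ)
    (hC : ∀ i k, IsClosed (C i k))
    (hcov : ∀ t ∈ Icc a b, P true t ∨ P false t)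
    (hPC : ∀ i, ∀ t ∈ Icc a b, P i t → ∃ k, t ∈ C i k)
    (hCP : ∀ i k t, t ∈ C i k → ¬ P (!i) t)
    (hup : ∀ i k c t, c ∈ C i k → c < t → (∀ s ∈ Ioo c t, P (!i) s) → False)
    (hdn : ∀ i k c t, c ∈ C i k → t < c → (∀ s ∈ Ioo t c, P (!i) s) → False) :
    (∀ t ∈ Icc a b, P true t) ∨ (∀ t ∈ Icc a b, P false t) := by
  set T : Bool → Set ℝ := fun i => {t | t ∈ Icc a b ∧ P i t} with hT
  have hcov' : ∀ i, ∀ t ∈ Icc a b, P i t ∨ P (!i) t := by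
    intro i t ht; cases i
    · exact (hcov t ht).symm
    · exact hcov t ht
  have hcl : ∀ i, closure (T i) ⊆ Icc a b := fun i => closure_minimal (fun t ht => ht.1) isClosed_Icc
  set D : Set ℝ := closure (T true) ∩ closure (T false) with hD
  have hDcl : IsClosed D := isClosed_closure.inter isClosed_closure
  have hDi : ∀ i, D = closure (T i) ∩ closure (T (!i)) := by
    intro i; cases i
    · exact inter_comm _ _
    · rfl
  have hDI : D ⊆ Icc a b := fun t ht => hcl _ ht.1
  -- connectedness
  have hconn : ∀ i (J : Set ℝ), J ⊆ Icc a b → IsPreconnected J → J ∩ D = ∅ → (J ∩ T (!i)).Nonempty →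
      ∀ s ∈ J, P (!i) s := by
    intro i J hJ hJc hJD hne s hs
    by_contra hPs
    have hsT : s ∈ T i := ⟨hJ hs, (hcov' i s (hJ hs)).resolve_right hPs⟩
    have := isPreconnected_closed_iff.1 hJc (closure (T i)) (closure (T (!i))) isClosed_closure
      isClosed_closure (fun x hx => (hcov' i x (hJ hx)).imp (fun h => subset_closure ⟨hJ hx, h⟩)
        (fun h => subset_closure ⟨hJ hx, h⟩)) ⟨s, hs, subset_closure hsT⟩
        (hne.mono (inter_subset_inter_right _ subset_closure))
    rw [← hDi i, hJD] at this
    exact not_nonempty_empty this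
  rcases eq_empty_or_nonempty D with hDe | hDne
  · by_cases hne : (T true).Nonempty
    · left
      have := hconn false (Icc a b) le_rfl isPreconnected_Icc (by rw [hDe, inter_empty])
        (hne.mono (fun t ht => ⟨ht.1, ht⟩))
      simpa using this
    · right
      intro t ht
      exact (hcov t ht).resolve_left fun h => hne ⟨t, ht, h⟩
  · exfalso
    have : Nonempty D := hDne.to_subtype
    have : CompleteSpace D := hDcl.completeSpace_coe
    obtain ⟨⟨i, k⟩, hik⟩ := nonempty_interior_of_iUnion_of_closed
      (f := fun p : Bool × ℕ => (Subtype.val ⁻¹' (C p.1 p.2) : Set D))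
      (fun p => (hC _ _).preimage continuous_subtype_val) (by
        rw [eq_univ_iff_forall]
        rintro ⟨t, ht⟩
        rw [mem_iUnion]
        rcases hcov t (hDI ht) with h | h
        · obtain ⟨k, hk⟩ := hPC true t (hDI ht) h
          exact ⟨(true, k), hk⟩
        · obtain ⟨k, hk⟩ := hPC false t (hDI ht) h
          exact ⟨(false, k), hk⟩)
    obtain ⟨⟨d, hdD⟩, hd⟩ := hik
    rw [mem_interior_iff_mem_nhds, Metric.mem_nhds_iff] at hd
    obtain ⟨ε, hε, hball⟩ := hd
    have hU : ∀ t ∈ D, |t - d| < ε → t ∈ C i k := fun t ht h =>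
      hball (show (⟨t, ht⟩ : D) ∈ ball ⟨d, hdD⟩ ε from by
        rw [mem_ball, Subtype.dist_eq, Real.dist_eq]; exact h)
    have hd' : d ∈ closure (T (!i)) := by
      have := hdD; rw [hDi i] at this; exact this.2
    obtain ⟨t, htT, htd⟩ := Metric.mem_closure_iff.1 hd' ε hε
    rw [Real.dist_eq] at htd
    have htD : t ∉ D := fun h => hCP i k t (hU t h (by rwa [abs_sub_comm])) htT.2
    rcases lt_or_gt_of_ne (show d ≠ t from fun h => htD (h ▸ hdD)) with hlt | hlt
    · have hK : IsCompact (D ∩ Icc d t) := isCompact_Icc.inter_left hDcl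
      have hKne : (D ∩ Icc d t).Nonempty := ⟨d, hdD, left_mem_Icc.2 hlt.le⟩
      obtain ⟨c, ⟨hcD, hc1, hc2⟩, hcmax⟩ := hK.exists_isGreatest hKne
      have hct : c < t := lt_of_le_of_ne hc2 (fun h => htD (h ▸ hcD))
      rw [abs_of_neg (by linarith)] at htd
      refine hup i k c t (hU c hcD (by rw [abs_of_nonneg (by linarith)]; linarith)) hct ?_
      have := hconn i (Ioc c t) (fun s hs => ⟨(hDI hcD).1.trans hs.1.le, hs.2.trans htT.1.2⟩)
        isPreconnected_Ioc (by
          rw [eq_empty_iff_forall_notMem]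
          rintro s ⟨hs, hsD⟩
          exact absurd (hcmax ⟨hsD, hc1.trans hs.1.le, hs.2⟩) (not_le.2 hs.1)) ⟨t, ⟨hct, le_rfl⟩, htT⟩
      exact fun s hs => this s ⟨hs.1, hs.2.le⟩
    · have hK : IsCompact (D ∩ Icc t d) := isCompact_Icc.inter_left hDcl
      have hKne : (D ∩ Icc t d).Nonempty := ⟨d, hdD, right_mem_Icc.2 hlt.le⟩
      obtain ⟨c, ⟨hcD, hc1, hc2⟩, hcmax⟩ := hK.exists_isLeast hKne
      have hct : t < c := lt_of_le_of_ne hc1 (fun h => htD (h ▸ hcD))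
      rw [abs_of_pos (by linarith)] at htd
      refine hdn i k c t (hU c hcD (by rw [abs_of_nonpos (by linarith)]; linarith)) hct ?_
      have := hconn i (Ico t c) (fun s hs => ⟨htT.1.1.trans hs.1, hs.2.le.trans (hDI hcD).2⟩)
        isPreconnected_Ico (by
          rw [eq_empty_iff_forall_notMem]
          rintro s ⟨hs, hsD⟩
          exact absurd (hcmax ⟨hsD, hs.1, hs.2.le.trans hc2⟩) (not_le.2 hs.2)) ⟨t, ⟨le_rfl, hct⟩, htT⟩
      exact fun s hs => this s ⟨hs.1.le, hs.2⟩

section KeyProd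
open Module
variable {Y : Type*} [NormedAddCommGroup Y] [NormedSpace ℝ Y] [FiniteDimensional ℝ Y]
  [MeasurableSpace Y] [BorelSpace Y] {ν : Measure Y} [ν.IsAddHaarMeasure]

theorem bad_null_piece {A : Set (Y × ℝ)} (hA : MeasurableSet A) {η δ s : ℝ} (hη0 : 0 < η)
    (hη : η * 3 ^ (finrank ℝ Y + 1) < (ν (ball (0:Y) 1)).toReal / 4)
    (hδ : 0 < δ) (hs : 0 < s) (j : ℤ) :
    ν {y | ∃ c, j * (s/2) ≤ c ∧ c < (j+1) * (s/2) ∧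
      (y, c) ∈ CZ (ν.prod volume) (finrank ℝ Y + 1) A η δ ∧
      ∀ᵐ t : ℝ, t ∈ Ioo c (c + s) → (y, t) ∈ A} = 0 := by
  set Bad := {y | ∃ c, j * (s/2) ≤ c ∧ c < (j+1) * (s/2) ∧
      (y, c) ∈ CZ (ν.prod volume) (finrank ℝ Y + 1) A η δ ∧
      ∀ᵐ t : ℝ, t ∈ Ioo c (c + s) → (y, t) ∈ A} with hBad
  by_contra hne
  have hrest : ν.restrict Bad ≠ 0 := by rwa [Ne, Measure.restrict_eq_zero]
  have : (ae (ν.restrict Bad)).NeBot := ae_neBot.2 hrest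
  obtain ⟨y0, hy0⟩ := (Besicovitch.ae_tendsto_measure_inter_div ν Bad).exists
  have hev : ∀ᶠ r in 𝓝[>] (0:ℝ), (1/2 : ℝ≥0∞) < ν (Bad ∩ closedBall y0 r) / ν (closedBall y0 r) :=
    hy0.eventually (lt_mem_nhds (by simp))
  obtain ⟨r, ⟨hr1, hr0, hr2⟩⟩ := (hev.and (Ioo_mem_nhdsGT (show (0:ℝ) < min (s/2) (δ/3) by positivity))).exists
  have hrs : r < s/2 := hr2.trans_le (min_le_left _ _)
  have hrδ : 3 * r < δ := by have := hr2.trans_le (min_le_right _ _); linarith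
  set m := finrank ℝ Y
  have hcb : ν (closedBall y0 r) = ENNReal.ofReal (r ^ m * (ν (ball (0:Y) 1)).toReal) := by
    rw [Measure.addHaar_closedBall ν y0 hr0.le, ENNReal.ofReal_mul (by positivity), ENNReal.ofReal_toReal ball_one_ne_top]
  set S := Bad ∩ closedBall y0 r with hS
  have hSm : (1/2) * ν (closedBall y0 r) ≤ ν S := by
    rw [ENNReal.lt_div_iff_mul_lt (Or.inl (measure_closedBall_pos ν y0 hr0).ne') (Or.inl measure_closedBall_lt_top.ne)] at hr1
    exact hr1.le
  have hSne : S.Nonempty := by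
    rw [nonempty_iff_ne_empty]
    intro h
    rw [h] at hr1; simp at hr1
  have hch : ∀ y : Y, ∃ c : ℝ, y ∈ Bad → j * (s/2) ≤ c ∧ c < (j+1) * (s/2) ∧
      (y, c) ∈ CZ (ν.prod volume) (m + 1) A η δ ∧ ∀ᵐ t : ℝ, t ∈ Ioo c (c + s) → (y, t) ∈ A := by
    intro y
    by_cases h : y ∈ Bad
    · obtain ⟨c, hc⟩ := h
      exact ⟨c, fun _ => hc⟩
    · exact ⟨0, fun h' => absurd h' h⟩
  choose c hc using hch
  have hbdd : BddAbove (c '' S) := ⟨(j+1)*(s/2), by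
    rintro _ ⟨y, hy, rfl⟩; exact (hc y hy.1).2.1.le⟩
  obtain ⟨_, ⟨b, hbS, rfl⟩, hb⟩ := exists_lt_of_lt_csSup (hSne.image c) (sub_lt_self (sSup (c '' S)) (half_pos hr0))
  obtain ⟨hb1, hb2, hb3, -⟩ := hc b hbS.1
  set I := Ioo (c b + r/2) (c b + r) with hI
  have hsub : A ∩ (closedBall y0 r ×ˢ I) ⊆ A ∩ ball (b, c b) (3*r) := by
    apply inter_subset_inter_right
    rintro ⟨y, t⟩ ⟨hy, ht⟩
    simp only at hy ht
    rw [mem_ball, Prod.dist_eq, max_lt_iff]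
    constructor
    · have h1 : dist y y0 ≤ r := hy
      have h2 : dist b y0 ≤ r := hbS.2
      have := dist_triangle_right y b y0
      show dist y b < 3 * r
      linarith
    · show dist t (c b) < 3*r
      rw [Real.dist_eq, abs_lt]
      constructor <;> linarith [ht.1, ht.2]
  have hup := (measure_mono hsub).trans (hb3 (3*r) (by linarith) hrδ)
  have hmeas : MeasurableSet (A ∩ (closedBall y0 r ×ˢ I)) :=
    hA.inter (measurableSet_closedBall.prod measurableSet_Ioo)
  rw [Measure.prod_apply hmeas] at hup
  set φ : Y → ℝ≥0∞ := fun y => volume (Prod.mk y ⁻¹' (A ∩ (closedBall y0 r ×ˢ I))) with hφ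
  have hSφ : S ⊆ {y | ENNReal.ofReal (r/2) ≤ φ y} := by
    intro y hy
    obtain ⟨h1, h2, h3, h4⟩ := hc y hy.1
    have hcy : c y ≤ sSup (c '' S) := le_csSup hbdd (mem_image_of_mem _ hy)
    show _ ≤ φ y
    have : volume I = ENNReal.ofReal (r/2) := by rw [hI, Real.volume_Ioo]; congr 1; ring
    rw [← this]
    apply measure_mono_ae
    filter_upwards [h4] with t ht htI
    refine ⟨ht ⟨by linarith [htI.1], ?_⟩, hy.2, htI⟩
    have := htI.2
    nlinarith [htI.2]
  have hlow : ENNReal.ofReal (r/2) * ν S ≤ ENNReal.ofReal (η * (3*r)^(m+1)) :=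
    calc ENNReal.ofReal (r/2) * ν S ≤ ENNReal.ofReal (r/2) * ν {y | ENNReal.ofReal (r/2) ≤ φ y} := by gcongr
      _ ≤ ∫⁻ y, φ y ∂ν := mul_meas_ge_le_lintegral (measurable_measure_prodMk_left hmeas) _
      _ ≤ _ := hup
  have hfin : ENNReal.ofReal (r/2) * (ENNReal.ofReal (1/2) * ENNReal.ofReal (r ^ m * (ν (ball (0:Y) 1)).toReal)) ≤ ENNReal.ofReal (η * (3*r)^(m+1)) := by
    refine le_trans ?_ hlow
    rw [← hcb]
    have h12 : ENNReal.ofReal (1/2) = 1/2 := by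
      rw [ENNReal.ofReal_div_of_pos (by norm_num)]; simp
    rw [h12]
    gcongr
  rw [← ENNReal.ofReal_mul (by norm_num), ← ENNReal.ofReal_mul (by positivity),
    ENNReal.ofReal_le_ofReal_iff (by positivity)] at hfin
  have hrm : 0 < r ^ (m+1) := by positivity
  have : r / 2 * (1/2 * (r^m * (ν (ball (0:Y) 1)).toReal)) = r^(m+1) * ((ν (ball (0:Y) 1)).toReal / 4) := by ring
  rw [this, mul_pow] at hfin
  have h3 : r^(m+1) * (η * 3 ^ (m+1)) < r^(m+1) * ((ν (ball (0:Y) 1)).toReal / 4) := by gcongr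
  linarith

theorem bad_null {A : Set (Y × ℝ)} (hA : MeasurableSet A) {η δ s : ℝ} (hη0 : 0 < η)
    (hη : η * 3 ^ (finrank ℝ Y + 1) < (ν (ball (0:Y) 1)).toReal / 4)
    (hδ : 0 < δ) (hs : 0 < s) :
    ∀ᵐ y ∂ν, ∀ c, (y, c) ∈ CZ (ν.prod volume) (finrank ℝ Y + 1) A η δ →
      ¬ ∀ᵐ t : ℝ, t ∈ Ioo c (c + s) → (y, t) ∈ A := by
  have : ∀ j : ℤ, ∀ᵐ y ∂ν, ¬ ∃ c, j * (s/2) ≤ c ∧ c < (j+1) * (s/2) ∧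
      (y, c) ∈ CZ (ν.prod volume) (finrank ℝ Y + 1) A η δ ∧
      ∀ᵐ t : ℝ, t ∈ Ioo c (c + s) → (y, t) ∈ A := fun j => by
    rw [ae_iff]; simpa using bad_null_piece hA hη0 hη hδ hs j
  filter_upwards [ae_all_iff.2 this] with y hy c h1 h2
  refine hy ⌊c / (s/2)⌋ ⟨c, ?_, ?_, h1, h2⟩
  · rw [← le_div_iff₀ (by positivity)]; exact Int.floor_le _
  · rw [← div_lt_iff₀ (by positivity)]; exact Int.lt_floor_add_one _

theorem bad_null_dn {A : Set (Y × ℝ)} (hA : MeasurableSet A) {η δ s : ℝ} (hη0 : 0 < η)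
    (hη : η * 3 ^ (finrank ℝ Y + 1) < (ν (ball (0:Y) 1)).toReal / 4)
    (hδ : 0 < δ) (hs : 0 < s) :
    ∀ᵐ y ∂ν, ∀ c, (y, c) ∈ CZ (ν.prod volume) (finrank ℝ Y + 1) A η δ →
      ¬ ∀ᵐ t : ℝ, t ∈ Ioo (c - s) c → (y, t) ∈ A := by
  have hmp : MeasurePreserving (Prod.map (id : Y → Y) (Neg.neg : ℝ → ℝ)) (ν.prod volume) (ν.prod volume) :=
    (MeasurePreserving.id ν).prod (Measure.measurePreserving_neg (volume : Measure ℝ))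
  have hA' : MeasurableSet (Prod.map (id : Y → Y) (Neg.neg : ℝ → ℝ) ⁻¹' A) := hmp.measurable hA
  filter_upwards [bad_null hA' hη0 hη hδ hs] with y hy c h1 h2
  refine hy (-c) ?_ ?_
  · intro ρ hρ1 hρ2
    refine le_trans (le_of_eq ?_) (h1 ρ hρ1 hρ2)
    rw [← hmp.measure_preimage (hA.inter measurableSet_ball).nullMeasurableSet]
    congr 1
    ext ⟨y', t⟩
    simp only [mem_inter_iff, mem_preimage, Prod.map_apply, mem_ball, Prod.dist_eq, id]
    rw [show dist (-t) c = dist t (-c) by rw [Real.dist_eq, Real.dist_eq, ← abs_neg]; congr 1; ring]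
  · have := (Measure.measurePreserving_neg (volume : Measure ℝ)).quasiMeasurePreserving.ae h2
    filter_upwards [this] with t ht htI
    exact ht ⟨by linarith [htI.2], by linarith [htI.1]⟩

theorem key_prod {G : Set (Y × ℝ)} (hG : MeasurableSet G) :
    ∀ᵐ y ∂ν, ∀ a b : ℝ, (∀ t ∈ Icc a b, DZ (ν.prod volume) (finrank ℝ Y + 1) G (y, t) ∨
        DZ (ν.prod volume) (finrank ℝ Y + 1) Gᶜ (y, t)) →
      (∀ t ∈ Icc a b, DZ (ν.prod volume) (finrank ℝ Y + 1) G (y, t)) ∨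
      (∀ t ∈ Icc a b, DZ (ν.prod volume) (finrank ℝ Y + 1) Gᶜ (y, t)) := by
  set d := finrank ℝ Y + 1 with hd
  have hdim : finrank ℝ (Y × ℝ) = d := by rw [Module.finrank_prod, Module.finrank_self]
  set μ := ν.prod (volume : Measure ℝ) with hμ
  set β := (ν (ball (0:Y) 1)).toReal with hβ
  have hβ0 : 0 < β := ENNReal.toReal_pos ball_one_ne_zero ball_one_ne_top
  set β' := (μ (ball (0:Y × ℝ) 1)).toReal with hβ'
  have hβ'0 : 0 < β' := ENNReal.toReal_pos ball_one_ne_zero ball_one_ne_top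
  obtain ⟨η, hη0, hη, hη'⟩ : ∃ η : ℝ, 0 < η ∧ η * 3 ^ d < β / 4 ∧ η < β' / 4 := by
    refine ⟨min (β / (8 * 3^d)) (β'/8), by positivity, ?_, lt_of_le_of_lt (min_le_right _ _) (by linarith)⟩
    calc min (β / (8 * 3^d)) (β'/8) * 3^d ≤ β / (8 * 3^d) * 3^d := by gcongr; exact min_le_left _ _
      _ = β / 8 := by field_simp
      _ < β/4 := by linarith
  set Gi : Bool → Set (Y × ℝ) := fun i => if i then G else Gᶜ with hGi
  have hGm : ∀ i, MeasurableSet (Gi i) := by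
    intro i; cases i
    · exact hG.compl
    · exact hG
  have hGc : ∀ i, Gi (!i) = (Gi i)ᶜ := by intro i; cases i <;> simp [hGi]
  have hup : ∀ᵐ y ∂ν, ∀ (i : Bool) (k j : ℕ) (c : ℝ), (y, c) ∈ CZ μ d (Gi i) η (1/((k:ℝ)+1)) →
      ¬ ∀ᵐ t : ℝ, t ∈ Ioo c (c + 1/((j:ℝ)+1)) → (y, t) ∈ Gi i := by
    rw [ae_all_iff]; intro i; rw [ae_all_iff]; intro k; rw [ae_all_iff]; intro j
    exact bad_null (hGm i) hη0 hη (by positivity) (by positivity)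
  have hdn : ∀ᵐ y ∂ν, ∀ (i : Bool) (k j : ℕ) (c : ℝ), (y, c) ∈ CZ μ d (Gi i) η (1/((k:ℝ)+1)) →
      ¬ ∀ᵐ t : ℝ, t ∈ Ioo (c - 1/((j:ℝ)+1)) c → (y, t) ∈ Gi i := by
    rw [ae_all_iff]; intro i; rw [ae_all_iff]; intro k; rw [ae_all_iff]; intro j
    exact bad_null_dn (hGm i) hη0 hη (by positivity) (by positivity)
  have hae : ∀ i, ∀ᵐ y ∂ν, ∀ᵐ t : ℝ, DZ μ d (Gi (!i)) (y, t) → (y, t) ∈ Gi i := by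
    intro i
    apply Measure.ae_ae_of_ae_prod (p := fun p => DZ μ d (Gi (!i)) p → p ∈ Gi i)
    have := ae_DZ_of_notMem (μ := μ) (hGm i)
    rw [hdim] at this
    filter_upwards [this] with p hp h
    by_contra hc
    have := DZ_excl (μ := μ) (E := Gi i) (x := p)
    rw [hdim] at this
    exact this (hp hc) (hGc i ▸ h)
  filter_upwards [hup, hdn, ae_all_iff.2 hae] with y hup hdn hae a b hab
  refine baire_interval a b (fun i t => DZ μ d (Gi i) (y, t))
    (fun i k => (fun t => (y, t)) ⁻¹' CZ μ d (Gi i) η (1/((k:ℝ)+1)))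
    (fun i k => (isClosed_CZ _ _).preimage (by fun_prop)) hab ?_ ?_ ?_ ?_
  · intro i t ht h
    obtain ⟨δ, hδ, H⟩ := h η hη0
    obtain ⟨k, hk⟩ := exists_nat_one_div_lt hδ
    exact ⟨k, fun ρ h1 h2 => H ρ h1 (h2.trans hk)⟩
  · intro i k t ht h
    obtain ⟨δ, hδ, H⟩ := h (β'/4) (by positivity)
    set ρ := min δ (1/((k:ℝ)+1)) / 2 with hρ
    have hm : 0 < min δ (1/((k:ℝ)+1)) := by positivity
    have h0 : 0 < ρ := by positivity
    have h1 := H ρ h0 (lt_of_lt_of_le (by linarith) (min_le_left _ _))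
    have h2 := ht ρ h0 (lt_of_lt_of_le (by linarith) (min_le_right δ _))
    have h3 : μ (ball (y,t) ρ) ≤ ENNReal.ofReal (β'/4 * ρ^d) + ENNReal.ofReal (η * ρ^d) := by
      refine le_trans ?_ (add_le_add h1 h2)
      refine le_trans (measure_mono ?_) (measure_union_le _ _)
      intro z hz
      by_cases hzE : z ∈ Gi i
      · exact Or.inr ⟨hzE, hz⟩
      · exact Or.inl ⟨hGc i ▸ hzE, hz⟩
    rw [Measure.addHaar_ball_of_pos μ _ h0, ← ENNReal.ofReal_toReal (ball_one_ne_top (μ := μ) (Z := Y × ℝ)), ← hβ',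
      ← ENNReal.ofReal_mul (by positivity), ← ENNReal.ofReal_add (by positivity) (by positivity),
      ENNReal.ofReal_le_ofReal_iff (by positivity), hdim] at h3
    have : η * ρ^d < β'/4 * ρ^d := by gcongr
    have : 0 < β' * ρ^d := by positivity
    linarith
  · intro i k c t hc hct h
    obtain ⟨j, hj⟩ := exists_nat_one_div_lt (sub_pos.2 hct)
    refine hup i k j c hc ?_
    filter_upwards [hae i] with s hs hsI
    exact hs (h s ⟨hsI.1, by linarith [hsI.2]⟩)
  · intro i k c t hc hct h
    obtain ⟨j, hj⟩ := exists_nat_one_div_lt (sub_pos.2 hct)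
    refine hdn i k j c hc ?_
    filter_upwards [hae i] with s hs hsI
    exact hs (h s ⟨by linarith [hsI.1], hsI.2⟩)
end KeyProd

end SecA2

section SecA3
open MeasureTheory Metric Set Filter
open scoped ENNReal NNReal Topology RealInnerProductSpace
set_option linter.all false
set_option linter.deprecated false

section HausGen
variable {A B : Type*} [MetricSpace A] [MeasurableSpace A] [BorelSpace A]
  [MetricSpace B] [MeasurableSpace B] [BorelSpace B]

theorem haus_image_le {f : A → B} {s : Set A} {K : ℝ≥0} {d : ℝ} (hd : 0 ≤ d)
    (h : ∀ x ∈ s, ∀ y ∈ s, dist (f x) (f y) ≤ K * dist x y) :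
    μH[d] (f '' s) ≤ (K : ℝ≥0∞) ^ d * μH[d] s :=
  (LipschitzOnWith.of_dist_le_mul h).hausdorffMeasure_image_le hd

theorem haus_le_image {f : A → B} {s : Set A} {K : ℝ≥0} {d : ℝ} (hd : 0 ≤ d)
    (h : ∀ x ∈ s, ∀ y ∈ s, dist x y ≤ K * dist (f x) (f y)) :
    μH[d] s ≤ (K : ℝ≥0∞) ^ d * μH[d] (f '' s) := by
  rcases s.eq_empty_or_nonempty with rfl | ⟨x0, hx0⟩
  · simp
  have : Nonempty A := ⟨x0⟩
  have hinj : InjOn f s := fun x hx y hy hxy => by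
    have := h x hx y hy
    rw [hxy, dist_self, mul_zero] at this
    exact dist_le_zero.1 this
  have hl : LeftInvOn (Function.invFunOn f s) f s := hinj.leftInvOn_invFunOn
  have h2 := haus_image_le (f := Function.invFunOn f s) (s := f '' s) (K := K) hd (by
    rintro _ ⟨x, hx, rfl⟩ _ ⟨y, hy, rfl⟩
    rw [hl hx, hl hy]; exact h x hx y hy)
  rwa [hl.image_image] at h2

theorem haus_image_null {f : A → B} {s : Set A} {K : ℝ≥0} {d : ℝ} (hd : 0 ≤ d)
    (h : ∀ x ∈ s, ∀ y ∈ s, dist (f x) (f y) ≤ K * dist x y) (hs : μH[d] s = 0) :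
    μH[d] (f '' s) = 0 := by
  have := haus_image_le hd h
  rw [hs, mul_zero] at this
  exact le_antisymm this bot_le
end HausGen

section Transfer
open Module
variable {Z X : Type*} [NormedAddCommGroup Z] [NormedSpace ℝ Z] [FiniteDimensional ℝ Z]
  [MeasurableSpace Z] [BorelSpace Z] {μ : Measure Z} [μ.IsAddHaarMeasure]
  [NormedAddCommGroup X] [NormedSpace ℝ X] [FiniteDimensional ℝ X]
  [MeasurableSpace X] [BorelSpace X] {m : Measure X} [m.IsAddHaarMeasure]

/-- a Haar measure is comparable to the Hausdorff measure -/
theorem haar_eq_haus (μ : Measure Z) [μ.IsAddHaarMeasure] : ∃ c : ℝ≥0, 0 < c ∧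
    μ = (c : ℝ≥0∞) • (μH[(finrank ℝ Z : ℝ)] : Measure Z) := by
  refine ⟨μ.addHaarScalarFactor (μH[(finrank ℝ Z : ℝ)] : Measure Z), ?_, ?_⟩
  · exact Measure.addHaarScalarFactor_pos_of_isAddHaarMeasure _ _
  · have := Measure.isAddLeftInvariant_eq_smul μ (μH[(finrank ℝ Z : ℝ)] : Measure Z)
    exact this

theorem DZ_transfer (hdim : finrank ℝ Z = finrank ℝ X) {Ψ : Z → X} {p : Z} {r0 : ℝ} (hr0 : 0 < r0)
    {K L : ℝ≥0} (hL : ∀ a ∈ ball p r0, ∀ b ∈ ball p r0, dist (Ψ a) (Ψ b) ≤ L * dist a b)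
    (hK : ∀ a ∈ ball p r0, ∀ b ∈ ball p r0, dist a b ≤ K * dist (Ψ a) (Ψ b))
    {E : Set X} (h : DZ m (finrank ℝ X) E (Ψ p)) : DZ μ (finrank ℝ Z) (Ψ ⁻¹' E) p := by
  obtain ⟨c, hc0, hc⟩ := haar_eq_haus μ
  obtain ⟨c', hc0', hc'⟩ := haar_eq_haus m
  set d := finrank ℝ Z with hd
  rw [← hdim] at h
  rw [← hdim] at hc'
  intro ε hε
  set L' : ℝ := L + 1 with hL'
  have hL0 : 0 < L' := by positivity
  obtain ⟨δ, hδ, H⟩ := h (ε * c' / (c * (K+1)^d * L'^d)) (by positivity)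
  refine ⟨min r0 (δ / L'), by positivity, fun ρ h1 h2 => ?_⟩
  have hρ0 : ρ < r0 := h2.trans_le (min_le_left _ _)
  have hρ1 : L' * ρ < δ := by
    have := h2.trans_le (min_le_right _ _)
    rw [lt_div_iff₀ hL0] at this; linarith
  have hb : ball p ρ ⊆ ball p r0 := ball_subset_ball hρ0.le
  have h3 := H (L' * ρ) (by positivity) hρ1
  have h4 : Ψ '' (Ψ ⁻¹' E ∩ ball p ρ) ⊆ E ∩ ball (Ψ p) (L' * ρ) := by
    rintro _ ⟨z, ⟨hz1, hz2⟩, rfl⟩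
    refine ⟨hz1, ?_⟩
    rw [mem_ball]
    calc dist (Ψ z) (Ψ p) ≤ L * dist z p := hL z (hb hz2) p (mem_ball_self hr0)
      _ ≤ L' * dist z p := by gcongr; linarith
      _ < L' * ρ := by gcongr; exact hz2
  have h5 := haus_le_image (d := (d:ℝ)) (K := K) (f := Ψ) (s := Ψ ⁻¹' E ∩ ball p ρ) (by positivity)
    (fun a ha b hb' => hK a (hb ha.2) b (hb hb'.2))
  have h6 : (c' : ℝ≥0∞) * μH[(d:ℝ)] (Ψ '' (Ψ ⁻¹' E ∩ ball p ρ)) ≤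
      ENNReal.ofReal (ε * c' / (c * (K+1)^d * L'^d) * (L' * ρ)^d) := by
    refine le_trans ?_ h3
    rw [hc', Measure.smul_apply, smul_eq_mul]
    gcongr
  have h7 : μ (Ψ ⁻¹' E ∩ ball p ρ) = c * μH[(d:ℝ)] (Ψ ⁻¹' E ∩ ball p ρ) := by
    rw [hc, Measure.smul_apply, smul_eq_mul]
  rw [h7]
  have hc'0 : (c' : ℝ≥0∞) ≠ 0 := by exact_mod_cast hc0'.ne'
  have hc't : (c' : ℝ≥0∞) ≠ ⊤ := ENNReal.coe_ne_top
  rw [← ENNReal.mul_le_mul_iff_right hc'0 hc't]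
  calc (c':ℝ≥0∞) * (c * μH[(d:ℝ)] (Ψ ⁻¹' E ∩ ball p ρ))
      ≤ c' * (c * (((K+1 : ℝ≥0) : ℝ≥0∞)^(d:ℝ) * μH[(d:ℝ)] (Ψ '' (Ψ ⁻¹' E ∩ ball p ρ)))) := by
        gcongr
        refine h5.trans ?_
        gcongr
        exact_mod_cast le_add_of_nonneg_right zero_le_one
    _ = c * ((K+1 : ℝ≥0) : ℝ≥0∞)^d * (c' * μH[(d:ℝ)] (Ψ '' (Ψ ⁻¹' E ∩ ball p ρ))) := by
        rw [ENNReal.rpow_natCast]; ring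
    _ ≤ c * ((K+1 : ℝ≥0) : ℝ≥0∞)^d * ENNReal.ofReal (ε * c' / (c * (K+1)^d * L'^d) * (L' * ρ)^d) := by
        gcongr
    _ = c' * ENNReal.ofReal (ε * ρ ^ d) := by
        rw [← ENNReal.ofReal_coe_nnreal (p := c), ← ENNReal.ofReal_coe_nnreal (p := c'),
          ← ENNReal.ofReal_coe_nnreal (p := K+1), ← ENNReal.ofReal_pow (by positivity),
          ← ENNReal.ofReal_mul (by positivity), ← ENNReal.ofReal_mul (by positivity),
          ← ENNReal.ofReal_mul (by positivity)]
        congr 1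
        push_cast
        have : (c:ℝ) ≠ 0 := by exact_mod_cast hc0.ne'
        rw [mul_pow]; field_simp
end Transfer

section Lines
open Module
variable {n : ℕ}

theorem key_transfer {Y : Type*} [NormedAddCommGroup Y] [NormedSpace ℝ Y] [FiniteDimensional ℝ Y]
    [MeasurableSpace Y] [BorelSpace Y] {ν : Measure Y} [ν.IsAddHaarMeasure] (hY : finrank ℝ Y + 1 = n)
    {Ψ : Y × ℝ → Euc n} (hΨ : Measurable Ψ) (J : Set ℝ)
    (hloc : ∀ y, ∀ t ∈ J, ∃ r0 : ℝ, 0 < r0 ∧ ∃ K L : ℝ≥0,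
      (∀ a ∈ ball (y,t) r0, ∀ b ∈ ball (y,t) r0, dist (Ψ a) (Ψ b) ≤ L * dist a b) ∧
      (∀ a ∈ ball (y,t) r0, ∀ b ∈ ball (y,t) r0, dist a b ≤ K * dist (Ψ a) (Ψ b)))
    {E : Set (Euc n)} (hE : MeasurableSet E) :
    ∀ᵐ y ∂ν, ∀ a b : ℝ, Icc a b ⊆ J → (∀ t ∈ Icc a b, Ψ (y, t) ∉ essBoundary E) →
      (∀ t ∈ Icc a b, DZ volume n E (Ψ (y,t))) ∨ (∀ t ∈ Icc a b, DZ volume n Eᶜ (Ψ (y,t))) := by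
  have hdim : finrank ℝ (Y × ℝ) = n := by rw [Module.finrank_prod, Module.finrank_self, hY]
  have htr : ∀ y, ∀ t ∈ J, ∀ E : Set (Euc n), DZ volume n E (Ψ (y,t)) →
      DZ (ν.prod volume) (finrank ℝ Y + 1) (Ψ ⁻¹' E) (y,t) := by
    intro y t ht E h
    obtain ⟨r0, hr0, K, L, hL, hK⟩ := hloc y t ht
    have := DZ_transfer (μ := ν.prod volume) (m := (volume : Measure (Euc n))) (E := E)
      (by rw [hdim, finrank_euclideanSpace_fin]) hr0 hL hK
    rw [hdim, finrank_euclideanSpace_fin] at this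
    rw [hY]; exact this h
  filter_upwards [key_prod (ν := ν) (hΨ hE)] with y hy a b hab h
  have hexcl : ∀ t, DZ (ν.prod volume) (finrank ℝ Y + 1) (Ψ ⁻¹' E) (y,t) →
      DZ (ν.prod volume) (finrank ℝ Y + 1) (Ψ ⁻¹' E)ᶜ (y,t) → False := by
    intro t
    have := DZ_excl (μ := ν.prod volume) (E := Ψ ⁻¹' E) (x := (y,t))
    rw [hdim] at this
    rw [hY]; exact this
  have h' : ∀ t ∈ Icc a b, DZ volume n E (Ψ (y,t)) ∨ DZ volume n Eᶜ (Ψ (y,t)) := fun t ht =>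
    (notMem_essBoundary_iff hE).1 (h t ht)
  rcases hy a b (fun t ht => (h' t ht).imp (htr y t (hab ht) E) (htr y t (hab ht) Eᶜ)) with h1 | h1
  · left
    intro t ht
    exact (h' t ht).resolve_right fun h2 => hexcl t (h1 t ht) (htr y t (hab ht) Eᶜ h2)
  · right
    intro t ht
    exact (h' t ht).resolve_left fun h2 => hexcl t (htr y t (hab ht) E h2) (h1 t ht)

/-- hyperplane orthogonal to u -/
noncomputable abbrev Hyp (u : Euc n) : Submodule ℝ (Euc n) := (Submodule.span ℝ {u})ᗮ

theorem finrank_hyp {u : Euc n} (hu : ‖u‖ = 1) : finrank ℝ (Hyp u) + 1 = n := by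
  have h := Submodule.finrank_add_finrank_orthogonal (𝕜 := ℝ) (E := Euc n) (Submodule.span ℝ {u})
  rw [finrank_span_singleton (by rintro rfl; simp at hu), finrank_euclideanSpace_fin] at h
  rw [add_comm]; exact h

theorem haar_hyp {u : Euc n} (hu : ‖u‖ = 1) :
    (μH[(n:ℝ) - 1] : Measure (Hyp u)).IsAddHaarMeasure := by
  have : (n:ℝ) - 1 = (finrank ℝ (Hyp u) : ℝ) := by
    rw [eq_comm, eq_sub_iff_add_eq]; exact_mod_cast finrank_hyp hu
  rw [this]; infer_instance

theorem inner_hyp (u : Euc n) (y : Hyp u) : ⟪u, (y : Euc n)⟫ = 0 :=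
  Submodule.mem_orthogonal_singleton_iff_inner_right.1 y.2

theorem hyp_sub_inner {u : Euc n} (hu : ‖u‖ = 1) (y y' : Hyp u) (t t' : ℝ) :
    |t - t'| ≤ ‖((y : Euc n) + t • u) - (y' + t' • u)‖ := by
  have h1 : ⟪u, ((y : Euc n) + t • u) - (y' + t' • u)⟫ = t - t' := by
    rw [inner_sub_right, inner_add_right, inner_add_right, inner_hyp, inner_hyp, inner_smul_right,
      inner_smul_right, real_inner_self_eq_norm_sq, hu]; ring
  rw [← h1]
  have := abs_real_inner_le_norm u (((y : Euc n) + t • u) - (y' + t' • u))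
  rwa [hu, one_mul] at this

theorem lines_lemma {u : Euc n} (hu : ‖u‖ = 1) {E : Set (Euc n)} (hE : MeasurableSet E) :
    ∀ᵐ (y : Hyp u) ∂(μH[(n:ℝ) - 1] : Measure (Hyp u)), ∀ a b : ℝ,
      (∀ t ∈ Icc a b, (y : Euc n) + t • u ∉ essBoundary E) →
      (∀ t ∈ Icc a b, DZ volume n E (y + t • u)) ∨ (∀ t ∈ Icc a b, DZ volume n Eᶜ (y + t • u)) := by
  have := haar_hyp hu
  have key := key_transfer (ν := (μH[(n:ℝ) - 1] : Measure (Hyp u))) (finrank_hyp hu)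
    (Ψ := fun p => (p.1 : Euc n) + p.2 • u) (by fun_prop) univ (by
      intro y t _
      refine ⟨1, one_pos, 2, 2, ?_, ?_⟩
      · rintro ⟨y1, t1⟩ - ⟨y2, t2⟩ -
        simp only [dist_eq_norm]
        have e : (y1 : Euc n) + t1 • u - (y2 + t2 • u) = (y1 - y2 : Hyp u) + (t1 - t2) • u := by
          push_cast; module
        rw [e]
        have h1 : ‖(y1 - y2 : Hyp u)‖ ≤ ‖((y1, t1) - (y2, t2) : Hyp u × ℝ)‖ := norm_fst_le ((y1, t1) - (y2, t2))
        have h2 : ‖t1 - t2‖ ≤ ‖((y1, t1) - (y2, t2) : Hyp u × ℝ)‖ := norm_snd_le ((y1, t1) - (y2, t2))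
        refine (norm_add_le _ _).trans ?_
        rw [norm_smul, hu, mul_one]
        have h3 : ‖((y1 - y2 : Hyp u) : Euc n)‖ = ‖(y1 - y2 : Hyp u)‖ := rfl
        rw [h3]; push_cast; linarith
      · rintro ⟨y1, t1⟩ - ⟨y2, t2⟩ -
        simp only [dist_eq_norm]
        have h0 := hyp_sub_inner hu y1 y2 t1 t2
        set w := (y1 : Euc n) + t1 • u - (y2 + t2 • u) with hw
        have e : ((y1 - y2 : Hyp u) : Euc n) = w - (t1 - t2) • u := by
          rw [hw]; push_cast; module
        have h3 : ‖((y1 - y2 : Hyp u) : Euc n)‖ = ‖(y1 - y2 : Hyp u)‖ := rfl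
        refine (Prod.norm_def _).trans_le (max_le ?_ ?_)
        · show ‖y1 - y2‖ ≤ _
          rw [← h3, e]
          refine (norm_sub_le _ _).trans ?_
          rw [norm_smul, hu, mul_one, Real.norm_eq_abs]; push_cast; linarith
        · show ‖t1 - t2‖ ≤ _
          rw [Real.norm_eq_abs]; push_cast; linarith [norm_nonneg w]) hE
  filter_upwards [key] with y hy a b h
  exact hy a b (subset_univ _) h

theorem norm_hatv_sub_le {a : ℝ} (ha : 0 < a) {x y : Euc n} (hx : a ≤ ‖x‖) (hy : a ≤ ‖y‖) :
    ‖hatv x - hatv y‖ ≤ (2 / a) * ‖x - y‖ := by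
  have hx0 : 0 < ‖x‖ := ha.trans_le hx
  have hy0 : 0 < ‖y‖ := ha.trans_le hy
  have e : hatv x - hatv y = ‖x‖⁻¹ • (x - y) + (‖x‖⁻¹ * (‖y‖ - ‖x‖)) • hatv y := by
    unfold hatv
    rw [smul_smul, smul_sub]
    have : ‖x‖⁻¹ * (‖y‖ - ‖x‖) * ‖y‖⁻¹ = ‖x‖⁻¹ - ‖y‖⁻¹ := by field_simp
    rw [this]; module
  have hn : ‖hatv y‖ = 1 := by
    unfold hatv; rw [norm_smul, norm_inv, norm_norm, inv_mul_cancel₀ hy0.ne']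
  rw [e]
  refine (norm_add_le _ _).trans ?_
  rw [norm_smul, norm_smul, hn, mul_one, norm_mul, norm_inv, norm_norm]
  have h1 : ‖‖y‖ - ‖x‖‖ ≤ ‖x - y‖ := by
    rw [Real.norm_eq_abs, abs_sub_comm]; exact abs_norm_sub_norm_le x y
  have h2 : ‖x‖⁻¹ ≤ a⁻¹ := inv_anti₀ ha hx
  calc ‖x‖⁻¹ * ‖x - y‖ + ‖x‖⁻¹ * ‖‖y‖ - ‖x‖‖ ≤ a⁻¹ * ‖x - y‖ + a⁻¹ * ‖x - y‖ := by gcongr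
    _ = _ := by ring

theorem norm_hatv {x : Euc n} (hx : x ≠ 0) : ‖hatv x‖ = 1 := by
  unfold hatv; rw [norm_smul, norm_inv, norm_norm, inv_mul_cancel₀ (norm_ne_zero_iff.2 hx)]

theorem norm_hyp_add_ge {u : Euc n} (hu : ‖u‖ = 1) (y : Hyp u) : 1 ≤ ‖(y : Euc n) + u‖ := by
  have := hyp_sub_inner hu y 0 1 0
  simpa using this

theorem rays_chart {u : Euc n} (hu : ‖u‖ = 1) {E : Set (Euc n)} (hE : MeasurableSet E) :
    ∀ᵐ (y : Hyp u) ∂(μH[(n:ℝ) - 1] : Measure (Hyp u)), ∀ a b : ℝ, 0 < a →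
      (∀ t ∈ Icc a b, t • ((y : Euc n) + u) ∉ essBoundary E) →
      (∀ t ∈ Icc a b, DZ volume n E (t • ((y : Euc n) + u))) ∨
        (∀ t ∈ Icc a b, DZ volume n Eᶜ (t • ((y : Euc n) + u))) := by
  have := haar_hyp hu
  have key := key_transfer (ν := (μH[(n:ℝ) - 1] : Measure (Hyp u))) (finrank_hyp hu)
    (Ψ := fun p => p.2 • ((p.1 : Euc n) + u)) (by fun_prop) (Ioi 0) (by
      intro y t (ht : 0 < t)
      refine ⟨t/2, by positivity, Real.toNNReal (1 + 2/t * (2 + (‖y‖ + t/2))),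
        Real.toNNReal (2 * t + (‖y‖ + t/2) + 1), ?_, ?_⟩
      · rintro ⟨y1, t1⟩ h1 ⟨y2, t2⟩ h2
        rw [Real.coe_toNNReal _ (by positivity)]
        simp only [dist_eq_norm]
        have e : t1 • ((y1 : Euc n) + u) - t2 • (y2 + u) = t1 • ((y1 - y2 : Hyp u) : Euc n) + (t1 - t2) • (y2 + u) := by
          push_cast; module
        rw [e]
        have g1 : ‖(y1 - y2 : Hyp u)‖ ≤ ‖((y1, t1) - (y2, t2) : Hyp u × ℝ)‖ := norm_fst_le ((y1, t1) - (y2, t2))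
        have g2 : ‖t1 - t2‖ ≤ ‖((y1, t1) - (y2, t2) : Hyp u × ℝ)‖ := norm_snd_le ((y1, t1) - (y2, t2))
        have h3 : ‖((y1 - y2 : Hyp u) : Euc n)‖ = ‖(y1 - y2 : Hyp u)‖ := rfl
        rw [mem_ball, Prod.dist_eq, max_lt_iff] at h1 h2
        have ht1 := h1.2
        have hy2 := h2.1
        simp only [Real.dist_eq, abs_lt] at ht1
        have hy2' : ‖(y2 : Euc n)‖ ≤ ‖y‖ + t/2 := by
          rw [dist_eq_norm] at hy2
          have := norm_le_norm_add_norm_sub' y2 y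
          have h4 : ‖(y2 : Euc n)‖ = ‖y2‖ := rfl
          simp only at hy2
          rw [h4]; linarith
        refine (norm_add_le _ _).trans ?_
        rw [norm_smul, norm_smul, h3]
        have q1 : ‖(y2 : Euc n) + u‖ ≤ ‖y‖ + t/2 + 1 := (norm_add_le _ _).trans (by rw [hu]; linarith)
        have q2 : ‖t1‖ ≤ 2 * t := by rw [Real.norm_eq_abs, abs_le]; constructor <;> linarith
        calc _ ≤ (2*t) * ‖((y1, t1) - (y2, t2) : Hyp u × ℝ)‖ + ‖((y1, t1) - (y2, t2) : Hyp u × ℝ)‖ * (‖y‖ + t/2 + 1) := by gcongr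
          _ = _ := by ring
      · rintro ⟨y1, t1⟩ h1 ⟨y2, t2⟩ h2
        rw [Real.coe_toNNReal _ (by positivity)]
        simp only [dist_eq_norm]
        rw [mem_ball, Prod.dist_eq, max_lt_iff] at h1 h2
        have ht1 := h1.2
        have hy2 := h2.1
        simp only [Real.dist_eq, abs_lt] at ht1
        have hy2' : ‖(y2 : Euc n)‖ ≤ ‖y‖ + t/2 := by
          rw [dist_eq_norm] at hy2
          have := norm_le_norm_add_norm_sub' y2 y
          have h4 : ‖(y2 : Euc n)‖ = ‖y2‖ := rfl
          simp only at hy2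
          rw [h4]; linarith
        have h0 := hyp_sub_inner hu (t1 • y1) (t2 • y2) t1 t2
        set w := t1 • ((y1 : Euc n) + u) - t2 • (y2 + u) with hw
        have hw' : ((t1 • y1 : Hyp u) : Euc n) + t1 • u - (((t2 • y2 : Hyp u) : Euc n) + t2 • u) = w := by
          rw [hw]; push_cast; module
        rw [hw'] at h0
        have e : t1 • ((y1 - y2 : Hyp u) : Euc n) = w - (t1 - t2) • (y2 + u) := by
          rw [hw]; push_cast; module
        have h3 : ‖((y1 - y2 : Hyp u) : Euc n)‖ = ‖(y1 - y2 : Hyp u)‖ := rfl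
        have q1 : ‖(y2 : Euc n) + u‖ ≤ ‖y‖ + t/2 + 1 := (norm_add_le _ _).trans (by rw [hu]; linarith)
        have q2 : t1 * ‖y1 - y2‖ ≤ (2 + (‖y‖ + t/2)) * ‖w‖ := by
          rw [← h3]
          calc t1 * ‖((y1 - y2 : Hyp u) : Euc n)‖ = ‖t1 • ((y1 - y2 : Hyp u) : Euc n)‖ := by
                rw [norm_smul, Real.norm_of_nonneg (by linarith)]
            _ ≤ ‖w‖ + ‖(t1 - t2) • ((y2 : Euc n) + u)‖ := by rw [e]; exact norm_sub_le _ _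
            _ ≤ ‖w‖ + ‖w‖ * (‖y‖ + t/2 + 1) := by rw [norm_smul, Real.norm_eq_abs]; gcongr
            _ = _ := by ring
        have q3 : ‖y1 - y2‖ ≤ 2/t * (2 + (‖y‖ + t/2)) * ‖w‖ := by
          have : t/2 * ‖y1 - y2‖ ≤ t1 * ‖y1 - y2‖ := by gcongr; linarith
          have h5 := this.trans q2
          rw [mul_assoc, div_mul_eq_mul_div, le_div_iff₀ ht]; linarith
        refine (Prod.norm_def _).trans_le (max_le ?_ ?_)
        · show ‖y1 - y2‖ ≤ _
          linarith [norm_nonneg w]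
        · show ‖t1 - t2‖ ≤ _
          rw [Real.norm_eq_abs, add_mul, one_mul]
          have : 0 ≤ 2/t * (2 + (‖y‖ + t/2)) * ‖w‖ := by positivity
          linarith) hE
  filter_upwards [key] with y hy a b ha h
  exact hy a b (fun t ht => ha.trans_le ht.1) h

/-- the unit sphere -/
abbrev Sph (n : ℕ) : Type := sphere (0 : Euc n) 1

/-- Hausdorff measure on the unit sphere -/
noncomputable def sig (n : ℕ) : Measure (Sph n) := μH[(n:ℝ) - 1]

theorem norm_sph (ω : Sph n) : ‖(ω : Euc n)‖ = 1 := by simpa using ω.2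

/-- charts covering the sphere -/
theorem exists_chart (ω : Sph n) : ∃ (i : Fin n) (b : Bool),
    0 < ⟪(EuclideanSpace.single i (if b then (1:ℝ) else -1) : Euc n), (ω : Euc n)⟫ := by
  have h0 : (ω : Euc n) ≠ 0 := by
    intro h; have := norm_sph ω; rw [h, norm_zero] at this; exact zero_ne_one this
  obtain ⟨i, hi⟩ : ∃ i, (ω : Euc n) i ≠ 0 := by
    by_contra hc
    push Not at hc
    exact h0 (by ext i; simpa using hc i)
  rcases lt_or_gt_of_ne hi with h | h
  · exact ⟨i, false, by rw [EuclideanSpace.inner_single_left]; simpa using h⟩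
  · exact ⟨i, true, by rw [EuclideanSpace.inner_single_left]; simpa using h⟩

theorem norm_chart (i : Fin n) (b : Bool) : ‖(EuclideanSpace.single i (if b then (1:ℝ) else -1) : Euc n)‖ = 1 := by
  rw [EuclideanSpace.norm_single]; cases b <;> simp

noncomputable def chartMap {u : Euc n} (hu : ‖u‖ = 1) (y : Hyp u) : Sph n :=
  ⟨hatv ((y : Euc n) + u), by
    rw [mem_sphere_zero_iff_norm]; apply norm_hatv
    intro h; have := norm_hyp_add_ge hu y; rw [h, norm_zero] at this; linarith⟩

theorem chartMap_lip {u : Euc n} (hu : ‖u‖ = 1) (y y' : Hyp u) :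
    dist (chartMap hu y) (chartMap hu y') ≤ (2:ℝ≥0) * dist y y' := by
  rw [Subtype.dist_eq, dist_eq_norm, dist_eq_norm]
  have := norm_hatv_sub_le one_pos (norm_hyp_add_ge hu y) (norm_hyp_add_ge hu y')
  have e : (y : Euc n) + u - (y' + u) = ((y - y' : Hyp u) : Euc n) := by push_cast; module
  rw [e, div_one] at this
  exact this

theorem exists_chartMap {u : Euc n} (hu : ‖u‖ = 1) (ω : Sph n) (h : 0 < ⟪u, (ω : Euc n)⟫) :
    ∃ y : Hyp u, chartMap hu y = ω ∧ ⟪u, (ω : Euc n)⟫ • ((y : Euc n) + u) = ω := by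
  set s := ⟪u, (ω : Euc n)⟫ with hs
  have hy : s⁻¹ • (ω : Euc n) - u ∈ Hyp u := by
    rw [Submodule.mem_orthogonal_singleton_iff_inner_right, inner_sub_right, inner_smul_right, ← hs,
      real_inner_self_eq_norm_sq, hu, inv_mul_cancel₀ h.ne']; norm_num
  refine ⟨⟨_, hy⟩, ?_, ?_⟩
  · apply Subtype.ext
    show hatv (s⁻¹ • (ω : Euc n) - u + u) = ω
    rw [sub_add_cancel, hatv, norm_smul, norm_sph, mul_one, norm_inv, Real.norm_of_nonneg h.le, smul_smul,
      inv_inv, mul_inv_cancel₀ h.ne', one_smul]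
  · show s • (s⁻¹ • (ω : Euc n) - u + u) = ω
    rw [sub_add_cancel, smul_smul, mul_inv_cancel₀ h.ne', one_smul]

theorem rays_lemma (hn : 1 ≤ n) {E : Set (Euc n)} (hE : MeasurableSet E) :
    ∀ᵐ (ω : Sph n) ∂(sig n), ∀ a b : ℝ, 0 < a →
      (∀ t ∈ Icc a b, t • (ω : Euc n) ∉ essBoundary E) →
      (∀ t ∈ Icc a b, DZ volume n E (t • (ω : Euc n))) ∨
        (∀ t ∈ Icc a b, DZ volume n Eᶜ (t • (ω : Euc n))) := by
  have hd : (0:ℝ) ≤ (n:ℝ) - 1 := by have : (1:ℝ) ≤ n := by exact_mod_cast hn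
                                    linarith
  have key : ∀ (i : Fin n) (b : Bool), ∀ᵐ (ω : Sph n) ∂(sig n),
      0 < ⟪(EuclideanSpace.single i (if b then (1:ℝ) else -1) : Euc n), (ω : Euc n)⟫ → ∀ a b : ℝ, 0 < a →
      (∀ t ∈ Icc a b, t • (ω : Euc n) ∉ essBoundary E) →
      (∀ t ∈ Icc a b, DZ volume n E (t • (ω : Euc n))) ∨
        (∀ t ∈ Icc a b, DZ volume n Eᶜ (t • (ω : Euc n))) := by
    intro i b
    have hu := norm_chart i b
    set u := (EuclideanSpace.single i (if b then (1:ℝ) else -1) : Euc n)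
    have h1 := rays_chart hu hE
    rw [ae_iff] at h1 ⊢
    have h2 := haus_image_null (f := chartMap hu) (K := 2) hd (fun x _ y _ => chartMap_lip hu x y) h1
    refine measure_mono_null ?_ h2
    intro ω hω
    simp only [mem_setOf_eq, Classical.not_imp] at hω
    obtain ⟨hpos, hω⟩ := hω
    obtain ⟨y, hy1, hy2⟩ := exists_chartMap hu ω hpos
    refine ⟨y, ?_, hy1⟩
    intro hy
    apply hω
    intro a' b' ha' hab
    set s := ⟪u, (ω : Euc n)⟫ with hs
    have e : ∀ t : ℝ, t • (ω : Euc n) = (t * s) • ((y : Euc n) + u) := fun t => by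
      rw [mul_smul, hy2]
    have hh : ∀ t ∈ Icc (a' * s) (b' * s), t / s ∈ Icc a' b' ∧ t • ((y : Euc n) + u) = (t/s) • (ω : Euc n) := by
      intro t ht
      refine ⟨⟨by rw [le_div_iff₀ hpos]; exact ht.1, by rw [div_le_iff₀ hpos]; exact ht.2⟩, ?_⟩
      rw [e, div_mul_cancel₀ _ hpos.ne']
    have hh' : ∀ t ∈ Icc a' b', t * s ∈ Icc (a' * s) (b' * s) := fun t ht =>
      ⟨by gcongr; exact ht.1, by gcongr; exact ht.2⟩
    refine (hy (a' * s) (b' * s) (by positivity) ?_).imp ?_ ?_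
    · intro t ht; rw [(hh t ht).2]; exact hab _ (hh t ht).1
    · intro h t ht; rw [e]; exact h _ (hh' t ht)
    · intro h t ht; rw [e]; exact h _ (hh' t ht)
  have key2 := ae_all_iff.2 fun i => ae_all_iff.2 fun b => key i b
  filter_upwards [key2] with ω hω
  obtain ⟨i, b, h⟩ := exists_chart ω
  exact hω i b h
end Lines

end SecA3

section SecA4
open MeasureTheory Metric Set Filter
open scoped ENNReal NNReal Topology RealInnerProductSpace Pointwise
set_option linter.all false
set_option linter.deprecated false

section Unif
variable {S : Type*} [MetricSpace S] [MeasurableSpace S] [BorelSpace S] [SecondCountableTopology S]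
  {μ ν : Measure S} [IsFiniteMeasure μ] [IsFiniteMeasure ν]

theorem unif_fubini {f g : ℝ → ℝ≥0∞} (hf : ∀ x ρ, 0 < ρ → μ (ball x ρ) = f ρ)
    (hg : ∀ x ρ, 0 < ρ → ν (ball x ρ) = g ρ) {ρ : ℝ} (hρ : 0 < ρ) {V U : Set S}
    (hV : MeasurableSet V) (hU : MeasurableSet U) (hVU : ∀ x ∈ V, ball x ρ ⊆ U) :
    g ρ * μ V ≤ f ρ * ν U := by
  have hm : MeasurableSet {p : S × S | p.1 ∈ V ∧ dist p.2 p.1 < ρ} :=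
    (measurable_fst hV).inter (measurableSet_lt (show Measurable fun p : S × S => dist p.2 p.1 from measurable_snd.dist measurable_fst) measurable_const)
  have h1 : (μ.prod ν) {p : S × S | p.1 ∈ V ∧ dist p.2 p.1 < ρ} = g ρ * μ V := by
    rw [Measure.prod_apply hm, ← setLIntegral_const, ← lintegral_indicator hV]
    congr 1; ext x
    by_cases hx : x ∈ V
    · rw [indicator_of_mem hx, ← hg x ρ hρ]; congr 1; ext y; simp [hx]
    · rw [indicator_of_notMem hx]; convert measure_empty (μ := ν); ext y; simp [hx]
  have h2 : (μ.prod ν) {p : S × S | p.1 ∈ V ∧ dist p.2 p.1 < ρ} ≤ f ρ * ν U := by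
    rw [Measure.prod_apply_symm hm, ← setLIntegral_const, ← lintegral_indicator hU]
    apply lintegral_mono
    intro y
    by_cases hy : y ∈ U
    · rw [indicator_of_mem hy, ← hf y ρ hρ]
      apply measure_mono
      rintro x ⟨hx1, hx2⟩
      rw [mem_ball, dist_comm]; exact hx2
    · rw [indicator_of_notMem hy]
      apply le_of_eq
      convert measure_empty (μ := μ)
      ext x
      simp only [mem_preimage, mem_setOf_eq, mem_empty_iff_false, iff_false]
      rintro ⟨h1, h2⟩
      exact hy (hVU x h1 h2)
  rw [← h1]; exact h2

theorem unif_ball_ne {f : ℝ → ℝ≥0∞} (hf : ∀ x ρ, 0 < ρ → μ (ball x ρ) = f ρ) (hμ : μ ≠ 0)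
    {ρ : ℝ} (hρ : 0 < ρ) : f ρ ≠ 0 := by
  intro h0
  apply hμ
  rw [← Measure.measure_univ_eq_zero]
  obtain ⟨t, -, htc, ht⟩ := TopologicalSpace.isOpen_biUnion_countable (univ : Set S) (fun x => ball x ρ) (fun _ _ => isOpen_ball)
  refine measure_mono_null (t := ⋃ i ∈ t, ball i ρ) ?_ ((measure_biUnion_null_iff htc).2 fun x _ => by rw [hf x ρ hρ, h0])
  rw [ht]
  intro x _
  exact mem_biUnion (mem_univ x) (mem_ball_self hρ)

theorem unif_open {f g : ℝ → ℝ≥0∞} (hf : ∀ x ρ, 0 < ρ → μ (ball x ρ) = f ρ)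
    (hg : ∀ x ρ, 0 < ρ → ν (ball x ρ) = g ρ) (hμ : μ ≠ 0) {U : Set S} (hU : IsOpen U) :
    ν univ * μ U ≤ μ univ * ν U := by
  have hne : Nonempty S := by
    by_contra h
    rw [not_nonempty_iff] at h
    exact hμ (Measure.eq_zero_of_isEmpty μ)
  have hUU : U = ⋃ k : ℕ, (thickening (1/((k:ℝ)+1)) Uᶜ)ᶜ := by
    apply Subset.antisymm
    · intro x hx
      obtain ⟨ε, hε, hb⟩ := Metric.isOpen_iff.1 hU x hx
      obtain ⟨k, hk⟩ := exists_nat_one_div_lt hε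
      refine mem_iUnion.2 ⟨k, fun h => ?_⟩
      obtain ⟨z, hz, hzx⟩ := mem_thickening_iff.1 h
      exact hz (hb (by rw [mem_ball, dist_comm]; exact hzx.trans hk))
    · apply iUnion_subset
      intro k x hx
      by_contra h
      exact hx (self_subset_thickening (by positivity) _ h)
  have hmono : Monotone fun k : ℕ => (thickening (1/((k:ℝ)+1)) Uᶜ)ᶜ := by
    intro a b hab
    apply compl_subset_compl.2
    exact thickening_mono (Nat.one_div_le_one_div hab) _
  have e : μ U = ⨆ k : ℕ, μ (thickening (1/((k:ℝ)+1)) Uᶜ)ᶜ := by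
    conv_lhs => rw [hUU]
    rw [hmono.measure_iUnion]
  rw [e, ENNReal.mul_iSup]
  refine iSup_le fun k => ?_
  have hρ : (0:ℝ) < 1/((k:ℝ)+1) := by positivity
  set ρ := (1:ℝ)/((k:ℝ)+1)
  set V := (thickening ρ Uᶜ)ᶜ
  have h1 : g ρ * μ V ≤ f ρ * ν U := unif_fubini hf hg hρ isOpen_thickening.measurableSet.compl hU.measurableSet (by
    intro x hx y hy
    by_contra h
    exact hx (mem_thickening_iff.2 ⟨y, h, by rw [dist_comm]; exact hy⟩))
  have h2 : f ρ * ν univ ≤ g ρ * μ univ := unif_fubini hg hf hρ MeasurableSet.univ MeasurableSet.univ (fun _ _ => subset_univ _)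
  have hf0 : f ρ ≠ 0 := unif_ball_ne hf hμ hρ
  have hft : f ρ ≠ ⊤ := by
    obtain ⟨x⟩ := hne
    rw [← hf x ρ hρ]; exact measure_ne_top _ _
  rw [← ENNReal.mul_le_mul_iff_right hf0 hft]
  calc f ρ * (ν univ * μ V) = (f ρ * ν univ) * μ V := by ring
    _ ≤ (g ρ * μ univ) * μ V := by gcongr
    _ = μ univ * (g ρ * μ V) := by ring
    _ ≤ μ univ * (f ρ * ν U) := by gcongr
    _ = _ := by ring

theorem unif_unique {f g : ℝ → ℝ≥0∞} (hf : ∀ x ρ, 0 < ρ → μ (ball x ρ) = f ρ)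
    (hg : ∀ x ρ, 0 < ρ → ν (ball x ρ) = g ρ) (hμ : μ ≠ 0) (hν : ν ≠ 0) :
    ν univ • μ = μ univ • ν := by
  have : IsFiniteMeasure (ν univ • μ) := Measure.smul_finite μ (measure_ne_top ν univ)
  apply ext_of_generate_finite _ (BorelSpace.measurable_eq) isPiSystem_isOpen
  · intro U hU
    rw [Measure.smul_apply, Measure.smul_apply, smul_eq_mul, smul_eq_mul]
    exact le_antisymm (unif_open hf hg hμ hU) (unif_open hg hf hν hU)
  · rw [Measure.smul_apply, Measure.smul_apply, smul_eq_mul, smul_eq_mul, mul_comm]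
end Unif

section Sphere
variable {n : ℕ}

/-- slice -/
def slc (E : Set (Euc n)) (r : ℝ) : Set (Sph n) := {ω | r • (ω : Euc n) ∈ E}

theorem measurableSet_slc {E : Set (Euc n)} (hE : MeasurableSet E) (r : ℝ) : MeasurableSet (slc E r) :=
  (show Measurable fun ω : Sph n => r • (ω : Euc n) by fun_prop) hE

/-- a linear isometry acting on the sphere -/
noncomputable def sphIso (A : Euc n ≃ₗᵢ[ℝ] Euc n) : Sph n ≃ᵢ Sph n where
  toFun ω := ⟨A ω, by rw [mem_sphere_zero_iff_norm, A.norm_map]; exact norm_sph ω⟩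
  invFun ω := ⟨A.symm ω, by rw [mem_sphere_zero_iff_norm, A.symm.norm_map]; exact norm_sph ω⟩
  left_inv ω := by apply Subtype.ext; simp
  right_inv ω := by apply Subtype.ext; simp
  isometry_toFun := by
    apply Isometry.of_dist_eq
    intro x y
    rw [Subtype.dist_eq, Subtype.dist_eq]
    exact A.dist_map _ _

theorem sphIso_coe (A : Euc n ≃ₗᵢ[ℝ] Euc n) (ω : Sph n) : (sphIso A ω : Euc n) = A ω := rfl

theorem sig_mp (A : Euc n ≃ₗᵢ[ℝ] Euc n) : MeasurePreserving (sphIso A) (sig n) (sig n) :=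
  (sphIso A).measurePreserving_hausdorffMeasure _

theorem dim_nonneg (hn : 1 ≤ n) : (0:ℝ) ≤ (n:ℝ) - 1 := by
  have : (1:ℝ) ≤ n := by exact_mod_cast hn
  linarith

theorem sig_finite (hn : 1 ≤ n) : IsFiniteMeasure (sig n) := by
  have : CompactSpace (Sph n) := isCompact_iff_compactSpace.1 (isCompact_sphere _ _)
  have : IsLocallyFiniteMeasure (sig n) := by
    refine ⟨fun (ω : Sph n) => ?_⟩
    set u : Euc n := (ω : Euc n) with hu'
    have hu : ‖u‖ = 1 := norm_sph ω
    have := haar_hyp hu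
    refine ⟨{ω' : Sph n | 1/2 < ⟪u, (ω' : Euc n)⟫}, ?_, ?_⟩
    · apply IsOpen.mem_nhds
      · exact isOpen_lt continuous_const (by fun_prop)
      · show 1/2 < ⟪u, u⟫
        rw [real_inner_self_eq_norm_sq, hu]; norm_num
    · have hsub : {ω' : Sph n | 1/2 < ⟪u, (ω' : Euc n)⟫} ⊆ chartMap hu '' (closedBall 0 3) := by
        intro ω' (h : 1/2 < ⟪u, (ω' : Euc n)⟫)
        obtain ⟨y, hy1, hy2⟩ := exists_chartMap hu ω' (by linarith)
        refine ⟨y, ?_, hy1⟩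
        rw [mem_closedBall_zero_iff]
        have h3 : ⟪u, (ω' : Euc n)⟫ * ‖(y : Euc n) + u‖ = 1 := by
          have h7 := congrArg norm hy2
          rw [norm_smul, Real.norm_of_nonneg (by linarith)] at h7
          exact h7.trans (norm_sph ω')
        have h4 : ‖(y : Euc n) + u‖ ≤ 2 := by nlinarith [norm_nonneg ((y : Euc n) + u)]
        have h5 : ‖(y : Euc n)‖ ≤ ‖(y : Euc n) + u‖ + ‖u‖ := by
          have := norm_sub_le ((y : Euc n) + u) u
          rwa [add_sub_cancel_right] at this
        have h6 : ‖(y : Euc n)‖ = ‖y‖ := rfl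
        rw [← h6]; linarith
      refine lt_of_le_of_lt (measure_mono hsub) ?_
      refine lt_of_le_of_lt (haus_image_le (K := 2) (dim_nonneg hn) (fun x _ y _ => chartMap_lip hu x y)) ?_
      exact ENNReal.mul_lt_top (ENNReal.rpow_lt_top_of_nonneg (dim_nonneg hn) ENNReal.coe_ne_top) measure_closedBall_lt_top
  infer_instance

theorem sig_ne_zero (hn : 1 ≤ n) : sig n ≠ 0 := by
  intro h0
  set u : Euc n := EuclideanSpace.single ⟨0, hn⟩ 1
  have hu : ‖u‖ = 1 := by simp [u]
  have := haar_hyp hu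
  set f : Sph n → Hyp u := fun ω => (Hyp u).orthogonalProjection (ω : Euc n)
  have hlip : ∀ x ∈ (univ : Set (Sph n)), ∀ y ∈ (univ : Set (Sph n)), dist (f x) (f y) ≤ (1:ℝ≥0) * dist x y := by
    intro x _ y _
    rw [NNReal.coe_one, one_mul, dist_eq_norm, Subtype.dist_eq, dist_eq_norm]
    show ‖(Hyp u).orthogonalProjection (x : Euc n) - (Hyp u).orthogonalProjection (y : Euc n)‖ ≤ _
    rw [← map_sub]
    exact Submodule.norm_orthogonalProjection_apply_le _ _
  have h1 := haus_image_null (dim_nonneg hn) hlip (show (sig n) univ = 0 by rw [h0]; simp)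
  have h2 : ball (0 : Hyp u) 1 ⊆ f '' univ := by
    intro y hy
    rw [mem_ball_zero_iff] at hy
    have hy' : ‖(y : Euc n)‖ < 1 := hy
    have hn1 : ‖(y : Euc n) + Real.sqrt (1 - ‖(y : Euc n)‖^2) • u‖ = 1 := by
      have : ‖(y : Euc n) + Real.sqrt (1 - ‖(y : Euc n)‖^2) • u‖ ^ 2 = 1 := by
        rw [norm_add_sq_real, inner_smul_right, real_inner_comm, inner_hyp, norm_smul, hu, Real.norm_of_nonneg (Real.sqrt_nonneg _),
          mul_one, Real.sq_sqrt (by nlinarith [norm_nonneg (y : Euc n)])]; ring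
      nlinarith [norm_nonneg ((y : Euc n) + Real.sqrt (1 - ‖(y : Euc n)‖^2) • u)]
    refine ⟨⟨(y : Euc n) + Real.sqrt (1 - ‖(y : Euc n)‖^2) • u, by rw [mem_sphere_zero_iff_norm, hn1]⟩, mem_univ _, ?_⟩
    show (Hyp u).orthogonalProjection ((y : Euc n) + Real.sqrt (1 - ‖(y : Euc n)‖^2) • u) = y
    rw [map_add, map_smul, Submodule.orthogonalProjection_mem_subspace_eq_self]
    have : (Hyp u).orthogonalProjection u = 0 :=
      Submodule.orthogonalProjection_mem_subspace_orthogonalComplement_eq_zero (by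
        apply Submodule.le_orthogonal_orthogonal; exact Submodule.mem_span_singleton_self u)
    rw [this, smul_zero, add_zero]
  have h3 := measure_mono_null h2 h1
  exact (measure_ball_pos (μH[(n:ℝ) - 1] : Measure (Hyp u)) 0 one_pos).ne' h3

theorem exists_iso (ω ω' : Sph n) : ∃ A : Euc n ≃ₗᵢ[ℝ] Euc n, A ω = ω' := by
  refine ⟨Submodule.reflection (Submodule.span ℝ {(ω : Euc n) - ω'})ᗮ, ?_⟩
  exact Submodule.reflection_sub (by rw [norm_sph, norm_sph])

theorem toSphere_mp (A : Euc n ≃ₗᵢ[ℝ] Euc n) {s : Set (Sph n)} (hs : MeasurableSet s) :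
    (volume : Measure (Euc n)).toSphere (sphIso A ⁻¹' s) = (volume : Measure (Euc n)).toSphere s := by
  rw [Measure.toSphere_apply' _ hs, Measure.toSphere_apply' _ ((sphIso A).continuous.measurable hs)]
  congr 1
  have hmp := A.measurePreserving
  refine Eq.trans ?_ (hmp.measure_preimage_equiv (f := A.toMeasurableEquiv) _)
  congr 1
  ext x
  constructor
  · rintro ⟨t, ht, _, ⟨ω, hω, rfl⟩, rfl⟩
    refine ⟨t, ht, _, ⟨_, hω, rfl⟩, ?_⟩
    simp [sphIso_coe]
  · rintro ⟨t, ht, _, ⟨ω, hω, rfl⟩, h⟩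
    refine ⟨t, ht, _, ⟨(sphIso A).symm ω, by simpa using hω, rfl⟩, ?_⟩
    apply A.injective
    rw [show A x = t • (ω : Euc n) from h.symm]
    simp only [map_smul]
    congr 1
    rw [← sphIso_coe]; simp

noncomputable def polC (n : ℕ) : ℝ≥0∞ := (volume : Measure (Euc n)).toSphere univ / sig n univ

theorem toSphere_eq (hn : 1 ≤ n) : (volume : Measure (Euc n)).toSphere = polC n • sig n := by
  have := sig_finite hn
  have hs0 := sig_ne_zero hn
  have hnt : Nontrivial (Euc n) := by
    have : Nonempty (Fin n) := ⟨⟨0, hn⟩⟩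
    infer_instance
  have ht0 : (volume : Measure (Euc n)).toSphere ≠ 0 := Measure.toSphere_ne_zero _
  set p : Sph n := ⟨EuclideanSpace.single ⟨0, hn⟩ 1, by simp⟩
  have hball : ∀ (A : Euc n ≃ₗᵢ[ℝ] Euc n) (x : Sph n) ρ, ball x ρ = sphIso A ⁻¹' (ball (sphIso A x) ρ) := by
    intro A x ρ; rw [IsometryEquiv.preimage_ball]; simp
  have key := unif_unique (μ := (volume : Measure (Euc n)).toSphere) (ν := sig n)
    (f := fun ρ => (volume : Measure (Euc n)).toSphere (ball p ρ)) (g := fun ρ => sig n (ball p ρ))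
    (by
      intro x ρ _
      obtain ⟨A, hA⟩ := exists_iso x p
      have : sphIso A x = p := Subtype.ext hA
      rw [hball A x, toSphere_mp A measurableSet_ball, this])
    (by
      intro x ρ _
      obtain ⟨A, hA⟩ := exists_iso x p
      have : sphIso A x = p := Subtype.ext hA
      rw [hball A x, (sig_mp A).measure_preimage measurableSet_ball.nullMeasurableSet, this]) ht0 hs0
  have h1 : sig n univ ≠ 0 := by rwa [Ne, Measure.measure_univ_eq_zero]
  have h2 : sig n univ ≠ ⊤ := measure_ne_top _ _
  rw [polC, ENNReal.div_eq_inv_mul, mul_smul, ← key, smul_smul, ENNReal.inv_mul_cancel h1 h2, one_smul]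

theorem polC_ne_zero (hn : 1 ≤ n) : polC n ≠ 0 := by
  have hnt : Nontrivial (Euc n) := by
    have : Nonempty (Fin n) := ⟨⟨0, hn⟩⟩
    infer_instance
  intro h
  have := toSphere_eq hn
  rw [h, zero_smul] at this
  exact Measure.toSphere_ne_zero _ this

theorem polC_ne_top (hn : 1 ≤ n) : polC n ≠ ⊤ := by
  have := sig_finite hn
  have hs0 := sig_ne_zero hn
  refine ENNReal.div_ne_top (measure_ne_top _ _) (by rwa [Ne, Measure.measure_univ_eq_zero])

theorem measurable_sig_slc (hn : 1 ≤ n) {A : Set (Euc n)} (hA : MeasurableSet A) :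
    Measurable fun r : ℝ => sig n (slc A r) := by
  have := sig_finite hn
  exact measurable_measure_prodMk_left (s := {p : ℝ × Sph n | p.1 • (p.2 : Euc n) ∈ A})
    ((show Measurable fun p : ℝ × Sph n => p.1 • (p.2 : Euc n) by fun_prop) hA)

theorem polar (hn : 1 ≤ n) {A : Set (Euc n)} (hA : MeasurableSet A) :
    volume A = polC n * ∫⁻ r in Ioi (0:ℝ), ENNReal.ofReal (r ^ (n-1)) * sig n (slc A r) := by
  have := sig_finite hn
  have hnt : Nontrivial (Euc n) := by
    have : Nonempty (Fin n) := ⟨⟨0, hn⟩⟩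
    infer_instance
  have hmp := (volume : Measure (Euc n)).measurePreserving_homeomorphUnitSphereProd
  rw [finrank_euclideanSpace_fin, toSphere_eq hn] at hmp
  have hm : MeasurableSet {p : Sph n × Ioi (0:ℝ) | (p.2 : ℝ) • (p.1 : Euc n) ∈ A} :=
    (show Measurable fun p : Sph n × Ioi (0:ℝ) => (p.2 : ℝ) • (p.1 : Euc n) by fun_prop) hA
  have h1 : volume A = ((volume : Measure (Euc n)).comap (Subtype.val : ({0}ᶜ : Set (Euc n)) → Euc n))
      (Subtype.val ⁻¹' A) := by
    rw [comap_subtype_coe_apply (measurableSet_singleton _).compl, Subtype.image_preimage_coe, inter_comm]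
    rw [← diff_eq, measure_diff_null (measure_singleton _)]
  have h2 : (Subtype.val ⁻¹' A : Set ({0}ᶜ : Set (Euc n))) = homeomorphUnitSphereProd (Euc n) ⁻¹'
      {p : Sph n × Ioi (0:ℝ) | (p.2 : ℝ) • (p.1 : Euc n) ∈ A} := by
    ext ⟨x, hx⟩
    simp only [mem_preimage, mem_setOf_eq, homeomorphUnitSphereProd_apply_snd_coe, homeomorphUnitSphereProd_apply_fst_coe]
    rw [smul_smul, mul_inv_cancel₀ (norm_ne_zero_iff.2 hx), one_smul]
  rw [h1, h2, hmp.measure_preimage hm.nullMeasurableSet, Measure.prod_apply_symm hm, Measure.volumeIoiPow,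
    lintegral_withDensity_eq_lintegral_mul₀]
  · rw [← lintegral_const_mul' _ _ (polC_ne_top hn), ← lintegral_subtype_comap measurableSet_Ioi]
    apply lintegral_congr
    rintro ⟨r, hr⟩
    simp only [Pi.mul_apply, Measure.smul_apply, smul_eq_mul]
    have : (fun x : Sph n => (x, (⟨r, hr⟩ : Ioi (0:ℝ)))) ⁻¹' {p : Sph n × Ioi (0:ℝ) | (p.2 : ℝ) • (p.1 : Euc n) ∈ A} = slc A r := rfl
    rw [this]; ring
  · fun_prop
  · have : IsFiniteMeasure (polC n • sig n) := Measure.smul_finite _ (polC_ne_top hn)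
    exact (measurable_measure_prodMk_right hm).aemeasurable

theorem sphere_slice {r : ℝ} (hr : 0 < r) (hn : 1 ≤ n) (E : Set (Euc n)) :
    μH[(n:ℝ) - 1] (E ∩ sphere (0 : Euc n) r) = ENNReal.ofReal (r ^ (n-1)) * sig n (slc E r) := by
  have h1 : E ∩ sphere (0 : Euc n) r = r • (Subtype.val '' (slc E r)) := by
    ext x
    rw [mem_smul_set]
    constructor
    · rintro ⟨hx, hxr⟩
      rw [mem_sphere_zero_iff_norm] at hxr
      refine ⟨r⁻¹ • x, ⟨⟨r⁻¹ • x, ?_⟩, ?_, rfl⟩, ?_⟩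
      · rw [mem_sphere_zero_iff_norm, norm_smul, norm_inv, Real.norm_of_nonneg hr.le, hxr, inv_mul_cancel₀ hr.ne']
      · show r • r⁻¹ • x ∈ E
        rwa [smul_inv_smul₀ hr.ne']
      · rw [smul_inv_smul₀ hr.ne']
    · rintro ⟨_, ⟨ω, hω, rfl⟩, rfl⟩
      refine ⟨hω, ?_⟩
      rw [mem_sphere_zero_iff_norm, norm_smul, norm_sph, Real.norm_of_nonneg hr.le, mul_one]
  rw [h1, Measure.hausdorffMeasure_smul₀ (dim_nonneg hn) hr.ne', isometry_subtype_coe.hausdorffMeasure_image (Or.inl (dim_nonneg hn))]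
  rw [ENNReal.smul_def, smul_eq_mul]
  congr 1
  have : (n:ℝ) - 1 = ((n-1 : ℕ) : ℝ) := by rw [Nat.cast_sub hn]; simp
  rw [this, NNReal.rpow_natCast, ENNReal.ofReal]
  congr 1
  ext
  rw [Real.coe_toNNReal _ (by positivity)]
  simp [abs_of_pos hr]
end Sphere

end SecA4

section SecA5
open MeasureTheory Metric Set Filter
open scoped ENNReal NNReal Topology RealInnerProductSpace Pointwise
set_option linter.all false
set_option linter.deprecated false

section Crossing
variable {n : ℕ}

/-- good radii -/
def goodR (E : Set (Euc n)) : Set ℝ := {r | 0 < r ∧ ∀ᵐ (ω : Sph n) ∂(sig n),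
  (r • (ω : Euc n) ∉ E ↔ DZ volume n E (r • (ω : Euc n))) ∧
    (r • (ω : Euc n) ∈ E ↔ DZ volume n Eᶜ (r • (ω : Euc n)))}

theorem polar_ae (hn : 1 ≤ n) {A : Set (Euc n)} (hA : MeasurableSet A) (h0 : volume A = 0) :
    ∀ᵐ (r : ℝ) ∂(volume.restrict (Ioi (0:ℝ))), sig n (slc A r) = 0 := by
  have := polar hn hA
  rw [h0] at this
  have h1 := (mul_eq_zero.1 this.symm).resolve_left (polC_ne_zero hn)
  rw [lintegral_eq_zero_iff] at h1
  · filter_upwards [h1, ae_restrict_mem measurableSet_Ioi] with r hr hr0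
    have := mul_eq_zero.1 hr
    refine this.resolve_left ?_
    have : 0 < r ^ (n-1) := pow_pos hr0 _
    simp [this]
  · exact (by fun_prop : Measurable fun r : ℝ => ENNReal.ofReal (r ^ (n-1))).mul (measurable_sig_slc hn hA)

theorem goodR_ae (hn : 1 ≤ n) {E : Set (Euc n)} (hE : MeasurableSet E) :
    ∀ᵐ (r : ℝ) ∂(volume.restrict (Ioi (0:ℝ))), r ∈ goodR E := by
  have hm : MeasurableSet {x : Euc n | ¬ ((x ∉ E ↔ DZ volume n E x) ∧ (x ∈ E ↔ DZ volume n Eᶜ x))} := by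
    apply MeasurableSet.compl
    exact (hE.compl.iff measurableSet_DZ).inter (hE.iff measurableSet_DZ)
  have := polar_ae hn hm (ae_iff.1 (ae_DZ_iff hE))
  filter_upwards [this, ae_restrict_mem measurableSet_Ioi] with r hr hr0
  exact ⟨hr0, ae_iff.2 hr⟩

/-- mass function -/
noncomputable def mass (E : Set (Euc n)) (r : ℝ) : ℝ :=
  (μH[(n:ℝ) - 1] (essBoundary E ∩ closedBall 0 r)).toReal

theorem mass_fin {E : Set (Euc n)} (hP : perim E univ < ⊤) (A : Set (Euc n)) :
    μH[(n:ℝ) - 1] (essBoundary E ∩ A) ≠ ⊤ :=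
  ((measure_mono (inter_subset_inter_right _ (subset_univ _))).trans_lt hP).ne

theorem mass_mono {E : Set (Euc n)} (hP : perim E univ < ⊤) : Monotone (mass E) := by
  intro a b hab
  exact ENNReal.toReal_mono (mass_fin hP _) (measure_mono (inter_subset_inter_right _ (closedBall_subset_closedBall hab)))

theorem mass_nonneg (E : Set (Euc n)) (r : ℝ) : 0 ≤ mass E r := ENNReal.toReal_nonneg

theorem mass_le {E : Set (Euc n)} (hP : perim E univ < ⊤) (r : ℝ) : mass E r ≤ (perim E univ).toReal :=
  ENNReal.toReal_mono hP.ne (measure_mono (inter_subset_inter_right _ (subset_univ _)))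

theorem mass_shell {E : Set (Euc n)} (hE : MeasurableSet E) (hP : perim E univ < ⊤) {a b : ℝ} (hab : a ≤ b) :
    μH[(n:ℝ) - 1] (essBoundary E ∩ {x | a < ‖x‖ ∧ ‖x‖ ≤ b}) = ENNReal.ofReal (mass E b - mass E a) := by
  have h1 : essBoundary E ∩ {x | a < ‖x‖ ∧ ‖x‖ ≤ b} = (essBoundary E ∩ closedBall 0 b) \ (essBoundary E ∩ closedBall 0 a) := by
    ext x
    simp only [mem_inter_iff, mem_setOf_eq, mem_diff, mem_closedBall_zero_iff, not_and, not_le]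
    tauto
  rw [h1, measure_diff (inter_subset_inter_right _ (closedBall_subset_closedBall hab))
    ((measurableSet_essBoundary hE).inter isClosed_closedBall.measurableSet).nullMeasurableSet (mass_fin hP _)]
  rw [ENNReal.ofReal_sub _ (mass_nonneg _ _), mass, mass, ENNReal.ofReal_toReal (mass_fin hP _), ENNReal.ofReal_toReal (mass_fin hP _)]

theorem crossing (hn : 1 ≤ n) {E : Set (Euc n)} (hE : MeasurableSet E) {a b : ℝ}
    (ha : a ∈ goodR E) (hb : b ∈ goodR E) (hab : a ≤ b) :
    sig n {ω | ¬ (a • (ω : Euc n) ∈ E ↔ b • (ω : Euc n) ∈ E)} ≤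
      ((2 / a).toNNReal : ℝ≥0∞) ^ ((n:ℝ) - 1) * μH[(n:ℝ) - 1] (essBoundary E ∩ {x | a < ‖x‖ ∧ ‖x‖ ≤ b}) := by
  have ha0 := ha.1
  have h1 : ∀ᵐ (ω : Sph n) ∂(sig n), ω ∈ {ω : Sph n | ¬ (a • (ω : Euc n) ∈ E ↔ b • (ω : Euc n) ∈ E)} →
      ω ∈ (Subtype.val ⁻¹' (hatv '' (essBoundary E ∩ {x | a < ‖x‖ ∧ ‖x‖ ≤ b})) : Set (Sph n)) := by
    filter_upwards [ha.2, hb.2, rays_lemma hn hE] with ω hωa hωb hω hne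
    by_contra hcon
    apply hne
    have := hω a b ha0 (by
      intro t ht hmem
      rcases eq_or_lt_of_le ht.1 with h | h
      · rw [← h, mem_essBoundary_iff hE] at hmem
        by_cases hx : a • (ω : Euc n) ∈ E
        · exact hmem.2 (hωa.2.1 hx)
        · exact hmem.1 (hωa.1.1 hx)
      · apply hcon
        have ht0 : 0 < t := ha0.trans h
        have hnt : ‖t • (ω : Euc n)‖ = t := by rw [norm_smul, norm_sph, mul_one, Real.norm_of_nonneg ht0.le]
        refine ⟨t • (ω : Euc n), ⟨hmem, ?_⟩, ?_⟩
        · show a < ‖t • (ω : Euc n)‖ ∧ ‖t • (ω : Euc n)‖ ≤ b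
          rw [hnt]; exact ⟨h, ht.2⟩
        · rw [hatv, hnt, inv_smul_smul₀ ht0.ne'])
    rcases this with h | h
    · have h1 := hωa.1.2 (h a ⟨le_rfl, hab⟩)
      have h2 := hωb.1.2 (h b ⟨hab, le_rfl⟩)
      tauto
    · have h1 := hωa.2.2 (h a ⟨le_rfl, hab⟩)
      have h2 := hωb.2.2 (h b ⟨hab, le_rfl⟩)
      tauto
  refine (measure_mono_ae h1).trans ?_
  have h2 : sig n (Subtype.val ⁻¹' (hatv '' (essBoundary E ∩ {x | a < ‖x‖ ∧ ‖x‖ ≤ b}))) ≤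
      μH[(n:ℝ)-1] (hatv '' (essBoundary E ∩ {x | a < ‖x‖ ∧ ‖x‖ ≤ b})) := by
    rw [sig, ← isometry_subtype_coe.hausdorffMeasure_image (Or.inl (dim_nonneg hn))]
    exact measure_mono (image_preimage_subset _ _)
  refine h2.trans (haus_image_le (dim_nonneg hn) ?_)
  intro x hx y hy
  rw [dist_eq_norm, dist_eq_norm, Real.coe_toNNReal _ (by positivity)]
  exact norm_hatv_sub_le ha0 hx.2.1.le hy.2.1.le

noncomputable def xi (E : Set (Euc n)) (r : ℝ) : ℝ := (sig n (slc E r)).toReal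

theorem crossing_xi (hn : 1 ≤ n) {E : Set (Euc n)} (hE : MeasurableSet E) (hP : perim E univ < ⊤) {a b : ℝ}
    (ha : a ∈ goodR E) (hb : b ∈ goodR E) (hab : a ≤ b) :
    |xi E a - xi E b| ≤ (2 / a) ^ (n-1) * (mass E b - mass E a) := by
  have ha0 := ha.1
  have := sig_finite hn
  have hc := crossing hn hE ha hb hab
  rw [mass_shell hE hP hab] at hc
  have e1 : ((2 / a).toNNReal : ℝ≥0∞) ^ ((n:ℝ) - 1) = ENNReal.ofReal ((2/a)^(n-1)) := by
    have : (n:ℝ) - 1 = ((n-1 : ℕ) : ℝ) := by rw [Nat.cast_sub hn]; simp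
    rw [this, ENNReal.rpow_natCast, ENNReal.ofReal_pow (by positivity)]; rfl
  rw [e1, ← ENNReal.ofReal_mul (by positivity)] at hc
  have hm := mul_nonneg (show 0 ≤ (2/a)^(n-1) by positivity) (sub_nonneg.2 (mass_mono hP hab))
  have key : ∀ s t : Set (Sph n), sig n (s \ t) ≤ ENNReal.ofReal ((2/a)^(n-1) * (mass E b - mass E a)) →
      (sig n s).toReal ≤ (sig n t).toReal + (2/a)^(n-1) * (mass E b - mass E a) := by
    intro s t h
    have h1 : sig n s ≤ sig n t + sig n (s \ t) := by
      refine (measure_mono (show s ⊆ t ∪ (s \ t) by simp)).trans (measure_union_le _ _)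
    have h2 := ENNReal.toReal_mono (ENNReal.add_ne_top.2 ⟨measure_ne_top _ _, ENNReal.ofReal_ne_top⟩) (h1.trans (add_le_add_right h _))
    rwa [ENNReal.toReal_add (measure_ne_top _ _) ENNReal.ofReal_ne_top, ENNReal.toReal_ofReal hm] at h2
  rw [abs_le]
  have k1 := key (slc E a) (slc E b) ((measure_mono (by
    rintro ω ⟨h1, h2⟩ h
    exact h2 (h.1 h1))).trans hc)
  have k2 := key (slc E b) (slc E a) ((measure_mono (by
    rintro ω ⟨h1, h2⟩ h
    exact h2 (h.2 h1))).trans hc)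
  unfold xi
  constructor <;> linarith

theorem sub_bv {p q : ℝ → ℝ} (hp : Monotone p) (hq : Monotone q) {C : ℝ} (hpC : ∀ x, |p x| ≤ C) (hqC : ∀ x, |q x| ≤ C)
    (s : Set ℝ) : BoundedVariationOn (fun x => p x - q x) s := by
  refine ne_top_of_le_ne_top (ENNReal.ofReal_ne_top (r := 4 * C)) ?_
  refine iSup_le ?_
  rintro ⟨N, u, hu, hus⟩
  simp only
  have h1 : ∀ i ∈ Finset.range N, edist (p (u (i+1)) - q (u (i+1))) (p (u i) - q (u i)) ≤
      ENNReal.ofReal ((p (u (i+1)) + q (u (i+1))) - (p (u i) + q (u i))) := by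
    intro i _
    rw [edist_dist, Real.dist_eq]
    apply ENNReal.ofReal_le_ofReal
    have a1 := hp (hu (Nat.le_succ i))
    have a2 := hq (hu (Nat.le_succ i))
    rw [abs_le]; simp only [Nat.succ_eq_add_one] at a1 a2
    constructor <;> linarith
  refine (Finset.sum_le_sum h1).trans ?_
  rw [← ENNReal.ofReal_sum_of_nonneg]
  · apply ENNReal.ofReal_le_ofReal
    rw [Finset.sum_range_sub (fun i => p (u i) + q (u i))]
    have := abs_le.1 (hpC (u N)); have := abs_le.1 (hqC (u N))
    have := abs_le.1 (hpC (u 0)); have := abs_le.1 (hqC (u 0))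
    linarith
  · intro i _
    have a1 := hp (hu (Nat.le_succ i))
    have a2 := hq (hu (Nat.le_succ i))
    simp only [Nat.succ_eq_add_one] at a1 a2
    linarith

theorem bv_main (hn : 2 ≤ n) {v : ℝ → ℝ} (hv : Measurable v) (hv0 : ∀ r ∈ Ioi (0:ℝ), 0 ≤ v r)
    {E : Set (Euc n)} (hE : MeasurableSet E) (hd : SphDistrib v E) (hP : perim E univ < ⊤) (hvol : volume E < ⊤) :
    BVIoi v := by
  have hn1 : 1 ≤ n := by omega
  have := sig_finite hn1
  have hintg : IntegrableOn v (Ioi (0:ℝ)) volume := by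
    refine ⟨hv.aestronglyMeasurable, ?_⟩
    rw [hasFiniteIntegral_iff_norm]
    have hp := polar hn1 hE
    have : ∫⁻ r in Ioi (0:ℝ), ENNReal.ofReal ‖v r‖ = ∫⁻ r in Ioi (0:ℝ), ENNReal.ofReal (r ^ (n-1)) * sig n (slc E r) := by
      apply lintegral_congr_ae
      filter_upwards [hd, ae_restrict_mem measurableSet_Ioi] with r hr hr0
      rw [← sphere_slice hr0 hn1, hr, Real.norm_of_nonneg (hv0 r hr0)]
    rw [this]
    by_contra hcon
    rw [not_lt, top_le_iff] at hcon
    rw [hcon, ENNReal.mul_top (polC_ne_zero hn1)] at hp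
    exact hvol.ne hp
  refine ⟨hintg, ?_⟩
  set G : Set ℝ := {r | r ∈ goodR E ∧ v r = r ^ (n-1) * xi E r} with hG
  have hGae : ∀ᵐ (r : ℝ) ∂(volume.restrict (Ioi (0:ℝ))), r ∈ G := by
    filter_upwards [goodR_ae hn1 hE, hd, ae_restrict_mem measurableSet_Ioi] with r h1 h2 h3
    refine ⟨h1, ?_⟩
    rw [sphere_slice h3 hn1] at h2
    have := congrArg ENNReal.toReal h2
    rw [ENNReal.toReal_mul, ENNReal.toReal_ofReal (hv0 r h3), ENNReal.toReal_ofReal (pow_nonneg (le_of_lt h3) _)] at this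
    exact this.symm
  have hcr : ∀ a ∈ G, ∀ b ∈ G, a ≤ b → v a ≤ v b + 2^(n-1) * (mass E b - mass E a) := by
    intro a ha b hb hab
    have ha0 := ha.1.1
    have hb0 := hb.1.1
    have h1 := crossing_xi hn1 hE hP ha.1 hb.1 hab
    rw [ha.2, hb.2]
    have h2 : xi E a ≤ xi E b + (2 / a) ^ (n-1) * (mass E b - mass E a) := by
      have := (abs_le.1 h1).2; linarith
    have h3 : a^(n-1) * xi E a ≤ a^(n-1) * (xi E b + (2 / a) ^ (n-1) * (mass E b - mass E a)) := by gcongr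
    have h4 : a^(n-1) * xi E b ≤ b^(n-1) * xi E b := by
      have : 0 ≤ xi E b := ENNReal.toReal_nonneg
      gcongr
    have h5 : a^(n-1) * (2/a)^(n-1) = 2^(n-1) := by
      rw [← mul_pow]; congr 1; field_simp
    calc a^(n-1) * xi E a ≤ _ := h3
      _ = a^(n-1) * xi E b + (a^(n-1) * (2/a)^(n-1)) * (mass E b - mass E a) := by ring
      _ ≤ _ := by rw [h5]; linarith
  set T := (perim E univ).toReal
  have hT0 : 0 ≤ T := ENNReal.toReal_nonneg
  have hlarge : ∀ a : ℝ, ∃ b ∈ G, a ≤ b ∧ v b ≤ 1 := by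
    intro a
    by_contra hcon
    push Not at hcon
    have h1 : ∀ᵐ (r : ℝ) ∂(volume.restrict (Ioi (max a 0))), 1 ≤ ‖v r‖ := by
      have h2 : ∀ᵐ (r : ℝ) ∂(volume.restrict (Ioi (max a 0))), r ∈ G :=
        ae_mono (Measure.restrict_mono (Ioi_subset_Ioi (le_max_right _ _)) le_rfl) hGae
      filter_upwards [h2, ae_restrict_mem measurableSet_Ioi] with r h3 h4
      have := hcon r h3 ((le_max_left _ _).trans (le_of_lt h4))
      exact this.le.trans (le_abs_self _)
    have h3 : IntegrableOn v (Ioi (max a 0)) volume := hintg.mono_set (Ioi_subset_Ioi (le_max_right _ _))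
    have h4 : Integrable (fun _ : ℝ => (1:ℝ)) (volume.restrict (Ioi (max a 0))) :=
      Integrable.mono (show Integrable v _ from h3) (by fun_prop) (by filter_upwards [h1] with r hr; simpa using hr)
    rw [integrable_const_iff] at h4
    simp [isFiniteMeasure_restrict] at h4
  set c : ℝ := 2^(n-1)
  have hc0 : 0 ≤ c := by positivity
  have hmT : ∀ r, mass E r ≤ T := mass_le hP
  have hm0 : ∀ r, 0 ≤ mass E r := mass_nonneg E
  set h : ℝ → ℝ := fun r => v r + c * mass E r
  have hmon : MonotoneOn h G := by
    intro a ha b hb hab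
    have := hcr a ha b hb hab
    simp only [h]; linarith
  have hlo : ∀ r ∈ G, 0 ≤ h r := fun r hr => add_nonneg (hv0 r hr.1.1) (mul_nonneg hc0 (hm0 r))
  have hup : ∀ r ∈ G, h r ≤ 1 + c * T := by
    intro r hr
    obtain ⟨b, hb, hrb, hvb⟩ := hlarge r
    have h1 := hmon hr hb hrb
    have h2 : c * mass E b ≤ c * T := by gcongr; exact hmT b
    simp only [h] at h1 ⊢; linarith
  obtain ⟨H, hHm, hHe⟩ := hmon.exists_monotone_extension ⟨0, by rintro _ ⟨r, hr, rfl⟩; exact hlo r hr⟩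
    ⟨1 + c * T, by rintro _ ⟨r, hr, rfl⟩; exact hup r hr⟩
  set C := 1 + c * T
  have hC0 : 0 ≤ C := by positivity
  refine ⟨fun r => max 0 (min (H r) C) - c * mass E r, ?_, ?_⟩
  · filter_upwards [hGae] with r hr
    rw [← hHe hr, min_eq_left (hup r hr), max_eq_right (hlo r hr)]
    simp [h]
  · refine sub_bv (C := C) ?_ ?_ ?_ ?_ _
    · intro a b hab
      exact max_le_max le_rfl (min_le_min (hHm hab) le_rfl)
    · intro a b hab
      exact mul_le_mul_of_nonneg_left (mass_mono hP hab) hc0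
    · intro x
      rw [abs_of_nonneg (le_max_left _ _)]
      exact max_le hC0 (min_le_right _ _)
    · intro x
      rw [abs_of_nonneg (mul_nonneg hc0 (hm0 x))]
      have : c * mass E x ≤ c * T := by gcongr; exact hmT x
      linarith
end Crossing

end SecA5

section SecA6
open MeasureTheory Metric Set Filter
open scoped ENNReal NNReal Topology RealInnerProductSpace Pointwise
set_option linter.all false
set_option linter.deprecated false

section PolG
variable {X : Type*}

/-- abstract polarization -/
def polG (R : X → X) (Hm : Set X) (A : Set X) : Set X :=
  {x | (x ∉ Hm ∧ (x ∈ A ∨ R x ∈ A)) ∨ (x ∈ Hm ∧ x ∈ A ∧ R x ∈ A)}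

variable [MeasurableSpace X] {μ : Measure X} {R : X → X} {Hm A B F : Set X}

theorem measurableSet_polG (hR : Measurable R) (hH : MeasurableSet Hm) (hA : MeasurableSet A) :
    MeasurableSet (polG R Hm A) :=
  (hH.compl.inter (hA.union (hR hA))).union (hH.inter (hA.inter (hR hA)))

theorem polG_measure (hR : MeasurePreserving R μ μ) (hinv : ∀ x, R (R x) = x) (hH : MeasurableSet Hm)
    (hA : MeasurableSet A) (hB : MeasurableSet B) (hRB : ∀ x, R x ∈ B ↔ x ∈ B)
    (h1 : ∀ x, x ∈ Hm → R x ∉ Hm) (h2 : ∀ x, x ∉ Hm → R x ∉ Hm → R x = x) :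
    μ (polG R Hm A ∩ B) = μ (A ∩ B) := by
  have hRA := hR.measurable hA
  set Y0 := A ∩ R ⁻¹' A ∩ B
  set Y1 := {x | x ∉ Hm ∧ x ∈ A ∧ R x ∉ A ∧ x ∈ B}
  set Y2 := {x | x ∈ Hm ∧ x ∈ A ∧ R x ∉ A ∧ x ∈ B}
  have m1 : MeasurableSet Y1 := hH.compl.inter (hA.inter (hRA.compl.inter hB))
  have m2 : MeasurableSet Y2 := hH.inter (hA.inter (hRA.compl.inter hB))
  have e1 : A ∩ B = Y0 ∪ (Y1 ∪ Y2) := by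
    ext x; simp only [Y0, Y1, Y2, mem_inter_iff, mem_union, mem_setOf_eq, mem_preimage]; tauto
  have e2 : polG R Hm A ∩ B = Y0 ∪ (Y1 ∪ R ⁻¹' Y2) := by
    ext x
    have a1 := h1 (R x)
    have a2 := h2 x
    have a3 := hRB x
    rw [hinv] at a1
    by_cases hx : R x = x
    · simp only [polG, Y0, Y1, Y2, mem_inter_iff, mem_union, mem_setOf_eq, mem_preimage, hinv, hx]; tauto
    · simp only [polG, Y0, Y1, Y2, mem_inter_iff, mem_union, mem_setOf_eq, mem_preimage, hinv]; tauto
  rw [e1, e2, measure_union, measure_union, measure_union, measure_union, hR.measure_preimage m2.nullMeasurableSet]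
  · rw [disjoint_left]; rintro x hx hx'; exact hx.1 hx'.1
  · exact m2
  · rw [disjoint_left]; rintro x hx (hx'|hx')
    · exact hx'.2.2.1 hx.1.2
    · exact hx'.2.2.1 hx.1.2
  · exact m1.union m2
  · rw [disjoint_left]; rintro x hx hx'
    have := hx'.2.2.1; rw [hinv] at this; exact this hx.2.1
  · exact hR.measurable m2
  · rw [disjoint_left]; rintro x hx (hx'|hx')
    · exact hx'.2.2.1 hx.1.2
    · have := hx'.2.2.1; rw [hinv] at this; exact this hx.1.1
  · exact m1.union (hR.measurable m2)

theorem polG_gain (hR : MeasurePreserving R μ μ) (hinv : ∀ x, R (R x) = x) (hH : MeasurableSet Hm)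
    (hA : MeasurableSet A) (hF : MeasurableSet F)
    (h1 : ∀ x, x ∈ Hm → R x ∉ Hm) (hFH : ∀ x, x ∈ Hm → x ∈ F → R x ∈ F) :
    μ (F \ polG R Hm A) + μ {x | x ∈ F \ A ∧ R x ∈ A \ F} ≤ μ (F \ A) := by
  have hRA := hR.measurable hA
  have hRF := hR.measurable hF
  set T := {x | x ∈ F \ A ∧ R x ∈ A \ F}
  set X1 := {x | x ∈ F \ A ∧ ¬ (x ∉ Hm ∧ R x ∈ A)}
  set X2 := {x | x ∉ Hm ∧ x ∈ F \ A ∧ R x ∈ A ∧ R x ∈ F}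
  have mT : MeasurableSet T := (hF.diff hA).inter (hRA.diff hRF)
  have m1 : MeasurableSet X1 := (hF.diff hA).inter (hH.compl.inter hRA).compl
  have m2 : MeasurableSet X2 := hH.compl.inter ((hF.diff hA).inter (hRA.inter hRF))
  have s1 : F \ polG R Hm A ⊆ X1 ∪ R ⁻¹' X2 := by
    intro x
    have a1 := h1 x
    have a2 := hFH x
    simp only [polG, X1, X2, mem_diff, mem_union, mem_setOf_eq, mem_preimage, hinv]; tauto
  have s2 : X1 ∪ (X2 ∪ T) ⊆ F \ A := by
    rintro x (h | h | h)
    · exact h.1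
    · exact h.2.1
    · exact h.1
  calc μ (F \ polG R Hm A) + μ T ≤ (μ X1 + μ (R ⁻¹' X2)) + μ T := by
        gcongr; exact (measure_mono s1).trans (measure_union_le _ _)
    _ = μ X1 + (μ X2 + μ T) := by rw [hR.measure_preimage m2.nullMeasurableSet, add_assoc]
    _ = μ (X1 ∪ (X2 ∪ T)) := by
        rw [measure_union _ (m2.union mT), measure_union _ mT]
        · rw [disjoint_left]; rintro x hx hx'; exact hx'.2.2 hx.2.2.2
        · rw [disjoint_left]; rintro x hx (hx'|hx')
          · exact hx.2 ⟨hx'.1, hx'.2.2.1⟩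
          · apply hx.2
            refine ⟨fun h => ?_, hx'.2.1⟩
            exact hx'.2.2 (hFH x h hx'.1.1)
    _ ≤ _ := measure_mono s2
end PolG

section Pol
variable {n : ℕ}

noncomputable abbrev rfx (u : Euc n) : Euc n ≃ₗᵢ[ℝ] Euc n := Submodule.reflection (Hyp u)

theorem rfx_apply {u : Euc n} (hu : ‖u‖ = 1) (x : Euc n) : rfx u x = x - (2 * ⟪u, x⟫) • u := by
  show Submodule.reflection (Submodule.span ℝ {u})ᗮ x = _
  rw [Submodule.reflection_orthogonal_apply, Submodule.reflection_singleton_apply]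
  simp only [hu, RCLike.ofReal_real_eq_id, id, one_pow, div_one, neg_sub]
  rw [two_smul, two_mul, add_smul]

theorem rfx_rfx (u x : Euc n) : rfx u (rfx u x) = x := Submodule.reflection_reflection _ _

theorem inner_rfx {u : Euc n} (hu : ‖u‖ = 1) (x : Euc n) : ⟪u, rfx u x⟫ = - ⟪u, x⟫ := by
  rw [rfx_apply hu, inner_sub_right, inner_smul_right, real_inner_self_eq_norm_sq, hu]; ring

def Hm (u : Euc n) : Set (Euc n) := {x | ⟪u, x⟫ < 0}

def pol (u : Euc n) (A : Set (Euc n)) : Set (Euc n) := polG (rfx u) (Hm u) A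

theorem isOpen_Hm (u : Euc n) : IsOpen (Hm u) := isOpen_lt (by fun_prop) continuous_const
theorem measurableSet_Hm (u : Euc n) : MeasurableSet (Hm u) := (isOpen_Hm u).measurableSet

theorem measurableSet_pol (u : Euc n) {A : Set (Euc n)} (hA : MeasurableSet A) : MeasurableSet (pol u A) :=
  measurableSet_polG (rfx u).continuous.measurable (measurableSet_Hm u) hA

theorem Hm_refl {u : Euc n} (hu : ‖u‖ = 1) (x : Euc n) (hx : x ∈ Hm u) : rfx u x ∉ Hm u := by
  unfold Hm at *
  rw [mem_setOf_eq] at *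
  rw [inner_rfx hu]; linarith

theorem Hm_refl' {u : Euc n} (hu : ‖u‖ = 1) (x : Euc n) (hx : x ∉ Hm u) (h : rfx u x ∉ Hm u) : rfx u x = x := by
  unfold Hm at *
  rw [mem_setOf_eq] at *
  rw [inner_rfx hu] at h
  have : ⟪u, x⟫ = 0 := by linarith
  rw [rfx_apply hu, this]; simp

theorem pol_volume {u : Euc n} (hu : ‖u‖ = 1) {A B : Set (Euc n)} (hA : MeasurableSet A) (hB : MeasurableSet B)
    (hRB : ∀ x, rfx u x ∈ B ↔ x ∈ B) : volume (pol u A ∩ B) = volume (A ∩ B) :=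
  polG_measure (rfx u).measurePreserving (rfx_rfx u) (measurableSet_Hm u) hA hB hRB (Hm_refl hu) (Hm_refl' hu)

theorem pol_slc {u : Euc n} (hu : ‖u‖ = 1) {A : Set (Euc n)} (hA : MeasurableSet A) {r : ℝ} (hr : 0 < r) :
    sig n (slc (pol u A) r) = sig n (slc A r) := by
  have h := polG_measure (X := Sph n) (μ := sig n) (R := sphIso (rfx u)) (Hm := {ω : Sph n | ⟪u, (ω : Euc n)⟫ < 0})
    (A := slc A r) (B := univ) (sig_mp _) (fun ω => Subtype.ext (rfx_rfx u ω))
    (measurableSet_lt (by fun_prop) measurable_const) (measurableSet_slc hA r) MeasurableSet.univ (by simp)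
    (fun ω h => Hm_refl hu ω h) (fun ω h h' => Subtype.ext (Hm_refl' hu ω h h'))
  rw [inter_univ, inter_univ] at h
  rw [← h]
  congr 1
  ext ω
  have h3 : ⟪u, r • (ω : Euc n)⟫ < 0 ↔ ⟪u, (ω : Euc n)⟫ < 0 := by
    rw [inner_smul_right]
    constructor
    · intro h; by_contra hc; rw [not_lt] at hc; nlinarith [mul_nonneg hr.le hc]
    · intro h; nlinarith
  have h4 : rfx u (r • (ω : Euc n)) = r • (sphIso (rfx u) ω : Euc n) := by
    rw [map_smul]; rfl
  simp only [slc, pol, polG, Hm, mem_setOf_eq]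
  rw [h3, h4]

theorem DZ_refl (u : Euc n) {A : Set (Euc n)} {x : Euc n} :
    DZ volume n (rfx u ⁻¹' A) x ↔ DZ volume n A (rfx u x) := by
  have : ∀ ρ : ℝ, volume (rfx u ⁻¹' A ∩ ball x ρ) = volume (A ∩ ball (rfx u x) ρ) := by
    intro ρ
    have h := (rfx u).measurePreserving.measure_preimage_equiv (f := (rfx u).toMeasurableEquiv) (A ∩ ball (rfx u x) ρ)
    rw [← h]
    congr 1
    ext y
    constructor
    · rintro ⟨h1, h2⟩; exact ⟨h1, by show dist (rfx u y) (rfx u x) < ρ; rw [(rfx u).dist_map]; exact h2⟩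
    · rintro ⟨h1, h2⟩; refine ⟨h1, ?_⟩
      have h2 : dist (rfx u y) (rfx u x) < ρ := h2
      rw [(rfx u).dist_map] at h2; exact h2
  simp only [DZ, this]

theorem essB_refl (u : Euc n) {A : Set (Euc n)} (hA : MeasurableSet A) :
    essBoundary (rfx u ⁻¹' A) = rfx u ⁻¹' (essBoundary A) := by
  ext x
  rw [mem_preimage, mem_essBoundary_iff hA, mem_essBoundary_iff ((rfx u).continuous.measurable hA), ← preimage_compl,
    DZ_refl, DZ_refl]

theorem haus_refl (u : Euc n) (d : ℝ) (A : Set (Euc n)) : μH[d] (rfx u ⁻¹' A) = μH[d] A :=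
  (rfx u).toIsometryEquiv.hausdorffMeasure_preimage d A

theorem essB_congr_loc {A A' U : Set (Euc n)} (hA : MeasurableSet A) (hA' : MeasurableSet A') (hU : IsOpen U)
    (h : ∀ x ∈ U, x ∈ A ↔ x ∈ A') : essBoundary A ∩ U = essBoundary A' ∩ U := by
  ext x
  constructor
  · rintro ⟨h1, h2⟩
    obtain ⟨ρ, hρ, hb⟩ := Metric.isOpen_iff.1 hU x h2
    refine ⟨?_, h2⟩
    rw [mem_essBoundary_iff hA] at h1
    rw [mem_essBoundary_iff hA']
    exact ⟨fun hd => h1.1 (hd.mono_loc hρ (.of_forall fun y hy hy' => (h y (hb hy)).1 hy')),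
      fun hd => h1.2 (hd.mono_loc hρ (.of_forall fun y hy hy' hy'' => hy' ((h y (hb hy)).2 hy'')))⟩
  · rintro ⟨h1, h2⟩
    obtain ⟨ρ, hρ, hb⟩ := Metric.isOpen_iff.1 hU x h2
    refine ⟨?_, h2⟩
    rw [mem_essBoundary_iff hA'] at h1
    rw [mem_essBoundary_iff hA]
    exact ⟨fun hd => h1.1 (hd.mono_loc hρ (.of_forall fun y hy hy' => (h y (hb hy)).2 hy')),
      fun hd => h1.2 (hd.mono_loc hρ (.of_forall fun y hy hy' hy'' => hy' ((h y (hb hy)).1 hy'')))⟩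

theorem essB_union_inter {A A' X : Set (Euc n)} (hA : MeasurableSet A) (hA' : MeasurableSet A') (hX : MeasurableSet X) (d : ℝ) :
    μH[d] (essBoundary (A ∪ A') ∩ X) + μH[d] (essBoundary (A ∩ A') ∩ X) ≤
      μH[d] (essBoundary A ∩ X) + μH[d] (essBoundary A' ∩ X) := by
  rw [← measure_union_add_inter _ ((measurableSet_essBoundary (hA.inter hA')).inter hX),
    ← measure_union_add_inter _ ((measurableSet_essBoundary hA').inter hX)]
  apply add_le_add
  · apply measure_mono
    rw [← union_inter_distrib_right, ← union_inter_distrib_right]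
    apply inter_subset_inter_left
    intro x hx
    by_contra hc
    rw [mem_union, not_or, notMem_essBoundary_iff hA, notMem_essBoundary_iff hA'] at hc
    rw [mem_union, mem_essBoundary_iff (hA.union hA'), mem_essBoundary_iff (hA.inter hA'), compl_union, compl_inter] at hx
    obtain ⟨h1 | h1, h2 | h2⟩ := hc
    · exact hx.elim (fun h => h.1 (h1.union h2)) (fun h => h.1 (h1.mono inter_subset_left))
    · exact hx.elim (fun h => h.2 (h2.mono inter_subset_right)) (fun h => h.1 (h1.mono inter_subset_left))
    · exact hx.elim (fun h => h.2 (h1.mono inter_subset_left)) (fun h => h.1 (h2.mono inter_subset_right))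
    · exact hx.elim (fun h => h.2 (h2.mono inter_subset_right)) (fun h => h.2 (h1.union h2))
  · apply measure_mono
    rintro x ⟨⟨h1, hX⟩, ⟨h2, -⟩⟩
    rw [mem_essBoundary_iff (hA.union hA'), compl_union] at h1
    rw [mem_essBoundary_iff (hA.inter hA'), compl_inter] at h2
    refine ⟨⟨?_, hX⟩, ⟨?_, hX⟩⟩
    · rw [mem_essBoundary_iff hA]
      exact ⟨fun h => h2.1 (h.mono inter_subset_left), fun h => h1.2 (h.mono inter_subset_left)⟩
    · rw [mem_essBoundary_iff hA']
      exact ⟨fun h => h2.1 (h.mono inter_subset_right), fun h => h1.2 (h.mono inter_subset_right)⟩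

theorem essB_pol_hyp {u : Euc n} (hu : ‖u‖ = 1) {A : Set (Euc n)} (hA : MeasurableSet A) {x : Euc n} (hx : ⟪u, x⟫ = 0) :
    x ∈ essBoundary (pol u A) ↔ x ∈ essBoundary A := by
  have hP := measurableSet_pol u hA
  have hfix : rfx u x = x := by rw [rfx_apply hu, hx]; simp
  have h1 : ∀ ρ, volume (pol u A ∩ ball x ρ) = volume (A ∩ ball x ρ) := by
    intro ρ
    apply pol_volume hu hA measurableSet_ball
    intro y
    rw [mem_ball, mem_ball]
    nth_rw 1 [← hfix]
    rw [(rfx u).dist_map]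
  have h2 : ∀ ρ, volume ((pol u A)ᶜ ∩ ball x ρ) = volume (Aᶜ ∩ ball x ρ) := by
    intro ρ
    have hc : ∀ S : Set (Euc n), MeasurableSet S → volume (Sᶜ ∩ ball x ρ) = volume (ball x ρ) - volume (S ∩ ball x ρ) := by
      intro S hS
      rw [inter_comm, ← diff_eq, inter_comm, ← measure_diff inter_subset_left (measurableSet_ball.inter hS).nullMeasurableSet
        ((measure_mono inter_subset_left).trans_lt measure_ball_lt_top).ne, diff_self_inter]
    rw [hc _ hP, hc _ hA, h1]
  rw [mem_essBoundary_iff hP, mem_essBoundary_iff hA]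
  simp only [DZ, h1, h2]

theorem pol_perim {u : Euc n} (hu : ‖u‖ = 1) {A B : Set (Euc n)} (hA : MeasurableSet A) (hB : MeasurableSet B)
    (hRB : ∀ x, rfx u x ∈ B ↔ x ∈ B) : perim (pol u A) B ≤ perim A B := by
  have hP := measurableSet_pol u hA
  have hA' : MeasurableSet (rfx u ⁻¹' A) := (rfx u).continuous.measurable hA
  set A' := rfx u ⁻¹' A
  set Hp : Set (Euc n) := {x | 0 < ⟪u, x⟫}
  set H0 : Set (Euc n) := {x | ⟪u, x⟫ = 0}
  have oHp : IsOpen Hp := isOpen_lt continuous_const (by fun_prop)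
  have oHm := isOpen_Hm u
  have hsplit : ∀ S : Set (Euc n), μH[(n:ℝ)-1] (S ∩ B) = μH[(n:ℝ)-1] (S ∩ Hp ∩ B) + (μH[(n:ℝ)-1] (S ∩ Hm u ∩ B) + μH[(n:ℝ)-1] (S ∩ H0 ∩ B)) := by
    intro S
    rw [← measure_inter_add_diff (S ∩ B) oHp.measurableSet, ← measure_inter_add_diff ((S ∩ B) \ Hp) oHm.measurableSet]
    refine congrArg₂ _ ?_ (congrArg₂ _ ?_ ?_)
    · congr 1; ext x; simp only [mem_inter_iff]; tauto
    · congr 1; ext x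
      simp only [mem_inter_iff, mem_diff, Hp, Hm, mem_setOf_eq]
      constructor
      · rintro ⟨⟨⟨h1, h2⟩, h3⟩, h4⟩; exact ⟨⟨h1, h4⟩, h2⟩
      · rintro ⟨⟨h1, h4⟩, h2⟩; exact ⟨⟨⟨h1, h2⟩, by linarith⟩, h4⟩
    · congr 1; ext x
      simp only [mem_inter_iff, mem_diff, Hp, H0, Hm, mem_setOf_eq]
      constructor
      · rintro ⟨⟨⟨h1, h2⟩, h3⟩, h4⟩; exact ⟨⟨h1, by linarith⟩, h2⟩
      · rintro ⟨⟨h1, h4⟩, h2⟩; exact ⟨⟨⟨h1, h2⟩, by linarith⟩, by linarith⟩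
  have hpre : ∀ S : Set (Euc n), rfx u ⁻¹' (S ∩ Hm u ∩ B) = rfx u ⁻¹' S ∩ Hp ∩ B := by
    intro S; ext x
    simp only [mem_preimage, mem_inter_iff, Hm, Hp, mem_setOf_eq, inner_rfx hu, hRB, Left.neg_neg_iff]
  have hinvI : rfx u ⁻¹' (A ∩ A') = A ∩ A' := by
    ext x
    simp only [A', mem_preimage, mem_inter_iff, rfx_rfx]; tauto
  have e1 : essBoundary (pol u A) ∩ Hp = essBoundary (A ∪ A') ∩ Hp := by
    apply essB_congr_loc hP (hA.union hA') oHp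
    intro x (hx : 0 < ⟪u, x⟫)
    have : x ∉ Hm u := by intro (h : ⟪u, x⟫ < 0); linarith
    simp only [pol, polG, A', mem_union, mem_setOf_eq, mem_preimage]; tauto
  have e2 : essBoundary (pol u A) ∩ Hm u = essBoundary (A ∩ A') ∩ Hm u := by
    apply essB_congr_loc hP (hA.inter hA') oHm
    intro x hx
    simp only [pol, polG, A', mem_inter_iff, mem_setOf_eq, mem_preimage]; tauto
  have e3 : essBoundary (pol u A) ∩ H0 = essBoundary A ∩ H0 := by
    ext x
    constructor
    · rintro ⟨h1, h2⟩; exact ⟨(essB_pol_hyp hu hA h2).1 h1, h2⟩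
    · rintro ⟨h1, h2⟩; exact ⟨(essB_pol_hyp hu hA h2).2 h1, h2⟩
  have e4 : μH[(n:ℝ)-1] (essBoundary (A ∩ A') ∩ Hm u ∩ B) = μH[(n:ℝ)-1] (essBoundary (A ∩ A') ∩ Hp ∩ B) := by
    rw [← haus_refl u, hpre, ← essB_refl u (hA.inter hA'), hinvI]
  have e5 : μH[(n:ℝ)-1] (essBoundary A ∩ Hm u ∩ B) = μH[(n:ℝ)-1] (essBoundary A' ∩ Hp ∩ B) := by
    rw [← haus_refl u, hpre, ← essB_refl u hA]
  rw [perim, perim, hsplit, hsplit (essBoundary A), e1, e2, e3, e4, e5, ← add_assoc, ← add_assoc]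
  refine add_le_add ?_ le_rfl
  simp only [inter_assoc]
  exact essB_union_inter hA hA' (oHp.measurableSet.inter hB) _

theorem pol_perim_shell {u : Euc n} (hu : ‖u‖ = 1) {A : Set (Euc n)} (hA : MeasurableSet A) {B : Set ℝ} (hB : MeasurableSet B) :
    perim (pol u A) (sphShell n B) ≤ perim A (sphShell n B) := by
  apply pol_perim hu hA
  · exact (measurableSet_singleton (0 : Euc n)).compl.inter (measurable_norm hB)
  · intro x
    simp only [sphShell, mem_setOf_eq, (rfx u).norm_map, ne_eq, LinearIsometryEquiv.map_eq_zero_iff]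
end Pol

end SecA6

section SecA7
open MeasureTheory Metric Set Filter
open scoped ENNReal NNReal Topology RealInnerProductSpace Pointwise
set_option linter.all false
set_option linter.deprecated false

section Conv
variable {n : ℕ}

theorem rfx_cover (hn : 1 ≤ n) {D : Set (Euc n)} {x : Euc n} (hx : x ≠ 0) (hxD : x ∉ D) :
    sig n (slc D ‖x‖) ≤ ((4:ℝ≥0) : ℝ≥0∞) ^ ((n:ℝ) - 1) * sig n {u : Sph n | rfx (u : Euc n) x ∈ D} := by
  have hx0 : 0 < ‖x‖ := norm_pos_iff.2 hx
  set ω : Sph n := ⟨hatv x, by rw [mem_sphere_zero_iff_norm, norm_hatv hx]⟩ with hω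
  have hxω : ‖x‖ • (ω : Euc n) = x := by
    simp [hω, hatv, smul_smul, mul_inv_cancel₀ hx0.ne']
  set f : Sph n → Sph n := fun u => sphIso (rfx (u : Euc n)) ω with hf
  have hfc : ∀ u : Sph n, (f u : Euc n) = (ω : Euc n) - (2 * ⟪(u : Euc n), (ω : Euc n)⟫) • (u : Euc n) := by
    intro u; exact rfx_apply (norm_sph u) _
  have hfx : ∀ u : Sph n, rfx (u : Euc n) x = ‖x‖ • (f u : Euc n) := by
    intro u
    rw [hfc, ← rfx_apply (norm_sph u), ← map_smul, hxω]
  have hsub : slc D ‖x‖ ⊆ f '' {u : Sph n | rfx (u : Euc n) x ∈ D} := by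
    intro ω' (hω' : ‖x‖ • (ω' : Euc n) ∈ D)
    have hne : (ω : Euc n) - ω' ≠ 0 := by
      intro h
      rw [sub_eq_zero] at h
      rw [← h, hxω] at hω'
      exact hxD hω'
    have hpos : 0 < ‖(ω : Euc n) - ω'‖ := norm_pos_iff.2 hne
    have hu1 : ‖‖(ω : Euc n) - ω'‖⁻¹ • ((ω : Euc n) - ω')‖ = 1 := by
      rw [norm_smul, norm_inv, norm_norm, inv_mul_cancel₀ hpos.ne']
    have hfu : f ⟨‖(ω : Euc n) - ω'‖⁻¹ • ((ω : Euc n) - ω'), by rw [mem_sphere_zero_iff_norm, hu1]⟩ = ω' := by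
      apply Subtype.ext
      rw [hfc]
      simp only [inner_smul_left, smul_smul]
      have h1 : ⟪(ω : Euc n) - ω', (ω : Euc n)⟫ = ‖(ω : Euc n) - ω'‖^2 / 2 := by
        have := norm_sub_sq_real (ω : Euc n) ω'
        rw [norm_sph, norm_sph] at this
        rw [inner_sub_left, real_inner_self_eq_norm_sq, norm_sph, real_inner_comm, this]; ring
      rw [h1]
      have : 2 * ((starRingEnd ℝ) ‖(ω : Euc n) - ω'‖⁻¹ * (‖(ω : Euc n) - ω'‖^2 / 2)) * ‖(ω : Euc n) - ω'‖⁻¹ = 1 := by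
        simp only [conj_trivial]; field_simp
      rw [this, one_smul, sub_sub_cancel]
    refine ⟨_, ?_, hfu⟩
    rw [mem_setOf_eq, hfx, hfu]
    exact hω'
  refine (measure_mono hsub).trans (haus_image_le (dim_nonneg hn) ?_)
  intro u _ u' _
  rw [Subtype.dist_eq, Subtype.dist_eq, dist_eq_norm, dist_eq_norm, hfc, hfc]
  have e : (ω : Euc n) - (2 * ⟪(u : Euc n), (ω : Euc n)⟫) • (u : Euc n) - ((ω : Euc n) - (2 * ⟪(u' : Euc n), (ω : Euc n)⟫) • (u' : Euc n))
      = - ((2 * ⟪(u : Euc n) - u', (ω : Euc n)⟫) • (u : Euc n) + (2 * ⟪(u' : Euc n), (ω : Euc n)⟫) • ((u : Euc n) - u')) := by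
    rw [inner_sub_left, smul_sub, mul_sub, sub_smul]; abel
  rw [e, norm_neg]
  refine (norm_add_le _ _).trans ?_
  rw [norm_smul, norm_smul, norm_mul, norm_mul, norm_sph, Real.norm_ofNat, Real.norm_eq_abs, Real.norm_eq_abs]
  have h1 := abs_real_inner_le_norm ((u : Euc n) - u') (ω : Euc n)
  have h2 := abs_real_inner_le_norm (u' : Euc n) (ω : Euc n)
  rw [norm_sph, mul_one] at h1
  rw [norm_sph, norm_sph, mul_one] at h2
  have h3 := mul_le_mul_of_nonneg_right h2 (norm_nonneg ((u : Euc n) - u'))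
  push_cast
  linarith

theorem slc_diff_eq (hn : 1 ≤ n) {A F : Set (Euc n)} (hA : MeasurableSet A) (hF : MeasurableSet F) {r : ℝ}
    (h : sig n (slc A r) = sig n (slc F r)) : sig n (slc (F \ A) r) = sig n (slc (A \ F) r) := by
  have := sig_finite hn
  exact measure_diff_eq_of_eq' hA hF h
where
  measure_diff_eq_of_eq' (hA : MeasurableSet A) (hF : MeasurableSet F)
    (h : sig n (slc A r) = sig n (slc F r)) : sig n (slc (F \ A) r) = sig n (slc (A \ F) r) := by
    have := sig_finite hn
    have e1 : slc (F \ A) r = slc F r \ slc A r := rfl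
    have e2 : slc (A \ F) r = slc A r \ slc F r := rfl
    rw [e1, e2]
    have a1 := measure_inter_add_diff (μ := sig n) (slc F r) (measurableSet_slc hA r)
    have a2 := measure_inter_add_diff (μ := sig n) (slc A r) (measurableSet_slc hF r)
    rw [h, inter_comm] at a2
    exact (ENNReal.add_right_inj (measure_ne_top _ _)).1 (a1.trans a2.symm)

theorem gain_bound (hn : 1 ≤ n) {A F : Set (Euc n)} (hA : MeasurableSet A) (hF : MeasurableSet F)
    (hs : ∀ᵐ (r : ℝ) ∂(volume.restrict (Ioi (0:ℝ))), sig n (slc A r) = sig n (slc F r))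
    {R ε : ℝ} (hR : 0 < R) (hε : 0 < ε) :
    ENNReal.ofReal ε * volume ((F \ A) ∩ ball 0 R) ≤
        ENNReal.ofReal ε * (polC n * ENNReal.ofReal (ε * R ^ n)) +
          ((4:ℝ≥0) : ℝ≥0∞) ^ ((n:ℝ) - 1) * ∫⁻ x in F \ A, sig n {u : Sph n | rfx (u : Euc n) x ∈ A \ F} := by
  have := sig_finite hn
  have hD : MeasurableSet (F \ A) := hF.diff hA
  have hD' : MeasurableSet (A \ F) := hA.diff hF
  set Q : Set ℝ := {r | ENNReal.ofReal ε ≤ sig n (slc (A \ F) r)} with hQ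
  have mQ : MeasurableSet Q := measurableSet_le measurable_const (measurable_sig_slc hn hD')
  set G1 : Set (Euc n) := (F \ A) ∩ ball 0 R ∩ {x | ‖x‖ ∉ Q} with hG1
  set G2 : Set (Euc n) := (F \ A) ∩ {x | ‖x‖ ∈ Q} with hG2
  have mN : MeasurableSet {x : Euc n | ‖x‖ ∈ Q} := measurable_norm mQ
  have mG1 : MeasurableSet G1 := (hD.inter measurableSet_ball).inter mN.compl
  have mG2 : MeasurableSet G2 := hD.inter mN
  have hsub : (F \ A) ∩ ball 0 R ⊆ G1 ∪ G2 := by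
    intro x hx
    by_cases h : ‖x‖ ∈ Q
    · exact Or.inr ⟨hx.1, h⟩
    · exact Or.inl ⟨hx, h⟩
  have b1 : volume G1 ≤ polC n * ENNReal.ofReal (ε * R ^ n) := by
    rw [polar hn mG1]
    gcongr
    calc ∫⁻ r in Ioi (0:ℝ), ENNReal.ofReal (r ^ (n-1)) * sig n (slc G1 r)
        ≤ ∫⁻ r in Ioi (0:ℝ), (Iio R).indicator (fun _ => ENNReal.ofReal (R ^ (n-1) * ε)) r := by
          apply lintegral_mono_ae
          filter_upwards [hs, ae_restrict_mem measurableSet_Ioi] with r hr hr0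
          have hr0 : 0 < r := hr0
          have hnr : ∀ ω : Sph n, ‖r • (ω : Euc n)‖ = r := by
            intro ω; rw [norm_smul, norm_sph, mul_one, Real.norm_of_nonneg hr0.le]
          by_cases h : r < R ∧ r ∉ Q
          · rw [indicator_of_mem (show r ∈ Iio R from h.1), ENNReal.ofReal_mul (by positivity)]
            gcongr
            · exact h.1.le
            · have h2 : ¬ ENNReal.ofReal ε ≤ sig n (slc (A \ F) r) := h.2
              rw [← slc_diff_eq hn hA hF hr] at h2
              refine le_trans (measure_mono ?_) (not_le.1 h2).le
              intro ω hω
              exact hω.1.1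
          · have : slc G1 r = ∅ := by
              ext ω
              simp only [slc, mem_setOf_eq, mem_empty_iff_false, iff_false]
              intro hω
              apply h
              have a := hω.1.2
              have b := hω.2
              rw [mem_ball_zero_iff, hnr] at a
              rw [mem_setOf_eq, hnr] at b
              exact ⟨a, b⟩
            rw [this, measure_empty, mul_zero]; exact zero_le
      _ = ENNReal.ofReal (ε * R ^ n) := by
          rw [lintegral_indicator measurableSet_Iio, lintegral_const, Measure.restrict_apply_univ, Measure.restrict_apply measurableSet_Iio]
          rw [show Iio R ∩ Ioi 0 = Ioo 0 R by ext; simp [and_comm], Real.volume_Ioo, ← ENNReal.ofReal_mul (by positivity)]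
          congr 1
          have : R ^ n = R ^ (n-1) * R := by rw [← pow_succ]; congr 1; omega
          rw [this]; ring
  have b2 : ENNReal.ofReal ε * volume G2 ≤ ((4:ℝ≥0) : ℝ≥0∞) ^ ((n:ℝ) - 1) * ∫⁻ x in F \ A, sig n {u : Sph n | rfx (u : Euc n) x ∈ A \ F} := by
    calc ENNReal.ofReal ε * volume G2 = ∫⁻ x in G2, ENNReal.ofReal ε := by rw [setLIntegral_const]
      _ ≤ ∫⁻ x in G2, ((4:ℝ≥0) : ℝ≥0∞) ^ ((n:ℝ) - 1) * sig n {u : Sph n | rfx (u : Euc n) x ∈ A \ F} := by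
          apply setLIntegral_mono' mG2
          intro x hx
          have hxQ : ENNReal.ofReal ε ≤ sig n (slc (A \ F) ‖x‖) := hx.2
          have hxD : x ∉ A \ F := fun h => h.2 hx.1.1
          have hx0 : x ≠ 0 := by
            rintro rfl
            have : slc (A \ F) ‖(0 : Euc n)‖ = ∅ := by
              ext ω
              simp only [slc, norm_zero, zero_smul, mem_setOf_eq, mem_empty_iff_false, iff_false]
              exact hxD
            rw [this, measure_empty] at hxQ
            exact absurd hxQ (not_le.2 (ENNReal.ofReal_pos.2 hε))
          exact hxQ.trans (rfx_cover hn hx0 hxD)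
      _ ≤ ∫⁻ x in F \ A, ((4:ℝ≥0) : ℝ≥0∞) ^ ((n:ℝ) - 1) * sig n {u : Sph n | rfx (u : Euc n) x ∈ A \ F} :=
          lintegral_mono_set inter_subset_left
      _ = _ := lintegral_const_mul' _ _ (ENNReal.rpow_ne_top_of_nonneg (dim_nonneg hn) ENNReal.coe_ne_top)
  calc ENNReal.ofReal ε * volume ((F \ A) ∩ ball 0 R) ≤ ENNReal.ofReal ε * (volume G1 + volume G2) := by
        gcongr; exact (measure_mono hsub).trans (measure_union_le _ _)
    _ = ENNReal.ofReal ε * volume G1 + ENNReal.ofReal ε * volume G2 := mul_add _ _ _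
    _ ≤ _ := by gcongr

theorem gain_step (hn : 1 ≤ n) {e : Euc n} {A F : Set (Euc n)} (hA : MeasurableSet A) (hF : MeasurableSet F)
    (hFp : ∀ u : Euc n, ‖u‖ = 1 → 0 ≤ ⟪u, e⟫ → ∀ x ∈ Hm u, x ∈ F → rfx u x ∈ F)
    (hFv : volume F ≠ ⊤)
    (hs : ∀ᵐ (r : ℝ) ∂(volume.restrict (Ioi (0:ℝ))), sig n (slc A r) = sig n (slc F r)) :
    ∃ u : Euc n, ‖u‖ = 1 ∧ ∃ I : ℝ≥0∞, volume (F \ pol u A) + I ≤ volume (F \ A) ∧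
      ∀ R ε : ℝ, 0 < R → 0 < ε → ENNReal.ofReal ε * volume ((F \ A) ∩ ball 0 R) ≤
        ENNReal.ofReal ε * (polC n * ENNReal.ofReal (ε * R ^ n)) +
          (((4:ℝ≥0) : ℝ≥0∞) ^ ((n:ℝ) - 1) * sig n univ) * I := by
  have := sig_finite hn
  set J : Euc n → ℝ≥0∞ := fun u => volume {x | x ∈ F \ A ∧ rfx u x ∈ A \ F}
  have hD : MeasurableSet (F \ A) := hF.diff hA
  have hD' : MeasurableSet (A \ F) := hA.diff hF
  have mS : MeasurableSet {p : Sph n × Euc n | p.2 ∈ F \ A ∧ rfx (p.1 : Euc n) p.2 ∈ A \ F} := by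
    have e1 : {p : Sph n × Euc n | p.2 ∈ F \ A ∧ rfx (p.1 : Euc n) p.2 ∈ A \ F} =
        {p : Sph n × Euc n | p.2 ∈ F \ A ∧ p.2 - (2 * ⟪(p.1 : Euc n), p.2⟫) • (p.1 : Euc n) ∈ A \ F} := by
      ext p; rw [mem_setOf_eq, mem_setOf_eq, rfx_apply (norm_sph p.1)]
    rw [e1]
    exact (measurable_snd hD).inter ((show Measurable fun p : Sph n × Euc n => p.2 - (2 * ⟪(p.1 : Euc n), p.2⟫) • (p.1 : Euc n) by fun_prop) hD')
  have hJ : ∫⁻ u : Sph n, J u ∂(sig n) = ∫⁻ x in F \ A, sig n {u : Sph n | rfx (u : Euc n) x ∈ A \ F} := by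
    have h1 := Measure.prod_apply (μ := sig n) (ν := (volume : Measure (Euc n))) mS
    have h2 := Measure.prod_apply_symm (μ := sig n) (ν := (volume : Measure (Euc n))) mS
    rw [← lintegral_indicator hD]
    refine (h1.symm.trans h2).trans ?_
    apply lintegral_congr
    intro x
    by_cases hx : x ∈ F \ A
    · rw [indicator_of_mem hx]; congr 1; ext u; exact and_iff_right hx
    · rw [indicator_of_notMem hx]; convert measure_empty (μ := sig n); ext u; simp only [mem_preimage, mem_setOf_eq, mem_empty_iff_false, iff_false]; tauto
  have hJtop : ∫⁻ u : Sph n, J u ∂(sig n) ≠ ⊤ := by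
    apply ne_top_of_le_ne_top (ENNReal.mul_ne_top hFv (measure_ne_top (sig n) univ))
    calc ∫⁻ u : Sph n, J u ∂(sig n) ≤ ∫⁻ u : Sph n, volume F ∂(sig n) :=
          lintegral_mono fun u => measure_mono fun x hx => hx.1.1
      _ = _ := by rw [lintegral_const]
  obtain ⟨u, hu⟩ : ∃ u : Sph n, ∫⁻ u : Sph n, J u ∂(sig n) ≤ J u * sig n univ := by
    obtain ⟨u, hu⟩ := exists_laverage_le (sig_ne_zero hn) (f := fun u : Sph n => J u) hJtop
    refine ⟨u, ?_⟩
    rw [laverage_eq] at hu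
    have h0 : sig n univ ≠ 0 := fun h => sig_ne_zero hn (Measure.measure_univ_eq_zero.1 h)
    exact (ENNReal.div_le_iff h0 (measure_ne_top _ _)).1 hu
  obtain ⟨w, hw1, hw2, hw3⟩ : ∃ w : Euc n, ‖w‖ = 1 ∧ 0 ≤ ⟪w, e⟫ ∧ J w = J u := by
    by_cases h : 0 ≤ ⟪(u : Euc n), e⟫
    · exact ⟨u, norm_sph u, h, rfl⟩
    · have h1 : ‖-(u : Euc n)‖ = 1 := by rw [norm_neg, norm_sph]
      refine ⟨-u, h1, by rw [inner_neg_left]; linarith, ?_⟩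
      have : ∀ x, rfx (-(u : Euc n)) x = rfx (u : Euc n) x := by
        intro x
        rw [rfx_apply h1, rfx_apply (norm_sph u), inner_neg_left]
        simp
      simp only [J, this]
  refine ⟨w, hw1, J w, ?_, ?_⟩
  · exact polG_gain (rfx w).measurePreserving (rfx_rfx w) (measurableSet_Hm w) hA hF (Hm_refl hw1) (hFp w hw1 hw2)
  · intro R ε hR hε
    refine (gain_bound hn hA hF hs hR hε).trans ?_
    rw [← hJ, mul_assoc, hw3, mul_comm (sig n univ)]
    gcongr

theorem exists_seq (hn : 1 ≤ n) {e : Euc n} {E F : Set (Euc n)} (hE : MeasurableSet E) (hF : MeasurableSet F)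
    (hFp : ∀ u : Euc n, ‖u‖ = 1 → 0 ≤ ⟪u, e⟫ → ∀ x ∈ Hm u, x ∈ F → rfx u x ∈ F)
    (hFv : volume F ≠ ⊤)
    (hs : ∀ᵐ (r : ℝ) ∂(volume.restrict (Ioi (0:ℝ))), sig n (slc E r) = sig n (slc F r)) :
    ∃ A : ℕ → Set (Euc n), (∀ k, MeasurableSet (A k)) ∧
      (∀ k, ∀ B : Set ℝ, MeasurableSet B → perim (A k) (sphShell n B) ≤ perim E (sphShell n B)) ∧
      ∀ R : ℝ, Tendsto (fun k => volume ({x | ¬ (x ∈ A k ↔ x ∈ F)} ∩ ball 0 R)) atTop (𝓝 0) := by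
  have := sig_finite hn
  let P : Set (Euc n) → Prop := fun A => MeasurableSet A ∧
    (∀ᵐ (r : ℝ) ∂(volume.restrict (Ioi (0:ℝ))), sig n (slc A r) = sig n (slc F r)) ∧
    (∀ B : Set ℝ, MeasurableSet B → perim A (sphShell n B) ≤ perim E (sphShell n B))
  set C : ℝ≥0∞ := ((4:ℝ≥0) : ℝ≥0∞) ^ ((n:ℝ) - 1) * sig n univ with hC
  have hCt : C ≠ ⊤ := ENNReal.mul_ne_top (ENNReal.rpow_ne_top_of_nonneg (dim_nonneg hn) ENNReal.coe_ne_top) (measure_ne_top _ _)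
  have step : ∀ A : {A // P A}, ∃ A' : {A // P A}, ∃ I : ℝ≥0∞, volume (F \ A'.1) + I ≤ volume (F \ A.1) ∧
      ∀ R ε : ℝ, 0 < R → 0 < ε → ENNReal.ofReal ε * volume ((F \ A.1) ∩ ball 0 R) ≤
        ENNReal.ofReal ε * (polC n * ENNReal.ofReal (ε * R ^ n)) + C * I := by
    rintro ⟨A, hA1, hA2, hA3⟩
    obtain ⟨u, hu, I, h1, h2⟩ := gain_step hn hA1 hF hFp hFv hA2
    refine ⟨⟨pol u A, measurableSet_pol u hA1, ?_, ?_⟩, I, h1, h2⟩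
    · filter_upwards [hA2, ae_restrict_mem measurableSet_Ioi] with r hr hr0
      rw [pol_slc hu hA1 hr0, hr]
    · intro B hB
      exact (pol_perim_shell hu hA1 hB).trans (hA3 B hB)
  choose nx I hI1 hI2 using step
  let S : ℕ → {A // P A} := fun k => Nat.rec ⟨E, hE, hs, fun _ _ => le_rfl⟩ (fun _ A => nx A) k
  have hS : ∀ k, S (k+1) = nx (S k) := fun k => rfl
  have hsum : ∀ N, volume (F \ (S N).1) + ∑ k ∈ Finset.range N, I (S k) ≤ volume F := by
    intro N
    induction N with
    | zero => simp only [Finset.range_zero, Finset.sum_empty, add_zero]; exact measure_mono diff_subset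
    | succ N ih =>
      rw [Finset.sum_range_succ, add_comm (∑ k ∈ _, _), ← add_assoc]
      refine le_trans ?_ ih
      gcongr
      exact hI1 (S N)
  have hts : ∑' k, I (S k) ≠ ⊤ := by
    apply ne_top_of_le_ne_top hFv
    rw [ENNReal.tsum_eq_iSup_nat]
    exact iSup_le fun N => le_trans le_add_self (hsum N)
  have hI0 : Tendsto (fun k => I (S k)) atTop (𝓝 0) := ENNReal.tendsto_atTop_zero_of_tsum_ne_top hts
  have key : ∀ R : ℝ, 0 < R → Tendsto (fun k => volume ((F \ (S k).1) ∩ ball 0 R)) atTop (𝓝 0) := by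
    intro R hR
    rw [ENNReal.tendsto_nhds_zero]
    intro η hη
    obtain ⟨ε, hε, hε'⟩ : ∃ ε : ℝ, 0 < ε ∧ polC n * ENNReal.ofReal (ε * R ^ n) ≤ η / 2 := by
      have : Tendsto (fun ε : ℝ => polC n * ENNReal.ofReal (ε * R ^ n)) (𝓝[>] 0) (𝓝 0) := by
        have h1 : Tendsto (fun ε : ℝ => ENNReal.ofReal (ε * R ^ n)) (𝓝[>] 0) (𝓝 (ENNReal.ofReal (0 * R ^ n))) :=
          (ENNReal.continuous_ofReal.tendsto _).comp (((continuous_id.mul continuous_const).tendsto 0).mono_left nhdsWithin_le_nhds)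
        rw [zero_mul, ENNReal.ofReal_zero] at h1
        have h2 := ENNReal.Tendsto.const_mul (a := polC n) h1 (Or.inr (polC_ne_top hn))
        rwa [mul_zero] at h2
      have h3 := (ENNReal.tendsto_nhds_zero.1 this (η/2) (ENNReal.half_pos hη.ne')).and self_mem_nhdsWithin
      obtain ⟨ε, h4, h5⟩ := h3.exists
      exact ⟨ε, h5, h4⟩
    have h6 : Tendsto (fun k => C * I (S k)) atTop (𝓝 0) := by
      have := ENNReal.Tendsto.const_mul (a := C) hI0 (Or.inr hCt)
      rwa [mul_zero] at this
    have hε0 : ENNReal.ofReal ε ≠ 0 := (ENNReal.ofReal_pos.2 hε).ne'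
    have h7 := ENNReal.tendsto_nhds_zero.1 h6 (ENNReal.ofReal ε * (η/2))
      (pos_iff_ne_zero.2 (mul_ne_zero hε0 (ENNReal.half_pos hη.ne').ne'))
    filter_upwards [h7] with k hk
    have h8 := hI2 (S k) R ε hR hε
    have h9 : ENNReal.ofReal ε * volume ((F \ (S k).1) ∩ ball 0 R) ≤ ENNReal.ofReal ε * η := by
      calc _ ≤ _ := h8
        _ ≤ ENNReal.ofReal ε * (η/2) + ENNReal.ofReal ε * (η/2) := by gcongr
        _ = _ := by rw [← mul_add, ENNReal.add_halves]
    exact (ENNReal.mul_le_mul_iff_right hε0 ENNReal.ofReal_ne_top).1 h9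
  refine ⟨fun k => (S k).1, fun k => (S k).2.1, fun k => (S k).2.2.2, ?_⟩
  have key2 : ∀ R : ℝ, 0 < R → Tendsto (fun k => volume ({x | ¬ (x ∈ (S k).1 ↔ x ∈ F)} ∩ ball 0 R)) atTop (𝓝 0) := by
    intro R hR
    have h2 := (key R hR).add (key R hR)
    rw [add_zero] at h2
    refine tendsto_of_tendsto_of_tendsto_of_le_of_le tendsto_const_nhds h2 (fun _ => zero_le) ?_
    intro k
    have hAm := (S k).2.1
    have e : volume (((S k).1 \ F) ∩ ball 0 R) = volume ((F \ (S k).1) ∩ ball 0 R) := by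
      rw [polar hn ((hAm.diff hF).inter measurableSet_ball), polar hn ((hF.diff hAm).inter measurableSet_ball)]
      congr 1
      apply lintegral_congr_ae
      filter_upwards [(S k).2.2.1, ae_restrict_mem measurableSet_Ioi] with r hr hr0
      have hr0 : 0 < r := hr0
      have hnr : ∀ ω : Sph n, ‖r • (ω : Euc n)‖ = r := by
        intro ω; rw [norm_smul, norm_sph, mul_one, Real.norm_of_nonneg hr0.le]
      by_cases h : r < R
      · have q : ∀ D : Set (Euc n), slc (D ∩ ball 0 R) r = slc D r := by
          intro D; ext ω
          simp only [slc, mem_setOf_eq, mem_inter_iff, mem_ball_zero_iff, hnr, h, and_true]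
        simp only [q]
        rw [slc_diff_eq hn hAm hF hr]
      · have q : ∀ D : Set (Euc n), slc (D ∩ ball 0 R) r = ∅ := by
          intro D; ext ω
          simp only [slc, mem_setOf_eq, mem_inter_iff, mem_ball_zero_iff, hnr, h, and_false, mem_empty_iff_false]
        simp only [q]
    calc volume ({x | ¬ (x ∈ (S k).1 ↔ x ∈ F)} ∩ ball 0 R)
        ≤ volume (((S k).1 \ F) ∩ ball 0 R ∪ (F \ (S k).1) ∩ ball 0 R) := by
          apply measure_mono
          intro x hx
          have h1 := hx.1
          simp only [mem_setOf_eq] at h1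
          by_cases h3 : x ∈ F
          · exact Or.inr ⟨⟨h3, by tauto⟩, hx.2⟩
          · exact Or.inl ⟨⟨by tauto, h3⟩, hx.2⟩
      _ ≤ _ := measure_union_le _ _
      _ = _ := by rw [e]
  intro R
  refine tendsto_of_tendsto_of_tendsto_of_le_of_le tendsto_const_nhds (key2 (max R 1) (by positivity)) (fun _ => zero_le) ?_
  intro k
  exact measure_mono (inter_subset_inter_right _ (ball_subset_ball (le_max_left _ _)))
end Conv

end SecA7

section SecA8
open MeasureTheory Metric Set Filter
open scoped ENNReal NNReal Topology RealInnerProductSpace Pointwise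
set_option linter.all false
set_option linter.deprecated false

section Lsc
variable {n : ℕ}

theorem hyp_fubini {u : Euc n} (hu : ‖u‖ = 1) : ∃ c : ℝ≥0∞, c ≠ 0 ∧ c ≠ ⊤ ∧ ∀ S : Set (Euc n), MeasurableSet S →
    ∫⁻ y : Hyp u, volume {t : ℝ | (y : Euc n) + t • u ∈ S} ∂(μH[(n:ℝ) - 1]) = c * volume S := by
  have := haar_hyp hu
  let L0 : (Hyp u × ℝ) →ₗ[ℝ] Euc n := (Hyp u).subtype.coprod (LinearMap.toSpanSingleton ℝ (Euc n) u)
  have hL0 : ∀ p, L0 p = (p.1 : Euc n) + p.2 • u := by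
    intro p; simp [L0]
  have hinj : Function.Injective L0 := by
    rw [injective_iff_map_eq_zero]
    rintro ⟨y, t⟩ h
    rw [hL0] at h
    have h1 : ⟪u, (y : Euc n) + t • u⟫ = t := by
      rw [inner_add_right, inner_hyp, inner_smul_right, real_inner_self_eq_norm_sq, hu]; ring
    rw [h, inner_zero_right] at h1
    subst h1
    simp only [zero_smul, add_zero] at h
    ext1
    · exact Subtype.ext h
    · rfl
  have hdim : Module.finrank ℝ (Hyp u × ℝ) = Module.finrank ℝ (Euc n) := by
    rw [Module.finrank_prod, Module.finrank_self, finrank_hyp hu, finrank_euclideanSpace_fin]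
  let L : (Hyp u × ℝ) ≃L[ℝ] Euc n := (LinearMap.linearEquivOfInjective L0 hinj hdim).toContinuousLinearEquiv
  have hL : ∀ p, L p = (p.1 : Euc n) + p.2 • u := fun p => hL0 p
  have hm : (Measure.map L ((μH[(n:ℝ) - 1] : Measure (Hyp u)).prod volume)).IsAddHaarMeasure :=
    L.isAddHaarMeasure_map _
  have he := Measure.isAddLeftInvariant_eq_smul (Measure.map L ((μH[(n:ℝ) - 1] : Measure (Hyp u)).prod volume)) (volume : Measure (Euc n))
  have hpos := Measure.addHaarScalarFactor_pos_of_isAddHaarMeasure (Measure.map L ((μH[(n:ℝ) - 1] : Measure (Hyp u)).prod volume)) (volume : Measure (Euc n))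
  generalize (Measure.map L ((μH[(n:ℝ) - 1] : Measure (Hyp u)).prod volume)).addHaarScalarFactor volume = c at he hpos
  refine ⟨c, by exact_mod_cast hpos.ne', ENNReal.coe_ne_top, fun S hS => ?_⟩
  · have h2 : Measure.map L ((μH[(n:ℝ) - 1] : Measure (Hyp u)).prod volume) S = ((c : ℝ≥0) • (volume : Measure (Euc n))) S := by rw [he]
    rw [Measure.map_apply L.continuous.measurable hS, Measure.prod_apply (L.continuous.measurable hS)] at h2
    simp only [Measure.smul_apply] at h2
    rw [ENNReal.smul_def, smul_eq_mul] at h2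
    rw [← h2]
    apply lintegral_congr
    intro y
    congr 1

noncomputable def pr {u : Euc n} (hu : ‖u‖ = 1) (x : Euc n) : Hyp u :=
  ⟨x - ⟪u, x⟫ • u, by
    rw [Submodule.mem_orthogonal_singleton_iff_inner_right, inner_sub_right, inner_smul_right, real_inner_self_eq_norm_sq, hu]; ring⟩

theorem pr_coe {u : Euc n} (hu : ‖u‖ = 1) (x : Euc n) : (pr hu x : Euc n) = x - ⟪u, x⟫ • u := rfl

theorem pr_dist {u : Euc n} (hu : ‖u‖ = 1) (x y : Euc n) : dist (pr hu x) (pr hu y) ^ 2 = ‖x - y‖^2 - ⟪u, x - y⟫^2 := by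
  rw [Subtype.dist_eq, dist_eq_norm, pr_coe, pr_coe]
  have e : x - ⟪u, x⟫ • u - (y - ⟪u, y⟫ • u) = (x - y) - ⟪u, x - y⟫ • u := by
    rw [inner_sub_right]; module
  rw [e, norm_sub_sq_real, inner_smul_right, real_inner_comm, norm_smul, hu, mul_one, Real.norm_eq_abs, sq_abs]; ring

theorem pr_lip {u : Euc n} (hu : ‖u‖ = 1) : LipschitzWith 1 (pr hu) := by
  apply LipschitzWith.of_dist_le_mul
  intro x y
  rw [NNReal.coe_one, one_mul, dist_eq_norm x y]
  apply abs_le_of_sq_le_sq' _ (norm_nonneg _) |>.2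
  rw [pr_dist]; nlinarith [sq_nonneg ⟪u, x - y⟫]

theorem pr_line {u : Euc n} (hu : ‖u‖ = 1) (y : Hyp u) (t : ℝ) : pr hu ((y : Euc n) + t • u) = y := by
  apply Subtype.ext
  rw [pr_coe, inner_add_right, inner_hyp, inner_smul_right, real_inner_self_eq_norm_sq, hu]; simp

theorem pr_rep {u : Euc n} (hu : ‖u‖ = 1) (x : Euc n) : (pr hu x : Euc n) + ⟪u, x⟫ • u = x := by
  rw [pr_coe]; abel

/-- two-sided cone condition at fixed scale -/
def ConeS (F N : Set (Euc n)) (u : Euc n) (ε δ : ℝ) : Set (Euc n) :=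
  {x | ∀ y, y ∉ N → ‖y - x‖ < δ → (ε * ‖y - x‖ < ⟪y - x, u⟫ → y ∉ F) ∧ (⟪y - x, u⟫ < - (ε * ‖y - x‖) → y ∈ F)}

/-- points having an approximate tangent half space -/
def Tan (F N : Set (Euc n)) : Set (Euc n) :=
  {x | ∃ ν : Euc n, ‖ν‖ = 1 ∧ ∀ ε : ℝ, 0 < ε → ∃ δ : ℝ, 0 < δ ∧ x ∈ ConeS F N ν ε δ}

theorem isClosed_ConeS (F N : Set (Euc n)) (u : Euc n) (ε δ : ℝ) : IsClosed (ConeS F N u ε δ) := by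
  have : ConeS F N u ε δ = ⋂ y : Euc n, ⋂ (_ : y ∉ N),
      (({x | δ ≤ ‖y - x‖} ∪ ({x | ⟪y - x, u⟫ ≤ ε * ‖y - x‖} ∪ {x | y ∉ F})) ∩
        ({x | δ ≤ ‖y - x‖} ∪ ({x | - (ε * ‖y - x‖) ≤ ⟪y - x, u⟫} ∪ {x | y ∈ F}))) := by
    ext x
    simp only [ConeS, mem_setOf_eq, mem_iInter, mem_inter_iff, mem_union]
    refine forall_congr' fun y => forall_congr' fun hy => ?_
    rw [← not_lt, ← not_lt, ← not_lt]
    tauto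
  rw [this]
  refine isClosed_iInter fun y => isClosed_iInter fun _ => ?_
  refine IsClosed.inter (IsClosed.union (isClosed_le (by fun_prop) (by fun_prop)) (IsClosed.union (isClosed_le (by fun_prop) (by fun_prop)) isClosed_const))
    (IsClosed.union (isClosed_le (by fun_prop) (by fun_prop)) (IsClosed.union (isClosed_le (by fun_prop) (by fun_prop)) isClosed_const))

theorem ConeS_flat_aux {F N : Set (Euc n)} (hN : volume N = 0) {u : Euc n} (hu : ‖u‖ = 1) {ε δ : ℝ} (hε1 : ε < 1)
    {x x' : Euc n} (hx : x ∈ ConeS F N u ε δ) (hx' : x' ∈ ConeS F N u ε δ) (hd : ‖x' - x‖ < δ) :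
    ⟪x' - x, u⟫ ≤ ε * ‖x' - x‖ := by
  by_contra hcon
  push Not at hcon
  have hδ : 0 < δ := (norm_nonneg _).trans_lt hd
  set V : Set (Euc n) := {y | ‖y - x‖ < δ ∧ ε * ‖y - x‖ < ⟪y - x, u⟫ ∧ ‖y - x'‖ < δ ∧ ⟪y - x', u⟫ < - (ε * ‖y - x'‖)} with hV
  have oV : IsOpen V := by
    simp only [hV, setOf_and]
    refine IsOpen.inter ?_ (IsOpen.inter ?_ (IsOpen.inter ?_ ?_)) <;> exact isOpen_lt (by fun_prop) (by fun_prop)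
  have hne : V.Nonempty := by
    have h1 : Tendsto (fun t : ℝ => x' - t • u) (𝓝[>] 0) (𝓝 x') := by
      have : Tendsto (fun t : ℝ => x' - t • u) (𝓝 0) (𝓝 (x' - (0:ℝ) • u)) := by
        apply Continuous.tendsto; fun_prop
      rw [zero_smul, sub_zero] at this
      exact this.mono_left nhdsWithin_le_nhds
    have h2 : {y | ‖y - x‖ < δ ∧ ε * ‖y - x‖ < ⟪y - x, u⟫ ∧ ‖y - x'‖ < δ} ∈ 𝓝 x' := by
      apply IsOpen.mem_nhds
      · simp only [setOf_and]
        refine IsOpen.inter ?_ (IsOpen.inter ?_ ?_) <;> exact isOpen_lt (by fun_prop) (by fun_prop)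
      · exact ⟨hd, hcon, by simpa using hδ⟩
    obtain ⟨t, ht, ht0⟩ := ((h1.eventually h2).and self_mem_nhdsWithin).exists
    have ht0 : 0 < t := ht0
    refine ⟨x' - t • u, ht.1, ht.2.1, ht.2.2, ?_⟩
    have e : x' - t • u - x' = -(t • u) := by abel
    rw [e, norm_neg, inner_neg_left, inner_smul_left, real_inner_self_eq_norm_sq, norm_smul, hu, Real.norm_of_nonneg ht0.le]
    simp only [conj_trivial]
    nlinarith
  have hpos := oV.measure_pos volume hne
  have : ¬ V ⊆ N := fun h => absurd (measure_mono_null h hN) hpos.ne'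
  obtain ⟨y, hyV, hyN⟩ := not_subset.1 this
  exact (hx y hyN hyV.1).1 hyV.2.1 ((hx' y hyN hyV.2.2.1).2 hyV.2.2.2)

theorem ConeS_flat {F N : Set (Euc n)} (hN : volume N = 0) {u : Euc n} (hu : ‖u‖ = 1) {ε δ : ℝ} (hε : 0 ≤ ε) (hε1 : ε < 1)
    {x x' : Euc n} (hx : x ∈ ConeS F N u ε δ) (hx' : x' ∈ ConeS F N u ε δ) (hd : ‖x' - x‖ < δ) :
    dist x x' ≤ (Real.sqrt (1 - ε^2))⁻¹ * dist (pr hu x) (pr hu x') := by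
  have h1 := ConeS_flat_aux hN hu hε1 hx hx' hd
  have h2 := ConeS_flat_aux hN hu hε1 hx' hx (by rwa [norm_sub_rev])
  rw [norm_sub_rev, ← neg_sub x' x, inner_neg_left] at h2
  have h3 : ⟪u, x - x'⟫ ^ 2 ≤ ε^2 * ‖x - x'‖^2 := by
    rw [real_inner_comm, ← mul_pow, ← neg_sub x' x, inner_neg_left, neg_sq, norm_neg]
    apply sq_le_sq'
    · linarith
    · linarith
  have h4 := pr_dist hu x x'
  have h5 : 0 < 1 - ε^2 := by nlinarith
  have h6 : (Real.sqrt (1 - ε^2) * dist x x')^2 ≤ dist (pr hu x) (pr hu x') ^ 2 := by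
    rw [h4, mul_pow, Real.sq_sqrt h5.le, dist_eq_norm]; linarith
  have h7 := abs_le_of_sq_le_sq' h6 dist_nonneg |>.2
  have h8 : 0 < Real.sqrt (1 - ε^2) := Real.sqrt_pos.2 h5
  rw [inv_mul_eq_div, le_div_iff₀ h8, mul_comm]; exact h7

theorem lines_ae {u : Euc n} (hu : ‖u‖ = 1) {P : Euc n → Prop} (h : ∀ᵐ x ∂(volume : Measure (Euc n)), P x) :
    ∀ᵐ (y : Hyp u) ∂(μH[(n:ℝ) - 1] : Measure (Hyp u)), ∀ᵐ (t : ℝ), P ((y : Euc n) + t • u) := by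
  have := haar_hyp hu
  obtain ⟨c, hc0, hct, hc⟩ := hyp_fubini hu
  set S := toMeasurable volume {x | ¬ P x} with hS
  have h0 : volume S = 0 := by rw [hS, measure_toMeasurable]; exact h
  have mS : MeasurableSet S := measurableSet_toMeasurable _ _
  have h1 := hc S mS
  rw [h0, mul_zero, lintegral_eq_zero_iff] at h1
  · filter_upwards [h1] with y hy
    rw [ae_iff]
    refine measure_mono_null ?_ hy
    intro t ht
    exact subset_toMeasurable _ _ ht
  · exact measurable_measure_prodMk_left (ν := (volume : Measure ℝ)) (s := {p : Hyp u × ℝ | (p.1 : Euc n) + p.2 • u ∈ S})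
      ((show Measurable fun p : Hyp u × ℝ => (p.1 : Euc n) + p.2 • u by fun_prop) mS)

theorem lsc_one {u : Euc n} (hn : 1 ≤ n) (hu : ‖u‖ = 1) {F N : Set (Euc n)} (hF : MeasurableSet F) (hN : volume N = 0) {ε δ : ℝ}
    (hε : 0 ≤ ε) (hε1 : ε < 1) (hδ : 0 < δ) {K : Set (Euc n)} (hK : IsCompact K) (hKQ : K ⊆ ConeS F N u ε δ)
    {A : ℕ → Set (Euc n)} (hA : ∀ k, MeasurableSet (A k))
    (hconv : ∀ R : ℝ, Tendsto (fun k => volume ({x | ¬ (x ∈ A k ↔ x ∈ F)} ∩ ball 0 R)) atTop (𝓝 0))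
    {U : Set (Euc n)} (hU : IsOpen U) (hKU : K ⊆ U) {η : ℝ≥0∞} (hη : 0 < η) :
    ∀ᶠ k in atTop, μH[(n:ℝ) - 1] (pr hu '' K) ≤ (μH[(n:ℝ) - 1] : Measure (Euc n)) (essBoundary (A k) ∩ U) + η := by
  have := haar_hyp hu
  obtain ⟨h0, hh0, hth⟩ := hK.exists_cthickening_subset_open hU hKU
  set h := min h0 δ with hh
  have hpos : 0 < h := lt_min hh0 hδ
  obtain ⟨R0, hR0⟩ := hK.isBounded.subset_ball (0 : Euc n)
  set R := R0 + h with hR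
  set D : ℕ → Set (Euc n) := fun k => {x | ¬ (x ∈ A k ↔ x ∈ F)} ∩ ball 0 R with hD
  have mD : ∀ k, MeasurableSet (D k) := by
    intro k
    refine MeasurableSet.inter ?_ measurableSet_ball
    have : {x | ¬ (x ∈ A k ↔ x ∈ F)} = (A k \ F) ∪ (F \ A k) := by
      ext x; simp only [mem_setOf_eq, mem_union, mem_diff]; tauto
    rw [this]; exact ((hA k).diff hF).union (hF.diff (hA k))
  obtain ⟨c, hc0, hct, hc⟩ := hyp_fubini hu
  set bad : ℕ → Set (Hyp u) := fun k => {y | ENNReal.ofReal (h/2) ≤ volume {t : ℝ | (y : Euc n) + t • u ∈ D k}} with hbad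
  have hh2 : ENNReal.ofReal (h/2) ≠ 0 := (ENNReal.ofReal_pos.2 (by positivity)).ne'
  have hb : ∀ k, μH[(n:ℝ) - 1] (bad k) ≤ c * volume (D k) / ENNReal.ofReal (h/2) := by
    intro k
    rw [← hc (D k) (mD k)]
    refine meas_ge_le_lintegral_div ?_ hh2 ENNReal.ofReal_ne_top
    exact (measurable_measure_prodMk_left (ν := (volume : Measure ℝ)) (s := {p : Hyp u × ℝ | (p.1 : Euc n) + p.2 • u ∈ D k})
      ((show Measurable fun p : Hyp u × ℝ => (p.1 : Euc n) + p.2 • u by fun_prop) (mD k))).aemeasurable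
  have hlim : Tendsto (fun k => c * volume (D k) / ENNReal.ofReal (h/2)) atTop (𝓝 0) := by
    have h1 := ENNReal.Tendsto.const_mul (a := c) (hconv R) (Or.inr hct)
    have h2 := ENNReal.Tendsto.div_const (b := ENNReal.ofReal (h/2)) h1 (Or.inr hh2)
    rwa [mul_zero, ENNReal.zero_div] at h2
  filter_upwards [ENNReal.tendsto_nhds_zero.1 hlim η hη] with k hk
  have hNae : ∀ᵐ x ∂(volume : Measure (Euc n)), x ∉ N := by rw [ae_iff]; simpa using hN
  have hsub : (pr hu '' K : Set (Hyp u)) ≤ᵐ[μH[(n:ℝ) - 1]] (pr hu '' (essBoundary (A k) ∩ U) ∪ bad k : Set (Hyp u)) := by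
    filter_upwards [lines_lemma hu (hA k), lines_ae hu hNae, lines_ae hu (ae_DZ_iff (hA k))] with y hy1 hy2 hy3 hyK
    by_contra hcon
    have hcon1 : y ∉ pr hu '' (essBoundary (A k) ∩ U) := fun h => hcon (Or.inl h)
    have hcon2 : y ∉ bad k := fun h => hcon (Or.inr h)
    obtain ⟨x, hxK, hxy⟩ := hyK
    have hxr : (y : Euc n) + ⟪u, x⟫ • u = x := by rw [← hxy]; exact pr_rep hu x
    set t0 := ⟪u, x⟫ with ht0
    have hdiff : ∀ t : ℝ, (y : Euc n) + t • u - x = (t - t0) • u := by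
      intro t; nth_rewrite 1 [← hxr]; module
    have hnd : ∀ t : ℝ, ‖(y : Euc n) + t • u - x‖ = |t - t0| := by
      intro t; rw [hdiff, norm_smul, hu, mul_one, Real.norm_eq_abs]
    have hsegR : ∀ t : ℝ, |t - t0| ≤ h/2 → (y : Euc n) + t • u ∈ ball (0 : Euc n) R := by
      intro t ht
      have h1 := hR0 hxK
      rw [mem_ball_zero_iff] at h1 ⊢
      have h2 := norm_le_norm_add_norm_sub' ((y : Euc n) + t • u) x
      rw [hnd] at h2
      linarith
    have hseg : ∀ t ∈ Icc (t0 - h/2) (t0 + h/2), (y : Euc n) + t • u ∉ essBoundary (A k) := by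
      intro t ht hmem
      apply hcon1
      refine ⟨(y : Euc n) + t • u, ⟨hmem, hth ?_⟩, pr_line hu y t⟩
      refine mem_cthickening_of_dist_le _ x _ _ hxK ?_
      rw [dist_eq_norm, hnd, abs_le]
      have := min_le_left h0 δ
      constructor <;> linarith [ht.1, ht.2]
    have hlt : volume {t : ℝ | (y : Euc n) + t • u ∈ D k} < ENNReal.ofReal (h/2) := not_le.1 hcon2
    have hhδ := min_le_right h0 δ
    rcases hy1 _ _ hseg with hc1 | hc1
    · have hle : (Ioo (t0 - h/2) t0 : Set ℝ) ≤ᵐ[volume] {t : ℝ | (y : Euc n) + t • u ∈ D k} := by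
        filter_upwards [hy2, hy3] with t ht2 ht3 htI
        have htI : t ∈ Ioo (t0 - h/2) t0 := htI
        have hab : |t - t0| = t0 - t := by rw [abs_of_neg (by linarith [htI.2])]; ring
        have hnA : (y : Euc n) + t • u ∉ A k := ht3.1.2 (hc1 t ⟨htI.1.le, by linarith [htI.2]⟩)
        have hinF : (y : Euc n) + t • u ∈ F := by
          refine (hKQ hxK _ ht2 ?_).2 ?_
          · rw [hnd, hab]; linarith [htI.1]
          · rw [hnd, hab, hdiff, inner_smul_left, real_inner_self_eq_norm_sq, hu]
            simp only [conj_trivial]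
            nlinarith [htI.2]
        exact ⟨fun hiff => hnA (hiff.2 hinF), hsegR t (by rw [hab]; linarith [htI.1])⟩
      have := measure_mono_ae hle
      rw [Real.volume_Ioo, show t0 - (t0 - h/2) = h/2 by ring] at this
      exact absurd hlt (not_lt.2 this)
    · have hle : (Ioo t0 (t0 + h/2) : Set ℝ) ≤ᵐ[volume] {t : ℝ | (y : Euc n) + t • u ∈ D k} := by
        filter_upwards [hy2, hy3] with t ht2 ht3 htI
        have htI : t ∈ Ioo t0 (t0 + h/2) := htI
        have hab : |t - t0| = t - t0 := by rw [abs_of_pos (by linarith [htI.1])]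
        have hnA : (y : Euc n) + t • u ∈ A k := ht3.2.2 (hc1 t ⟨by linarith [htI.1], htI.2.le⟩)
        have hinF : (y : Euc n) + t • u ∉ F := by
          refine (hKQ hxK _ ht2 ?_).1 ?_
          · rw [hnd, hab]; linarith [htI.2]
          · rw [hnd, hab, hdiff, inner_smul_left, real_inner_self_eq_norm_sq, hu]
            simp only [conj_trivial]
            nlinarith [htI.1]
        exact ⟨fun hiff => hinF (hiff.1 hnA), hsegR t (by rw [hab]; linarith [htI.2])⟩
      have := measure_mono_ae hle
      rw [Real.volume_Ioo, show t0 + h/2 - t0 = h/2 by ring] at this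
      exact absurd hlt (not_lt.2 this)
  calc μH[(n:ℝ) - 1] (pr hu '' K) ≤ μH[(n:ℝ) - 1] (pr hu '' (essBoundary (A k) ∩ U) ∪ bad k) := measure_mono_ae hsub
    _ ≤ μH[(n:ℝ) - 1] (pr hu '' (essBoundary (A k) ∩ U)) + μH[(n:ℝ) - 1] (bad k) := measure_union_le _ _
    _ ≤ _ := by
      gcongr
      · have := haus_image_le (f := pr hu) (s := essBoundary (A k) ∩ U) (K := 1) (dim_nonneg hn)
          (fun x _ y _ => (pr_lip hu).dist_le_mul x y)
        simpa using this
      · exact (hb k).trans hk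

theorem sep_sum {X ι : Type*} [TopologicalSpace X] [T2Space X] [MeasurableSpace X] [OpensMeasurableSpace X]
    (K : ι → Set X) (b : ι → ℝ≥0∞) (lam : ℕ → Measure X) (s : Finset ι)
    (hK : ∀ i ∈ s, IsCompact (K i)) (hdis : ∀ i ∈ s, ∀ j ∈ s, i ≠ j → Disjoint (K i) (K j))
    (h1 : ∀ i ∈ s, ∀ U, IsOpen U → K i ⊆ U → ∀ η : ℝ≥0∞, 0 < η → ∀ᶠ k in atTop, b i ≤ lam k U + η) :
    ∀ W, IsOpen W → (∀ i ∈ s, K i ⊆ W) → ∀ η : ℝ≥0∞, 0 < η → ∀ᶠ k in atTop, ∑ i ∈ s, b i ≤ lam k W + η := by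
  classical
  induction s using Finset.induction_on with
  | empty => intro W _ _ η _; simp
  | insert a s ha ih =>
    intro W hW hKW η hη
    have hcs : IsCompact (⋃ i ∈ s, K i) := s.isCompact_biUnion fun i hi => hK i (Finset.mem_insert_of_mem hi)
    have hd : Disjoint (K a) (⋃ i ∈ s, K i) := by
      rw [disjoint_iUnion₂_right]
      intro i hi
      exact hdis a (Finset.mem_insert_self _ _) i (Finset.mem_insert_of_mem hi) (by rintro rfl; exact ha hi)
    obtain ⟨U, V, hU, hV, hKU, hKV, hUV⟩ := SeparatedNhds.of_isCompact_isCompact (hK a (Finset.mem_insert_self _ _)) hcs hd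
    have e1 := h1 a (Finset.mem_insert_self _ _) (U ∩ W) (hU.inter hW) (subset_inter hKU (hKW a (Finset.mem_insert_self _ _))) (η/2) (ENNReal.half_pos hη.ne')
    have e2 := ih (fun i hi => hK i (Finset.mem_insert_of_mem hi))
      (fun i hi j hj => hdis i (Finset.mem_insert_of_mem hi) j (Finset.mem_insert_of_mem hj))
      (fun i hi => h1 i (Finset.mem_insert_of_mem hi)) (V ∩ W) (hV.inter hW)
      (fun i hi => subset_inter ((subset_biUnion_of_mem (u := fun i => K i) (show i ∈ (s : Set ι) from hi)).trans hKV) (hKW i (Finset.mem_insert_of_mem hi))) (η/2) (ENNReal.half_pos hη.ne')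
    filter_upwards [e1, e2] with k hk1 hk2
    rw [Finset.sum_insert ha]
    calc b a + ∑ i ∈ s, b i ≤ (lam k (U ∩ W) + η/2) + (lam k (V ∩ W) + η/2) := by gcongr
      _ = (lam k (U ∩ W) + lam k (V ∩ W)) + (η/2 + η/2) := by ring
      _ = lam k ((U ∩ W) ∪ (V ∩ W)) + η := by
          rw [ENNReal.add_halves, measure_union (hUV.mono inter_subset_left inter_subset_left) (hV.inter hW).measurableSet]
      _ ≤ _ := by
          gcongr
          exact union_subset inter_subset_right inter_subset_right

theorem cover_bound (μ : Measure (Euc n)) (T : ℕ → Set (Euc n)) (hT : ∀ i, MeasurableSet (T i)) (hfin : ∀ i, μ (T i) ≠ ⊤)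
    {W : Set (Euc n)} (hW : IsOpen W) {C : ℝ≥0∞}
    (h : ∀ N : ℕ, ∀ K : ℕ → Set (Euc n), (∀ i, IsCompact (K i)) → (∀ i, K i ⊆ T i ∩ W) → (∀ i j, i ≠ j → Disjoint (K i) (K j)) →
      ∑ i ∈ Finset.range N, μ (K i) ≤ C) : μ (⋃ i, T i ∩ W) ≤ C := by
  set D := disjointed (fun i => T i ∩ W) with hD
  have mD : ∀ i, MeasurableSet (D i) := fun i => MeasurableSet.disjointed (fun j => (hT j).inter hW.measurableSet) i
  have hDT : ∀ i, D i ⊆ T i ∩ W := fun i => disjointed_subset _ i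
  have hdd : Pairwise (fun i j => Disjoint (D i) (D j)) := disjoint_disjointed _
  rw [← iUnion_disjointed, measure_iUnion hdd mD, ENNReal.tsum_eq_iSup_nat]
  refine iSup_le fun N => ?_
  apply ENNReal.le_of_forall_pos_le_add
  intro η hη _
  have hex : ∀ i, ∃ K ⊆ D i, IsCompact K ∧ μ (D i) ≤ μ K + η / (N + 1) := by
    intro i
    have : IsFiniteMeasure (μ.restrict (T i)) := ⟨by rw [Measure.restrict_apply_univ]; exact (hfin i).lt_top⟩
    obtain ⟨K, hK1, hK2, hK3⟩ := (mD i).exists_isCompact_lt_add (μ := μ.restrict (T i)) (measure_ne_top _ _) (ε := (η / (N+1) : ℝ≥0∞))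
      (by simp [ENNReal.div_eq_zero_iff, hη.ne', ENNReal.add_eq_top])
    refine ⟨K, hK1, hK2, ?_⟩
    rw [Measure.restrict_apply (mD i), Measure.restrict_apply hK2.measurableSet, inter_eq_self_of_subset_left ((hDT i).trans inter_subset_left),
      inter_eq_self_of_subset_left (hK1.trans ((hDT i).trans inter_subset_left))] at hK3
    exact hK3.le
  choose K hK1 hK2 hK3 using hex
  have h1 := h N K hK2 (fun i => (hK1 i).trans (hDT i)) (fun i j hij => (hdd hij).mono (hK1 i) (hK1 j))
  calc ∑ i ∈ Finset.range N, μ (D i) ≤ ∑ i ∈ Finset.range N, (μ (K i) + η / (N + 1)) := Finset.sum_le_sum fun i _ => hK3 i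
    _ = ∑ i ∈ Finset.range N, μ (K i) + N * (η / (N + 1)) := by
        rw [Finset.sum_add_distrib, Finset.sum_const, Finset.card_range, nsmul_eq_mul]
    _ ≤ C + η := by
        gcongr
        calc (N : ℝ≥0∞) * (η / (N + 1)) ≤ (N + 1) * (η / (N + 1)) := by gcongr; exact le_self_add
          _ = η := ENNReal.mul_div_cancel (by simp) (by simp [ENNReal.add_eq_top])

theorem ConeS_mono {F N : Set (Euc n)} {ν u : Euc n} {ε δ δ' : ℝ} (hε : 0 < ε) (h : ‖u - ν‖ ≤ ε/2) (hδ : δ' ≤ δ) {x : Euc n}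
    (hx : x ∈ ConeS F N ν (ε/2) δ) : x ∈ ConeS F N u ε δ' := by
  intro y hy hd
  have h1 : |⟪y - x, u⟫ - ⟪y - x, ν⟫| ≤ ε/2 * ‖y - x‖ := by
    rw [← inner_sub_right]
    refine (abs_real_inner_le_norm _ _).trans ?_
    rw [mul_comm]
    gcongr
  have h2 := abs_le.1 h1
  have h3 := hx y hy (hd.trans_le hδ)
  exact ⟨fun h4 => h3.1 (by linarith), fun h4 => h3.2 (by linarith)⟩

theorem lsc_eps (hn : 1 ≤ n) {F N : Set (Euc n)} (hF : MeasurableSet F) (hN : volume N = 0) {ε : ℝ}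
    (hε : 0 < ε) (hε1 : ε < 1)
    {A : ℕ → Set (Euc n)} (hA : ∀ k, MeasurableSet (A k))
    (hconv : ∀ R : ℝ, Tendsto (fun k => volume ({x | ¬ (x ∈ A k ↔ x ∈ F)} ∩ ball 0 R)) atTop (𝓝 0))
    {W : Set (Euc n)} (hW : IsOpen W) {C : ℝ≥0∞} (hC : ∀ k, (μH[(n:ℝ) - 1] : Measure (Euc n)) (essBoundary (A k) ∩ W) ≤ C) :
    (μH[(n:ℝ) - 1] : Measure (Euc n)) (Tan F N ∩ W) ≤ (ENNReal.ofReal (Real.sqrt (1 - ε^2))⁻¹) ^ ((n:ℝ) - 1) * C := by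
  set κ : ℝ≥0 := ⟨(Real.sqrt (1 - ε^2))⁻¹, by positivity⟩ with hκ
  have hκe : ENNReal.ofReal (Real.sqrt (1 - ε^2))⁻¹ = (κ : ℝ≥0∞) := ENNReal.ofReal_eq_coe_nnreal _
  rw [hκe]
  have hd := dim_nonneg hn
  have hκt : (κ : ℝ≥0∞) ^ ((n:ℝ) - 1) ≠ ⊤ := ENNReal.rpow_ne_top_of_nonneg hd ENNReal.coe_ne_top
  have hne : Nonempty (Sph n) := ⟨⟨e1 n hn, by simp [e1]⟩⟩
  set us := TopologicalSpace.denseSeq (Sph n) with hus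
  set qs := TopologicalSpace.denseSeq (Euc n) with hqs
  let d : ℕ → ℝ := fun l => 1 / ((l : ℝ) + 1)
  have hdpos : ∀ l, 0 < d l := fun l => by positivity
  let T0 : ℕ × ℕ × ℕ → Set (Euc n) := fun p => ConeS F N (us p.1) ε (d p.2.1) ∩ closedBall (qs p.2.2) (d p.2.1 / 3)
  let T : ℕ → Set (Euc n) := fun i => T0 ((Denumerable.eqv (ℕ × ℕ × ℕ)).symm i)
  have hcT0 : ∀ p, IsCompact (T0 p) := fun p => (isCompact_closedBall _ _).inter_left (isClosed_ConeS _ _ _ _ _)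
  have hflat : ∀ p, ∀ x ∈ T0 p, ∀ x' ∈ T0 p, dist x x' ≤ κ * dist (pr (norm_sph (us p.1)) x) (pr (norm_sph (us p.1)) x') := by
    intro p x hx x' hx'
    apply ConeS_flat hN (norm_sph (us p.1)) hε.le hε1 hx.1 hx'.1
    have h1 := mem_closedBall.1 hx.2
    have h2 := mem_closedBall.1 hx'.2
    rw [← dist_eq_norm]
    have := dist_triangle_right x' x (qs p.2.2)
    have := hdpos p.2.1
    linarith
  have hTan : Tan F N ∩ W ⊆ ⋃ i, T i ∩ W := by
    rintro x ⟨⟨ν, hν, hx⟩, hxW⟩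
    obtain ⟨δ, hδ, hxδ⟩ := hx (ε/2) (by positivity)
    obtain ⟨l, hl⟩ := exists_nat_one_div_lt hδ
    obtain ⟨a, ha⟩ := (TopologicalSpace.denseRange_denseSeq (Sph n)).exists_dist_lt ⟨ν, by simpa using hν⟩ (show 0 < ε/2 by positivity)
    obtain ⟨b, hb⟩ := (TopologicalSpace.denseRange_denseSeq (Euc n)).exists_dist_lt x (show 0 < d l / 3 by have := hdpos l; positivity)
    refine mem_iUnion.2 ⟨Denumerable.eqv _ (a, l, b), ?_, hxW⟩
    show x ∈ T0 _
    rw [Equiv.symm_apply_apply]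
    refine ⟨ConeS_mono hε ?_ hl.le hxδ, mem_closedBall.2 hb.le⟩
    rw [Subtype.dist_eq, dist_comm, dist_eq_norm] at ha
    exact ha.le
  refine (measure_mono hTan).trans (cover_bound _ T (fun i => (hcT0 _).measurableSet) ?_ hW ?_)
  · intro i
    refine ne_top_of_le_ne_top ?_ (haus_le_image hd (hflat ((Denumerable.eqv (ℕ × ℕ × ℕ)).symm i)))
    have := haar_hyp (norm_sph (us ((Denumerable.eqv (ℕ × ℕ × ℕ)).symm i).1))
    refine ENNReal.mul_ne_top hκt ?_
    exact ((hcT0 _).image (pr_lip _).continuous).measure_ne_top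
  · intro M K hK1 hK2 hK3
    set p : ℕ → ℕ × ℕ × ℕ := fun i => (Denumerable.eqv (ℕ × ℕ × ℕ)).symm i with hp
    set b : ℕ → ℝ≥0∞ := fun i => μH[(n:ℝ) - 1] (pr (norm_sph (us (p i).1)) '' K i) with hb
    have hsum : ∑ i ∈ Finset.range M, b i ≤ C := by
      apply ENNReal.le_of_forall_pos_le_add
      intro η hη _
      have hev := sep_sum K b (fun k => (μH[(n:ℝ) - 1] : Measure (Euc n)).restrict (essBoundary (A k))) (Finset.range M)
        (fun i _ => hK1 i) (fun i _ j _ => hK3 i j) (by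
          intro i _ U hU hKU η' hη'
          have h1 := lsc_one hn (norm_sph (us (p i).1)) hF hN hε.le hε1 (hdpos (p i).2.1) (hK1 i)
            (fun x hx => (hK2 i hx).1.1) hA hconv hU hKU hη'
          filter_upwards [h1] with k hk
          rw [Measure.restrict_apply hU.measurableSet, inter_comm]; exact hk) W hW (fun i _ => (hK2 i).trans inter_subset_right) η (by exact_mod_cast hη)
      obtain ⟨k, hk⟩ := hev.exists
      rw [Measure.restrict_apply hW.measurableSet, inter_comm] at hk
      exact hk.trans (by gcongr; exact hC k)
    calc ∑ i ∈ Finset.range M, μH[(n:ℝ) - 1] (K i) ≤ ∑ i ∈ Finset.range M, (κ : ℝ≥0∞) ^ ((n:ℝ) - 1) * b i := by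
          apply Finset.sum_le_sum
          intro i _
          exact haus_le_image hd fun x hx x' hx' => hflat (p i) x (hK2 i hx).1 x' (hK2 i hx').1
      _ = (κ : ℝ≥0∞) ^ ((n:ℝ) - 1) * ∑ i ∈ Finset.range M, b i := by rw [Finset.mul_sum]
      _ ≤ _ := by gcongr

theorem lsc_main (hn : 1 ≤ n) {F N : Set (Euc n)} (hF : MeasurableSet F) (hN : volume N = 0)
    {A : ℕ → Set (Euc n)} (hA : ∀ k, MeasurableSet (A k))
    (hconv : ∀ R : ℝ, Tendsto (fun k => volume ({x | ¬ (x ∈ A k ↔ x ∈ F)} ∩ ball 0 R)) atTop (𝓝 0))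
    {W : Set (Euc n)} (hW : IsOpen W) {C : ℝ≥0∞} (hC : ∀ k, (μH[(n:ℝ) - 1] : Measure (Euc n)) (essBoundary (A k) ∩ W) ≤ C) :
    (μH[(n:ℝ) - 1] : Measure (Euc n)) (Tan F N ∩ W) ≤ C := by
  have h1 : Tendsto (fun ε : ℝ => (ENNReal.ofReal (Real.sqrt (1 - ε^2))⁻¹) ^ ((n:ℝ) - 1) * C) (𝓝[>] 0) (𝓝 C) := by
    have h2 : Tendsto (fun ε : ℝ => (Real.sqrt (1 - ε^2))⁻¹) (𝓝[>] 0) (𝓝 1) := by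
      have : ContinuousAt (fun ε : ℝ => (Real.sqrt (1 - ε^2))⁻¹) 0 := by
        apply ContinuousAt.inv₀
        · fun_prop
        · simp
      have h3 := this.tendsto
      simp only [ne_eq, OfNat.ofNat_ne_zero, not_false_eq_true, zero_pow, sub_zero, Real.sqrt_one, inv_one] at h3
      exact h3.mono_left nhdsWithin_le_nhds
    have h4 := (ENNReal.continuous_ofReal.tendsto _).comp h2
    have h5 := (ENNReal.continuous_rpow_const (y := (n:ℝ) - 1)).tendsto (ENNReal.ofReal 1) |>.comp h4
    simp only [ENNReal.ofReal_one, ENNReal.one_rpow] at h5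
    have h6 := ENNReal.Tendsto.mul_const (b := C) h5 (Or.inl one_ne_zero)
    rw [one_mul] at h6
    exact h6
  refine ge_of_tendsto h1 ?_
  have h7 : ∀ᶠ ε : ℝ in 𝓝[>] 0, ε < 1 := (eventually_lt_nhds one_pos).filter_mono nhdsWithin_le_nhds
  filter_upwards [h7, self_mem_nhdsWithin] with ε hε1 hε
  exact lsc_eps hn hF hN hε hε1 hA hconv hW hC

/-- lower semicontinuity on shells -/
theorem lsc_shell (hn : 1 ≤ n) {E F N : Set (Euc n)} (hF : MeasurableSet F) (hN : volume N = 0) (hE : MeasurableSet E)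
    (hP : perim E univ < ⊤)
    {A : ℕ → Set (Euc n)} (hA : ∀ k, MeasurableSet (A k))
    (hconv : ∀ R : ℝ, Tendsto (fun k => volume ({x | ¬ (x ∈ A k ↔ x ∈ F)} ∩ ball 0 R)) atTop (𝓝 0))
    (hper : ∀ k, ∀ B : Set ℝ, MeasurableSet B → perim (A k) (sphShell n B) ≤ perim E (sphShell n B))
    {B : Set ℝ} (hB : MeasurableSet B) :
    (μH[(n:ℝ) - 1] : Measure (Euc n)) (Tan F N ∩ sphShell n B) ≤ perim E (sphShell n B) := by
  set ν : Measure ℝ := (((μH[(n:ℝ) - 1] : Measure (Euc n)).restrict (essBoundary E)).restrict {0}ᶜ).map norm with hν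
  have hme := measurableSet_essBoundary hE
  have hνB : ∀ B : Set ℝ, MeasurableSet B → ν B = perim E (sphShell n B) := by
    intro B hB
    have mB : MeasurableSet {x : Euc n | ‖x‖ ∈ B} := measurable_norm hB
    rw [hν, Measure.map_apply measurable_norm hB, Measure.restrict_apply (measurable_norm hB), Measure.restrict_apply]
    · unfold perim
      congr 1
      ext x
      simp only [mem_inter_iff, mem_preimage, mem_compl_iff, mem_singleton_iff, sphShell, mem_setOf_eq]; tauto
    · exact mB.inter (measurableSet_singleton _).compl
  have hfin : IsFiniteMeasure ν := ⟨by
    rw [hνB univ MeasurableSet.univ]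
    refine lt_of_le_of_lt ?_ hP
    exact measure_mono (inter_subset_inter_right _ (subset_univ _))⟩
  apply ENNReal.le_of_forall_pos_le_add
  intro η hη _
  obtain ⟨U, hBU, hU, hUB⟩ := B.exists_isOpen_lt_add (μ := ν) (measure_ne_top _ _) (ε := (η : ℝ≥0∞)) (by exact_mod_cast hη.ne')
  have oW : IsOpen (sphShell n U) := by
    have : sphShell n U = {0}ᶜ ∩ norm ⁻¹' U := by
      ext x; simp [sphShell]
    rw [this]
    exact isOpen_compl_singleton.inter (hU.preimage continuous_norm)
  have h1 := lsc_main hn hF hN hA hconv oW (fun k => hper k U hU.measurableSet)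
  calc _ ≤ (μH[(n:ℝ) - 1] : Measure (Euc n)) (Tan F N ∩ sphShell n U) := by
        apply measure_mono
        rintro x ⟨hx1, hx2, hx3⟩
        exact ⟨hx1, hx2, hBU hx3⟩
    _ ≤ perim E (sphShell n U) := h1
    _ ≤ perim E (sphShell n B) + η := by
        rw [← hνB U hU.measurableSet, ← hνB B hB]; exact hUB.le
end Lsc

end SecA8

section SecA9
open MeasureTheory Metric Set Filter
open scoped ENNReal NNReal Topology RealInnerProductSpace Pointwise
set_option linter.all false
set_option linter.deprecated false

section Sard
variable {H : Type*} [NormedAddCommGroup H] [NormedSpace ℝ H] [FiniteDimensional ℝ H] [MeasurableSpace H] [BorelSpace H]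
variable {X : Type*} [MetricSpace X] [MeasurableSpace X] [BorelSpace X]

theorem finrank_prod_H : (Module.finrank ℝ (ℝ × H) : ℝ) = (Module.finrank ℝ H : ℝ) + 1 := by
  rw [Module.finrank_prod, Module.finrank_self]; push_cast; ring

/-- volume of a product slab in terms of Hausdorff measure -/
theorem haus_slab (ν : Measure H) [ν.IsAddHaarMeasure] : ∃ c : ℝ≥0∞, c ≠ ⊤ ∧ ∀ (S : Set ℝ) (B : Set H),
    (μH[(Module.finrank ℝ H : ℝ) + 1] : Measure (ℝ × H)) (S ×ˢ B) ≤ c * (volume S * ν B) := by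
  obtain ⟨c, hc, h⟩ := haar_eq_haus ((volume : Measure ℝ).prod ν)
  refine ⟨(c : ℝ≥0∞)⁻¹, by simp [hc.ne'], fun S B => ?_⟩
  rw [← finrank_prod_H, ← Measure.prod_prod (μ := (volume : Measure ℝ)) (ν := ν) S B, h, Measure.smul_apply, smul_eq_mul, ← mul_assoc,
    ENNReal.inv_mul_cancel (by exact_mod_cast hc.ne') ENNReal.coe_ne_top, one_mul]

theorem sard_null {Φ : ℝ × H → X} {Z : Set ℝ} (hZ : volume Z = 0) {K : ℝ≥0}
    (h : ∀ s ∈ Z, ∀ s' ∈ Z, ∀ y y', dist (Φ (s,y)) (Φ (s',y')) ≤ K * (|s - s'| + dist y y')) :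
    (μH[(Module.finrank ℝ H : ℝ) + 1] : Measure X) (Φ '' (Z ×ˢ univ)) = 0 := by
  obtain ⟨c, hc, hcS⟩ := haus_slab (Measure.addHaar : Measure H)
  have h0 : (μH[(Module.finrank ℝ H : ℝ) + 1] : Measure (ℝ × H)) (Z ×ˢ univ) = 0 := by
    have := hcS Z univ
    rw [hZ, zero_mul, mul_zero] at this
    exact le_antisymm this zero_le
  have h1 := haus_image_le (f := Φ) (s := Z ×ˢ univ) (K := 2 * K) (d := (Module.finrank ℝ H : ℝ) + 1) (by positivity) (by
    rintro ⟨s, y⟩ hs ⟨s', y'⟩ hs'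
    refine (h s hs.1 s' hs'.1 y y').trans ?_
    have e1 : |s - s'| ≤ dist (s,y) (s',y') := by rw [Prod.dist_eq, ← Real.dist_eq]; exact le_max_left _ _
    have e2 : dist y y' ≤ dist (s,y) (s',y') := by rw [Prod.dist_eq]; exact le_max_right _ _
    push_cast
    nlinarith [K.2])
  rw [h0, mul_zero] at h1
  exact le_antisymm h1 zero_le

theorem sard_crit_aux {Φ : ℝ × H → X} {Z : Set ℝ} {K : ℝ≥0} {a b : ℝ → ℝ}
    (h : ∀ s ∈ Z, ∀ s' ∈ Z, ∀ y y', dist (Φ (s,y)) (Φ (s',y')) ≤ K * (|a s - a s'| + |b s - b s'| + dist y y'))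
    (ha : ∀ s ∈ Z, HasDerivAt a 0 s) (hb : ∀ s ∈ Z, HasDerivAt b 0 s) {L : ℝ} (hL : 0 < L) (hZL : Z ⊆ Ioc (-L) L) :
    (μH[(Module.finrank ℝ H : ℝ) + 1] : Measure X) (Φ '' (Z ×ˢ ball 0 L)) = 0 := by
  obtain ⟨c, hc, hcS⟩ := haus_slab (Measure.addHaar : Measure H)
  have hd : 0 ≤ (Module.finrank ℝ H : ℝ) + 1 := by positivity
  set d := (Module.finrank ℝ H : ℝ) + 1 with hdd
  set C : ℝ≥0∞ := ((3 * K : ℝ≥0) : ℝ≥0∞) ^ d * (c * (ENNReal.ofReal (2 * L) * (Measure.addHaar : Measure H) (ball 0 L))) with hC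
  have hCt : C ≠ ⊤ := by
    refine ENNReal.mul_ne_top (ENNReal.rpow_ne_top_of_nonneg hd ENNReal.coe_ne_top) (ENNReal.mul_ne_top hc (ENNReal.mul_ne_top ENNReal.ofReal_ne_top measure_ball_lt_top.ne))
  have key : ∀ η : ℝ, 0 < η → (μH[d] : Measure X) (Φ '' (Z ×ˢ ball 0 L)) ≤ ENNReal.ofReal η * C := by
    intro η hη
    set Zk : ℕ → Set ℝ := fun k => {s | s ∈ Z ∧ ∀ s', |s' - s| < 1 / ((k:ℝ) + 1) → |a s' - a s| ≤ η * |s' - s| ∧ |b s' - b s| ≤ η * |s' - s|} with hZk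
    have hmono : Monotone Zk := by
      intro k l hkl s hs
      refine ⟨hs.1, fun s' hs' => hs.2 s' (hs'.trans_le ?_)⟩
      exact Nat.one_div_le_one_div hkl
    have hun : Z = ⋃ k, Zk k := by
      ext s
      refine ⟨fun hs => ?_, fun hs => by obtain ⟨k, hk⟩ := mem_iUnion.1 hs; exact hk.1⟩
      have e1 := (ha s hs).isLittleO.def hη
      have e2 := (hb s hs).isLittleO.def hη
      obtain ⟨δ, hδ, hball⟩ := Metric.eventually_nhds_iff.1 (e1.and e2)
      obtain ⟨k, hk⟩ := exists_nat_one_div_lt hδ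
      refine mem_iUnion.2 ⟨k, hs, fun s' hs' => ?_⟩
      have := hball (y := s') (by rw [Real.dist_eq]; exact hs'.trans hk)
      simpa using this
    have hk : ∀ k, (μH[d] : Measure X) (Φ '' (Zk k ×ˢ ball 0 L)) ≤ ENNReal.ofReal η * C := by
      intro k
      set θ : ℝ := 1 / ((k:ℝ) + 1) with hθ
      have hθ0 : 0 < θ := by positivity
      set I : ℤ → Set ℝ := fun j => Ioc (j • θ) ((j+1) • θ) with hI
      have hIun : ⋃ j, I j = univ := iUnion_Ioc_zsmul hθ0
      have hIdis : Pairwise (fun i j => Disjoint (I i) (I j)) := pairwise_disjoint_Ioc_zsmul θ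
      have hpiece : ∀ j, (μH[d] : Measure X) (Φ '' ((Zk k ∩ I j) ×ˢ ball 0 L)) ≤
          ((3 * K : ℝ≥0) : ℝ≥0∞) ^ d * (c * (ENNReal.ofReal η * volume (Ioc (-L) L ∩ I j) * (Measure.addHaar : Measure H) (ball 0 L))) := by
        intro j
        set S : Set ℝ := (fun t => η⁻¹ * t) ⁻¹' (Zk k ∩ I j) with hS
        have himg : Φ '' ((Zk k ∩ I j) ×ˢ ball 0 L) = (fun p : ℝ × H => Φ (η⁻¹ * p.1, p.2)) '' (S ×ˢ ball 0 L) := by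
          ext q
          constructor
          · rintro ⟨⟨s, y⟩, ⟨hs, hy⟩, rfl⟩
            have e : η⁻¹ * (η * s) = s := by field_simp
            refine ⟨(η * s, y), ⟨?_, hy⟩, ?_⟩
            · show η⁻¹ * (η * s) ∈ Zk k ∩ I j
              rw [e]; exact hs
            · show Φ (η⁻¹ * (η * s), y) = _
              rw [e]
          · rintro ⟨⟨s, y⟩, ⟨hs, hy⟩, rfl⟩
            exact ⟨(η⁻¹ * s, y), ⟨hs, hy⟩, rfl⟩
        rw [himg]
        refine (haus_image_le (K := 3 * K) hd ?_).trans ?_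
        · rintro ⟨s, y⟩ hs ⟨s', y'⟩ hs'
          have hs1 : η⁻¹ * s ∈ Zk k ∩ I j := hs.1
          have hs2 : η⁻¹ * s' ∈ Zk k ∩ I j := hs'.1
          have hlt : |η⁻¹ * s - η⁻¹ * s'| < θ := by
            have := hs1.2.1; have := hs1.2.2; have := hs2.2.1; have := hs2.2.2
            simp only [zsmul_eq_mul, Int.cast_add, Int.cast_one] at *
            rw [abs_lt]; constructor <;> nlinarith
          have h1 := hs2.1.2 _ hlt
          have e : η * |η⁻¹ * s - η⁻¹ * s'| = |s - s'| := by
            rw [← mul_sub, abs_mul, abs_of_pos (inv_pos.2 hη)]; field_simp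
          rw [e] at h1
          refine (h _ hs1.1.1 _ hs2.1.1 y y').trans ?_
          have e1 : |s - s'| ≤ dist (s,y) (s',y') := by rw [Prod.dist_eq, ← Real.dist_eq]; exact le_max_left _ _
          have e2 : dist y y' ≤ dist (s,y) (s',y') := by rw [Prod.dist_eq]; exact le_max_right _ _
          have e3 : |a (η⁻¹ * s) - a (η⁻¹ * s')| + |b (η⁻¹ * s) - b (η⁻¹ * s')| + dist y y' ≤ 3 * dist (s,y) (s',y') := by linarith [h1.1, h1.2]
          push_cast
          have := mul_le_mul_of_nonneg_left e3 (NNReal.coe_nonneg K)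
          linarith
        · gcongr
          refine (hcS _ _).trans ?_
          gcongr
          calc volume S ≤ volume ((fun t => η⁻¹ * t) ⁻¹' (Ioc (-L) L ∩ I j)) := measure_mono (preimage_mono (inter_subset_inter_left _ fun s hs => hZL hs.1))
            _ = _ := by
              rw [Real.volume_preimage_mul_left (inv_pos.2 hη).ne', inv_inv, abs_of_pos hη]
      have hcov : Φ '' (Zk k ×ˢ ball 0 L) ⊆ ⋃ j, Φ '' ((Zk k ∩ I j) ×ˢ ball 0 L) := by
        rintro _ ⟨⟨s, y⟩, ⟨hs, hy⟩, rfl⟩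
        have : s ∈ ⋃ j, I j := by rw [hIun]; trivial
        obtain ⟨j, hj⟩ := mem_iUnion.1 this
        exact mem_iUnion.2 ⟨j, (s, y), ⟨⟨hs, hj⟩, hy⟩, rfl⟩
      have hvol : ∑' j, volume (Ioc (-L) L ∩ I j) = ENNReal.ofReal (2 * L) := by
        rw [← measure_iUnion (fun i j hij => (hIdis hij).mono inter_subset_right inter_subset_right) (fun j => measurableSet_Ioc.inter measurableSet_Ioc),
          ← inter_iUnion, hIun, inter_univ, Real.volume_Ioc]
        congr 1; ring
      calc _ ≤ _ := measure_mono hcov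
        _ ≤ ∑' j, (μH[d] : Measure X) (Φ '' ((Zk k ∩ I j) ×ˢ ball 0 L)) := measure_iUnion_le _
        _ ≤ ∑' j, ((3 * K : ℝ≥0) : ℝ≥0∞) ^ d * (c * (ENNReal.ofReal η * volume (Ioc (-L) L ∩ I j) * (Measure.addHaar : Measure H) (ball 0 L))) :=
            ENNReal.tsum_le_tsum hpiece
        _ = ENNReal.ofReal η * C := by
            rw [ENNReal.tsum_mul_left, ENNReal.tsum_mul_left, ENNReal.tsum_mul_right, ENNReal.tsum_mul_left, hvol, hC]; ring
    have hU : Φ '' (Z ×ˢ ball 0 L) = ⋃ k, Φ '' (Zk k ×ˢ ball 0 L) := by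
      rw [← image_iUnion, ← iUnion_prod_const, ← hun]
    rw [hU, Monotone.measure_iUnion]
    · exact iSup_le hk
    · intro k l hkl
      exact image_mono (prod_mono_left (hmono hkl))
  by_contra hne
  have hpos : 0 < (μH[d] : Measure X) (Φ '' (Z ×ˢ ball 0 L)) := pos_iff_ne_zero.2 hne
  have hlim : Tendsto (fun η : ℝ => ENNReal.ofReal η * C) (𝓝[>] 0) (𝓝 0) := by
    have h1 : Tendsto (fun η : ℝ => ENNReal.ofReal η) (𝓝[>] 0) (𝓝 (ENNReal.ofReal 0)) :=
      (ENNReal.continuous_ofReal.tendsto _).mono_left nhdsWithin_le_nhds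
    rw [ENNReal.ofReal_zero] at h1
    have h2 := ENNReal.Tendsto.mul_const (b := C) h1 (Or.inr hCt)
    rwa [zero_mul] at h2
  have : (μH[d] : Measure X) (Φ '' (Z ×ˢ ball 0 L)) ≤ 0 := by
    refine ge_of_tendsto hlim ?_
    filter_upwards [self_mem_nhdsWithin] with η hη
    exact key η hη
  exact absurd this (not_le.2 hpos)

theorem sard_crit {Φ : ℝ × H → X} {Z : Set ℝ} {K : ℝ≥0} {a b : ℝ → ℝ}
    (h : ∀ s ∈ Z, ∀ s' ∈ Z, ∀ y y', dist (Φ (s,y)) (Φ (s',y')) ≤ K * (|a s - a s'| + |b s - b s'| + dist y y'))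
    (ha : ∀ s ∈ Z, HasDerivAt a 0 s) (hb : ∀ s ∈ Z, HasDerivAt b 0 s) :
    (μH[(Module.finrank ℝ H : ℝ) + 1] : Measure X) (Φ '' (Z ×ˢ univ)) = 0 := by
  have hsub : Φ '' (Z ×ˢ univ) ⊆ ⋃ k : ℕ, Φ '' ((Z ∩ Ioc (-((k:ℝ)+1)) ((k:ℝ)+1)) ×ˢ ball 0 ((k:ℝ)+1)) := by
    rintro _ ⟨⟨s, y⟩, ⟨hs, -⟩, rfl⟩
    obtain ⟨k, hk⟩ := exists_nat_gt (max |s| ‖y‖)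
    have h1 := abs_lt.1 ((le_max_left _ _).trans_lt hk)
    refine mem_iUnion.2 ⟨k, (s,y), ⟨⟨hs, by constructor <;> linarith [h1.1, h1.2]⟩, ?_⟩, rfl⟩
    rw [mem_ball_zero_iff]; linarith [(le_max_right |s| ‖y‖).trans_lt hk]
  refine measure_mono_null hsub (measure_iUnion_null fun k => ?_)
  exact sard_crit_aux (fun s hs s' hs' => h s hs.1 s' hs'.1) (fun s hs => ha s hs.1) (fun s hs => hb s hs.1) (by positivity) inter_subset_right
end Sard

end SecA9

section SecA10
open MeasureTheory Metric Set Filter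
open scoped ENNReal NNReal Topology RealInnerProductSpace Pointwise
set_option linter.all false
set_option linter.deprecated false

theorem pos_of_two {n : ℕ} (hn : 2 ≤ n) : 0 < n := lt_of_lt_of_le two_pos hn

noncomputable def capS (n : ℕ) (e : Euc n) (t : ℝ) : Set (Sph n) := {ω | t < ⟪(ω : Euc n), e⟫}

theorem measurableSet_capS (n : ℕ) (e : Euc n) (t : ℝ) : MeasurableSet (capS n e t) := by
  apply measurableSet_lt measurable_const
  exact ((continuous_subtype_val.inner continuous_const)).measurable

theorem band_lower {k : ℕ} {ε : ℝ} (hε : 0 < ε) (hε1 : ε < 1) : ∃ c : ℝ, 0 < c ∧ ∀ s t : ℝ, -(1 - ε) ≤ s → s ≤ t → t ≤ 1 - ε →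
    ENNReal.ofReal (c * (t - s)) ≤ sig (k+2) (capS (k+2) (e1 (k+2) (by omega)) s \ capS (k+2) (e1 (k+2) (by omega)) t) := by
  obtain ⟨δ, hδ, hδe⟩ : ∃ δ : ℝ, 0 < δ ∧ (k:ℝ) * δ^2 ≤ ε := by
    refine ⟨ε / (k+1), by positivity, ?_⟩
    have h1 : (k:ℝ) / (k+1) ≤ 1 := by rw [div_le_one (by positivity)]; linarith
    have h2 : ε / (k+1) ≤ 1 := by rw [div_le_one (by positivity)]; have : (0:ℝ) ≤ k := by positivity
                                  linarith
    have h3 : (k:ℝ) * (ε/(k+1))^2 = (k / (k+1)) * ε * (ε / (k+1)) := by field_simp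
    rw [h3]
    have h4 : (k:ℝ) / (k+1) * ε ≤ ε := by nlinarith
    have h5 : 0 ≤ ε / (k+1) := by positivity
    nlinarith
  refine ⟨(2*δ)^k, by positivity, fun s t hs hst ht => ?_⟩
  set S := capS (k+2) (e1 (k+2) (by omega)) s \ capS (k+2) (e1 (k+2) (by omega)) t with hS
  let f : Sph (k+2) → (Fin (k+1) → ℝ) := fun ω i => (ω : Euc (k+2)) i.castSucc
  let box : Set (Fin (k+1) → ℝ) := Set.pi univ (Fin.cons (Ioc s t) (fun _ => Icc (-δ) δ) : Fin (k+1) → Set ℝ)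
  have hvol : volume box = ENNReal.ofReal ((2*δ)^k * (t - s)) := by
    rw [volume_pi_pi, Fin.prod_univ_succ]
    simp only [Fin.cons_zero, Fin.cons_succ, Real.volume_Ioc, Real.volume_Icc, Finset.prod_const, Finset.card_univ, Fintype.card_fin]
    rw [mul_comm, ENNReal.ofReal_mul (by positivity), ENNReal.ofReal_pow (by positivity)]
    congr 3; ring
  have hdim : (((k+2 : ℕ) : ℝ) - 1) = (Fintype.card (Fin (k+1)) : ℝ) := by simp; ring
  have hlip := haus_image_le (f := f) (s := S) (K := 1) (d := ((k+2 : ℕ) : ℝ) - 1) (dim_nonneg (by omega)) (by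
    intro x _ y _
    rw [NNReal.coe_one, one_mul]
    rw [dist_pi_le_iff dist_nonneg]
    intro i
    rw [Subtype.dist_eq, dist_eq_norm, dist_eq_norm]
    exact PiLp.norm_apply_le ((x : Euc (k+2)) - (y : Euc (k+2))) i.castSucc)
  have himg : box ⊆ f '' S := by
    intro w hw
    have h0 := hw 0 (mem_univ _)
    rw [Fin.cons_zero] at h0
    have hj : ∀ j : Fin k, w j.succ ∈ Icc (-δ) δ := by
      intro j
      have := hw j.succ (mem_univ _)
      rwa [Fin.cons_succ] at this
    have hsum : ∑ i, (w i)^2 ≤ 1 := by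
      rw [Fin.sum_univ_succ]
      have h1 : ∑ j : Fin k, (w j.succ)^2 ≤ ∑ j : Fin k, δ^2 := by
        refine Finset.sum_le_sum fun j _ => ?_
        have := hj j
        exact sq_le_sq' this.1 this.2
      rw [Finset.sum_const, Finset.card_univ, Fintype.card_fin, nsmul_eq_mul] at h1
      have h2 : (w 0)^2 ≤ (1-ε)^2 := sq_le_sq' (by linarith [h0.1]) (by linarith [h0.2])
      nlinarith
    let ω : Euc (k+2) := WithLp.toLp 2 (Fin.snoc w (Real.sqrt (1 - ∑ i, (w i)^2)) : Fin (k+2) → ℝ)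
    have hω : ω ∈ sphere (0 : Euc (k+2)) 1 := by
      rw [mem_sphere_zero_iff_norm, EuclideanSpace.norm_eq, Real.sqrt_eq_one, Fin.sum_univ_castSucc]
      simp only [ω, Fin.snoc_castSucc, Fin.snoc_last, Real.norm_eq_abs, sq_abs]
      rw [Real.sq_sqrt (by linarith)]; ring
    have hin : ⟪(⟨ω, hω⟩ : Sph (k+2)).1, e1 (k+2) (by omega)⟫ = w 0 := by
      rw [e1, EuclideanSpace.inner_single_right]
      simp only [ω, map_one, one_mul]
      exact Fin.snoc_castSucc (α := fun _ => ℝ) (Real.sqrt (1 - ∑ i, (w i)^2)) w 0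
    refine ⟨⟨ω, hω⟩, ⟨?_, ?_⟩, ?_⟩
    · show s < _
      rw [hin]; exact h0.1
    · show ¬ (t < _)
      rw [hin]; exact not_lt.2 h0.2
    · funext i
      exact Fin.snoc_castSucc (α := fun _ => ℝ) _ w i
  rw [← hvol]
  rw [hdim] at hlip
  rw [hausdorffMeasure_pi_real] at hlip
  simp only [ENNReal.coe_one, ENNReal.one_rpow, one_mul] at hlip
  refine (measure_mono himg).trans (hlip.trans (le_of_eq ?_))
  rw [sig, hdim]

noncomputable def clampR (ε t : ℝ) : ℝ := max (-(1-ε)) (min t (1-ε))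

theorem clamp_bound {n : ℕ} (hn : 2 ≤ n) {ε : ℝ} (hε : 0 < ε) (hε1 : ε < 1) : ∃ c : ℝ, 0 < c ∧ ∀ s t : ℝ,
    c * |clampR ε s - clampR ε t| ≤ |(sig n (capS n (e1 n (pos_of_two hn)) s)).toReal - (sig n (capS n (e1 n (pos_of_two hn)) t)).toReal| := by
  obtain ⟨k, rfl⟩ : ∃ k, n = k + 2 := ⟨n - 2, by omega⟩
  obtain ⟨c, hc, h⟩ := band_lower (k := k) hε hε1
  have hfin := sig_finite (n := k+2) (by omega)
  refine ⟨c, hc, ?_⟩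
  have main : ∀ s t : ℝ, s ≤ t → c * |clampR ε s - clampR ε t| ≤ |(sig (k+2) (capS (k+2) (e1 (k+2) (by omega)) s)).toReal - (sig (k+2) (capS (k+2) (e1 (k+2) (by omega)) t)).toReal| := by
    intro s t hst
    have hcl : clampR ε s ≤ clampR ε t := by unfold clampR; gcongr
    rcases eq_or_lt_of_le hcl with heq | hlt
    · rw [heq, sub_self, abs_zero, mul_zero]; exact abs_nonneg _
    have l1 : -(1-ε) ≤ clampR ε s := le_max_left _ _
    have l2 : clampR ε t ≤ 1 - ε := max_le (by linarith) (min_le_right _ _)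
    have l3 : s ≤ clampR ε s := by
      unfold clampR at *
      rcases le_total s (1-ε) with h1 | h1
      · rw [min_eq_left h1]; exact le_max_right _ _
      · exfalso
        rw [min_eq_right h1, min_eq_right (h1.trans hst)] at hlt
        exact lt_irrefl _ hlt
    have l4 : clampR ε t ≤ t := by
      unfold clampR at *
      rcases le_total (-(1-ε)) t with h1 | h1
      · exact max_le h1 (min_le_left _ _)
      · exfalso
        have e1 : min t (1-ε) ≤ -(1-ε) := (min_le_left _ _).trans h1
        have e2 : min s (1-ε) ≤ -(1-ε) := (min_le_left _ _).trans (hst.trans h1)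
        rw [max_eq_left e1, max_eq_left e2] at hlt
        exact lt_irrefl _ hlt
    have hb := h _ _ l1 hcl l2
    set A := capS (k+2) (e1 (k+2) (by omega)) s with hA
    set B := capS (k+2) (e1 (k+2) (by omega)) t with hB
    have hBA : B ⊆ A := fun ω (hω : t < _) => (lt_of_le_of_lt hst hω : s < _)
    have hsub : capS (k+2) (e1 (k+2) (by omega)) (clampR ε s) \ capS (k+2) (e1 (k+2) (by omega)) (clampR ε t) ⊆ A \ B := by
      rintro ω ⟨h1, h2⟩
      exact ⟨lt_of_le_of_lt l3 h1, fun h3 => h2 (lt_of_le_of_lt l4 h3)⟩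
    have hd : (sig (k+2) (A \ B)).toReal = (sig (k+2) A).toReal - (sig (k+2) B).toReal := by
      rw [measure_diff hBA (measurableSet_capS _ _ _).nullMeasurableSet (measure_ne_top _ _), ENNReal.toReal_sub_of_le (measure_mono hBA) (measure_ne_top _ _)]
    rw [← hd, abs_sub_comm, abs_of_nonneg (by linarith), abs_of_nonneg ENNReal.toReal_nonneg]
    exact (ENNReal.ofReal_le_iff_le_toReal (measure_ne_top _ _)).1 (hb.trans (measure_mono hsub))
  intro s t
  rcases le_total s t with h1 | h1
  · exact main s t h1
  · rw [abs_sub_comm (clampR ε s), abs_sub_comm (sig _ _).toReal]; exact main t s h1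

end SecA10

section SecA11
open MeasureTheory Metric Set Filter
open scoped ENNReal NNReal Topology RealInnerProductSpace Pointwise
set_option linter.all false
set_option linter.deprecated false

theorem cone_core {η c τr τz p q q' w m : ℝ} (hη : 0 < η) (hc : 0 < c) (hτ : 0 ≤ τr)
    (hp : |p - τr * w| ≤ η * |w|) (hq : |q' - τz * w| ≤ η * |w|) (hpw : 0 ≤ p * w)
    (hf : c * (|p| + |q|) < τz * p - τr * q) (hm : ((|τz| + τr) / c + 1) * η < m)
    (hmm : (0 < τr ∧ m = τr) ∨ (τr = 0 ∧ m = |τz|)) : q < q' := by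
  by_contra hqq
  have hqq : q' ≤ q := not_lt.1 hqq
  set T := |τz| + τr with hT
  have hT0 : 0 ≤ T := by positivity
  have h1 : τz * p - τr * q ≤ T * η * |w| := by
    have e1 : τz * (p - τr * w) ≤ |τz| * (η * |w|) := by
      calc _ ≤ |τz * (p - τr * w)| := le_abs_self _
        _ = |τz| * |p - τr * w| := abs_mul _ _
        _ ≤ _ := by gcongr
    have e2 : -(τr * (q' - τz * w)) ≤ τr * (η * |w|) := by
      have := (abs_le.1 hq).1
      nlinarith
    have e3 : τr * q' ≤ τr * q := mul_le_mul_of_nonneg_left hqq hτ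
    rw [hT]; nlinarith
  have h2 : c * (|p| + |q|) < T * η * |w| := hf.trans_le h1
  have hw : 0 < |w| := by
    by_contra h
    have : |w| = 0 := le_antisymm (not_lt.1 h) (abs_nonneg _)
    rw [this, mul_zero] at h2
    have : 0 ≤ c * (|p| + |q|) := by positivity
    linarith
  have h3 : |p| + |q| < T / c * η * |w| := by
    have : T / c * η * |w| = (T * η * |w|) / c := by ring
    rw [this, lt_div_iff₀ hc]; linarith
  have hp0 := abs_nonneg p
  have hq0 := abs_nonneg q
  rcases hmm with ⟨ht, hmm⟩ | ⟨ht, hmm⟩ <;> rw [hmm] at hm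
  · have h4 : τr * |w| ≤ |p| + η * |w| := by
      calc τr * |w| = |τr * w| := by rw [abs_mul, abs_of_pos ht]
        _ = |p - (p - τr * w)| := by congr 1; ring
        _ ≤ |p| + |p - τr * w| := abs_sub _ _
        _ ≤ _ := by linarith
    have h5 : ((T / c + 1) * η) * |w| < τr * |w| := mul_lt_mul_of_pos_right hm hw
    nlinarith
  · subst ht
    have h6 : 0 < τz * p := by
      have : 0 ≤ c * (|p| + |q|) := by positivity
      linarith
    have h7 : 0 ≤ τz * w := by
      by_contra hneg
      have hneg : τz * w < 0 := not_le.1 hneg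
      have hp1 : p ≠ 0 := by rintro rfl; simp at h6
      have hw1 : w ≠ 0 := abs_pos.1 hw
      have : 0 < p * w := lt_of_le_of_ne hpw (mul_ne_zero hp1 hw1).symm
      have h8 : (τz * p) * (τz * w) < 0 := mul_neg_of_pos_of_neg h6 hneg
      have h9 : (τz * p) * (τz * w) = τz^2 * (p * w) := by ring
      rw [h9] at h8
      have : 0 ≤ τz^2 * (p * w) := by positivity
      linarith
    have h8 : τz * w = |τz| * |w| := by rw [← abs_mul, abs_of_nonneg h7]
    have h9 := (abs_le.1 hq).1
    have h10 : q ≤ |q| := le_abs_self _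
    have h5 : ((T / c + 1) * η) * |w| < |τz| * |w| := mul_lt_mul_of_pos_right hm hw
    nlinarith

theorem exists_curve {R1 : Set ℝ} {M h : ℝ → ℝ} (hM : ∀ a b, a ≤ b → b - a ≤ M b - M a)
    (hh : ∀ a ∈ R1, ∀ b ∈ R1, a ≤ b → |h b - h a| ≤ M b - M a) :
    ∃ ρ ζ : ℝ → ℝ, LipschitzWith 1 ρ ∧ LipschitzWith 1 ζ ∧ ∀ s ∈ R1, ρ (M s) = s ∧ ζ (M s) = h s := by
  have hinj : Function.Injective M := by
    have : StrictMono M := fun a b hab => by linarith [hM a b hab.le]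
    exact this.injective
  have hab : ∀ a b, |a - b| ≤ |M a - M b| := by
    intro a b
    rcases le_total a b with h1 | h1
    · rw [abs_sub_comm, abs_sub_comm (M a), abs_of_nonneg (by linarith), abs_of_nonneg (by linarith [hM a b h1])]; exact hM a b h1
    · rw [abs_of_nonneg (by linarith), abs_of_nonneg (by linarith [hM b a h1])]; exact hM b a h1
  have hhab : ∀ a ∈ R1, ∀ b ∈ R1, |h a - h b| ≤ |M a - M b| := by
    intro a ha b hb
    rcases le_total a b with h1 | h1
    · rw [abs_sub_comm, abs_sub_comm (M a)]; exact (hh a ha b hb h1).trans (le_abs_self _)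
    · exact (hh b hb a ha h1).trans (le_abs_self _)
  have hl := Function.leftInverse_invFun hinj
  have l1 : LipschitzOnWith 1 (Function.invFun M) (M '' R1) := by
    apply LipschitzOnWith.of_dist_le_mul
    rintro _ ⟨a, ha, rfl⟩ _ ⟨b, hb, rfl⟩
    rw [hl a, hl b, NNReal.coe_one, one_mul, Real.dist_eq, Real.dist_eq]; exact hab a b
  have l2 : LipschitzOnWith 1 (fun u => h (Function.invFun M u)) (M '' R1) := by
    apply LipschitzOnWith.of_dist_le_mul
    rintro _ ⟨a, ha, rfl⟩ _ ⟨b, hb, rfl⟩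
    rw [hl a, hl b, NNReal.coe_one, one_mul, Real.dist_eq, Real.dist_eq]; exact hhab a ha b hb
  obtain ⟨ρ, h1, h2⟩ := l1.extend_real
  obtain ⟨ζ, h3, h4⟩ := l2.extend_real
  refine ⟨ρ, ζ, h1, h3, fun s hs => ⟨?_, ?_⟩⟩
  · rw [← h2 (mem_image_of_mem M hs), hl s]
  · rw [← h4 (mem_image_of_mem M hs)]; simp only [hl s]

theorem curve_left {R1 : Set ℝ} {M h ρ ζ : ℝ → ℝ} {a0 r : ℝ} (hM : Monotone M)
    (hρ : LipschitzWith 1 ρ) (hζ : LipschitzWith 1 ζ) (hc : ∀ s ∈ R1, ρ (M s) = s ∧ ζ (M s) = h s)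
    (hd : ∀ a b, a0 ≤ a → a < b → ∃ s ∈ R1, a < s ∧ s < b) (hr : a0 < r) :
    ρ (Function.leftLim M r) = r ∧ ∀ η, 0 < η → ∃ δ, 0 < δ ∧ ∀ s ∈ R1, r - δ < s → s < r → |h s - ζ (Function.leftLim M r)| < η := by
  set l := Function.leftLim M r
  have ht := hM.tendsto_leftLim r
  have hlim : ∀ η, 0 < η → ∃ δ, 0 < δ ∧ ∀ s, r - δ < s → s < r → |M s - l| < η := by
    intro η hη
    have h1 := ht (Metric.ball_mem_nhds l hη)
    rw [mem_map, Metric.mem_nhdsWithin_iff] at h1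
    obtain ⟨δ, hδ, h2⟩ := h1
    refine ⟨δ, hδ, fun s h3 h4 => ?_⟩
    have := h2 ⟨by rw [mem_ball, Real.dist_eq, abs_lt]; constructor <;> linarith, h4⟩
    rwa [mem_preimage, mem_ball, Real.dist_eq] at this
  constructor
  · by_contra hne
    have hpos : 0 < |ρ l - r| := abs_pos.2 (sub_ne_zero.2 hne)
    obtain ⟨δ, hδ, h1⟩ := hlim (|ρ l - r| / 2) (by linarith)
    obtain ⟨s, hs, h2, h3⟩ := hd (max a0 (max (r - δ) (r - |ρ l - r| / 2))) r (le_max_left _ _) (by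
      refine max_lt hr (max_lt ?_ ?_) <;> linarith)
    have h4 : r - δ < s := ((le_max_left _ _).trans (le_max_right _ _)).trans_lt h2
    have h5 : r - |ρ l - r| / 2 < s := ((le_max_right _ _).trans (le_max_right _ _)).trans_lt h2
    have h6 := h1 s h4 h3
    have h7 := hρ.dist_le_mul (M s) l
    rw [(hc s hs).1, NNReal.coe_one, one_mul, Real.dist_eq, Real.dist_eq] at h7
    have h8 : |ρ l - r| ≤ |s - ρ l| + |s - r| := by
      rw [show ρ l - r = (s - r) - (s - ρ l) by ring]; linarith [abs_sub (s - r) (s - ρ l)]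
    rw [abs_of_neg (show s - r < 0 by linarith)] at h8
    linarith
  · intro η hη
    obtain ⟨δ, hδ, h1⟩ := hlim η hη
    refine ⟨δ, hδ, fun s hs h2 h3 => ?_⟩
    have h7 := hζ.dist_le_mul (M s) l
    rw [(hc s hs).2, NNReal.coe_one, one_mul, Real.dist_eq, Real.dist_eq] at h7
    exact h7.trans_lt (h1 s h2 h3)

theorem curve_right {R1 : Set ℝ} {M h ρ ζ : ℝ → ℝ} {a0 r : ℝ} (hM : Monotone M)
    (hρ : LipschitzWith 1 ρ) (hζ : LipschitzWith 1 ζ) (hc : ∀ s ∈ R1, ρ (M s) = s ∧ ζ (M s) = h s)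
    (hd : ∀ a b, a0 ≤ a → a < b → ∃ s ∈ R1, a < s ∧ s < b) (hr : a0 < r) :
    ρ (Function.rightLim M r) = r ∧ ∀ η, 0 < η → ∃ δ, 0 < δ ∧ ∀ s ∈ R1, r < s → s < r + δ → |h s - ζ (Function.rightLim M r)| < η := by
  set l := Function.rightLim M r
  have ht := hM.tendsto_rightLim r
  have hlim : ∀ η, 0 < η → ∃ δ, 0 < δ ∧ ∀ s, r < s → s < r + δ → |M s - l| < η := by
    intro η hη
    have h1 := ht (Metric.ball_mem_nhds l hη)
    rw [mem_map, Metric.mem_nhdsWithin_iff] at h1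
    obtain ⟨δ, hδ, h2⟩ := h1
    refine ⟨δ, hδ, fun s h3 h4 => ?_⟩
    have := h2 ⟨by rw [mem_ball, Real.dist_eq, abs_lt]; constructor <;> linarith, h3⟩
    rwa [mem_preimage, mem_ball, Real.dist_eq] at this
  constructor
  · by_contra hne
    have hpos : 0 < |ρ l - r| := abs_pos.2 (sub_ne_zero.2 hne)
    obtain ⟨δ, hδ, h1⟩ := hlim (|ρ l - r| / 2) (by linarith)
    obtain ⟨s, hs, h2, h3⟩ := hd r (min (r + δ) (r + |ρ l - r| / 2)) hr.le (by
      refine lt_min ?_ ?_ <;> linarith)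
    have h4 : s < r + δ := h3.trans_le (min_le_left _ _)
    have h5 : s < r + |ρ l - r| / 2 := h3.trans_le (min_le_right _ _)
    have h6 := h1 s h2 h4
    have h7 := hρ.dist_le_mul (M s) l
    rw [(hc s hs).1, NNReal.coe_one, one_mul, Real.dist_eq, Real.dist_eq] at h7
    have h8 : |ρ l - r| ≤ |s - ρ l| + |s - r| := by
      rw [show ρ l - r = (s - r) - (s - ρ l) by ring]; linarith [abs_sub (s - r) (s - ρ l)]
    rw [abs_of_pos (show 0 < s - r by linarith)] at h8
    linarith
  · intro η hη
    obtain ⟨δ, hδ, h1⟩ := hlim η hη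
    refine ⟨δ, hδ, fun s hs h2 h3 => ?_⟩
    have h7 := hζ.dist_le_mul (M s) l
    rw [(hc s hs).2, NNReal.coe_one, one_mul, Real.dist_eq, Real.dist_eq] at h7
    exact h7.trans_lt (h1 s h2 h3)

section grad
variable {n : ℕ}

theorem hasFDerivAt_norm' {x : Euc n} (hx : x ≠ 0) : HasFDerivAt (fun y : Euc n => ‖y‖) (‖x‖⁻¹ • innerSL ℝ x) x := by
  have h1 := (hasStrictFDerivAt_norm_sq x).hasFDerivAt
  have h2 := h1.sqrt (by positivity)
  have h3 : (fun y : Euc n => √(‖y‖ ^ 2)) = fun y => ‖y‖ := by funext y; exact Real.sqrt_sq (norm_nonneg y)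
  rw [h3, Real.sqrt_sq (norm_nonneg x)] at h2
  refine h2.congr_fderiv (ContinuousLinearMap.ext fun y => ?_)
  have : ‖x‖ ≠ 0 := norm_ne_zero_iff.2 hx
  simp only [ContinuousLinearMap.smul_apply, innerSL_apply_apply, smul_eq_mul, nsmul_eq_mul]
  push_cast
  field_simp

theorem hasFDerivAt_hat {x e : Euc n} (hx : x ≠ 0) : HasFDerivAt (fun y : Euc n => ⟪hatv y, e⟫)
    (‖x‖⁻¹ • (innerSL ℝ e) - (⟪x, e⟫ * (‖x‖^3)⁻¹) • innerSL ℝ x) x := by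
  have h1 := hasFDerivAt_norm' hx
  have h2 := (hasDerivAt_inv (norm_ne_zero_iff.2 hx)).comp_hasFDerivAt x h1
  have h3 : HasFDerivAt (fun y : Euc n => ⟪e, y⟫) (innerSL ℝ e) x := (innerSL ℝ e).hasFDerivAt
  have h4 := h2.mul h3
  have h5 : (fun y : Euc n => ⟪hatv y, e⟫) = (Inv.inv ∘ fun y : Euc n => ‖y‖) * (fun y : Euc n => ⟪e, y⟫) := by
    funext y
    simp [hatv, inner_smul_left, real_inner_comm]
  rw [h5]
  refine h4.congr_fderiv (ContinuousLinearMap.ext fun y => ?_)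
  have : ‖x‖ ≠ 0 := norm_ne_zero_iff.2 hx
  simp only [ContinuousLinearMap.smul_apply, ContinuousLinearMap.sub_apply, ContinuousLinearMap.add_apply, innerSL_apply_apply, smul_eq_mul, Function.comp_apply, real_inner_comm x e]
  field_simp
  ring

/-- planar gradient -/
theorem planar_grad {x e : Euc n} (hx : x ≠ 0) (he : ‖e‖ = 1) (hz : |⟪hatv x, e⟫| < 1) {τr τz : ℝ} (hτ : τr ≠ 0 ∨ τz ≠ 0) :
    ∃ ν : Euc n, ν ≠ 0 ∧ ∀ ε, 0 < ε → ∃ δ, 0 < δ ∧ ∀ y, ‖y - x‖ < δ →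
      |(τz * (‖y‖ - ‖x‖) - τr * (⟪hatv y, e⟫ - ⟪hatv x, e⟫)) - ⟪y - x, ν⟫| ≤ ε * ‖y - x‖ := by
  set r := ‖x‖ with hr
  have hr0 : r ≠ 0 := norm_ne_zero_iff.2 hx
  have hd := ((hasFDerivAt_norm' hx).const_mul τz).sub ((hasFDerivAt_hat (e := e) hx).const_mul τr)
  rw [← hr] at hd
  set ν : Euc n := (τz * r⁻¹) • x - τr • (r⁻¹ • e - (⟪x, e⟫ * (r^3)⁻¹) • x) with hν
  refine ⟨ν, ?_, fun ε hε => ?_⟩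
  · intro h0
    have hxx : ⟪x, x⟫ = r^2 := real_inner_self_eq_norm_sq x
    have hee : ⟪e, e⟫ = 1 := by rw [real_inner_self_eq_norm_sq, he]; norm_num
    have i1 : ⟪ν, x⟫ = τz * r := by
      rw [hν]
      simp only [inner_sub_left, inner_smul_left, hxx, RCLike.conj_to_real, real_inner_comm x e]
      field_simp
      ring
    rw [h0, inner_zero_left] at i1
    have hz0 : τz = 0 := by
      rcases mul_eq_zero.1 i1.symm with h | h
      · exact h
      · exact absurd h hr0
    have hr1 : τr ≠ 0 := by
      rcases hτ with h | h
      · exact h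
      · exact absurd hz0 h
    have i2 : ⟪ν, e⟫ = - τr * r⁻¹ * (1 - ⟪hatv x, e⟫^2) := by
      rw [hν, hz0]
      simp only [hatv, inner_sub_left, inner_smul_left, hee, RCLike.conj_to_real, ← hr]
      field_simp
      ring
    rw [h0, inner_zero_left] at i2
    have hz1 : 0 < 1 - ⟪hatv x, e⟫^2 := by
      have := (sq_lt_one_iff_abs_lt_one _).2 hz; linarith
    have : - τr * r⁻¹ * (1 - ⟪hatv x, e⟫^2) ≠ 0 := mul_ne_zero (mul_ne_zero (neg_ne_zero.2 hr1) (inv_ne_zero hr0)) hz1.ne'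
    exact this i2.symm
  · obtain ⟨δ, hδ, hb⟩ := Metric.eventually_nhds_iff.1 (hd.isLittleO.def hε)
    refine ⟨δ, hδ, fun y hy => ?_⟩
    have := hb (y := y) (by rw [dist_eq_norm]; exact hy)
    rw [Real.norm_eq_abs] at this
    convert this using 2
    have e1 : ⟪y - x, ν⟫ = (τz • r⁻¹ • innerSL ℝ x - τr • (r⁻¹ • innerSL ℝ e - (⟪x, e⟫ * (r^3)⁻¹) • innerSL ℝ x)) (y - x) := by
      rw [real_inner_comm, hν]
      simp only [ContinuousLinearMap.sub_apply, ContinuousLinearMap.smul_apply, innerSL_apply_apply, smul_eq_mul, inner_sub_left, inner_smul_left, RCLike.conj_to_real]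
      ring
    rw [e1]
    simp only [Pi.sub_apply, hr]
    ring
end grad

end SecA11

section SecA12
open MeasureTheory Metric Set Filter
open scoped ENNReal NNReal Topology RealInnerProductSpace Pointwise
set_option linter.all false
set_option linter.deprecated false

section planar
variable {n : ℕ}

theorem hat_lip {e x y : Euc n} (he : ‖e‖ = 1) {a : ℝ} (ha : 0 < a) (hx : a ≤ ‖x‖) (hy : a ≤ ‖y‖) :
    |⟪hatv y, e⟫ - ⟪hatv x, e⟫| ≤ (2 / a) * ‖y - x‖ := by
  rw [← inner_sub_left]
  calc _ ≤ ‖hatv y - hatv x‖ * ‖e‖ := abs_real_inner_le_norm _ _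
    _ ≤ _ := by rw [he, mul_one]; exact norm_hatv_sub_le ha hy hx

theorem near_pt {e x : Euc n} (he : ‖e‖ = 1) {a0 κ : ℝ} (ha : 0 < a0) (hx : a0 < ‖x‖) (hz : |⟪hatv x, e⟫| < κ)
    {η : ℝ} (hη : 0 < η) : ∃ δ, 0 < δ ∧ ∀ y, ‖y - x‖ < δ → a0 < ‖y‖ ∧ |⟪hatv y, e⟫| < κ ∧ |⟪hatv y, e⟫ - ⟪hatv x, e⟫| < η ∧
      |‖y‖ - ‖x‖| < η := by
  set η' := min η (min (‖x‖ - a0) ((κ - |⟪hatv x, e⟫|))) with hη'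
  have hη0 : 0 < η' := lt_min hη (lt_min (by linarith) (by linarith))
  refine ⟨η' / (1 + 2 / a0), by positivity, fun y hy => ?_⟩
  rw [lt_div_iff₀ (by positivity)] at hy
  have hd := norm_nonneg (y - x)
  have h2a : 0 < 2 / a0 := by positivity
  have h1 : ‖y - x‖ < η' := by nlinarith
  have h2 : |‖y‖ - ‖x‖| ≤ ‖y - x‖ := abs_norm_sub_norm_le y x
  have h3 : a0 < ‖y‖ := by
    have := (abs_le.1 h2).1
    have : η' ≤ ‖x‖ - a0 := (min_le_right _ _).trans (min_le_left _ _)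
    linarith
  have h4 := hat_lip he ha hx.le h3.le
  have h5 : |⟪hatv y, e⟫ - ⟪hatv x, e⟫| < η' := by nlinarith
  have h6 : η' ≤ κ - |⟪hatv x, e⟫| := (min_le_right _ _).trans (min_le_right _ _)
  have h7 : |⟪hatv y, e⟫| - |⟪hatv x, e⟫| ≤ |⟪hatv y, e⟫ - ⟪hatv x, e⟫| := abs_sub_abs_le_abs_sub _ _
  exact ⟨h3, by linarith, h5.trans_le (min_le_left _ _), (h2.trans_lt h1).trans_le (min_le_left _ _)⟩

theorem tan_diff {F N : Set (Euc n)} {e x : Euc n} {R1 : Set ℝ} {M h ρ ζ : ℝ → ℝ} {a0 κ : ℝ} (ha : 0 < a0) (hκ : κ ≤ 1)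
    (he : ‖e‖ = 1) (hM : ∀ a b, a ≤ b → b - a ≤ M b - M a) (hc : ∀ s ∈ R1, ρ (M s) = s ∧ ζ (M s) = h s)
    (hd : ∀ a b, a0 ≤ a → a < b → ∃ s ∈ R1, a < s ∧ s < b)
    (hF : ∀ y, y ∉ N → a0 < ‖y‖ → |⟪hatv y, e⟫| < κ → ‖y‖ ∈ R1 ∧ (y ∈ F ↔ h ‖y‖ < ⟪hatv y, e⟫))
    (hx : a0 < ‖x‖) (hz : |⟪hatv x, e⟫| < κ) (hMc : ContinuousAt M ‖x‖)
    (hρu : ρ (M ‖x‖) = ‖x‖) (hζu : ζ (M ‖x‖) = ⟪hatv x, e⟫) {τr τz : ℝ} (hτr : HasDerivAt ρ τr (M ‖x‖)) (hτz : HasDerivAt ζ τz (M ‖x‖))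
    (hτ : τr ≠ 0 ∨ τz ≠ 0) : x ∈ Tan F N := by
  set r := ‖x‖ with hr
  set z := ⟪hatv x, e⟫ with hzd
  set u := M r with hu
  have hx0 : x ≠ 0 := norm_pos_iff.1 (ha.trans hx)
  -- joint linearization
  have hlin : ∀ η, 0 < η → ∃ δ, 0 < δ ∧ ∀ s ∈ R1, |s - r| < δ →
      |(s - r) - τr * (M s - u)| ≤ η * |M s - u| ∧ |(h s - z) - τz * (M s - u)| ≤ η * |M s - u| := by
    intro η hη
    obtain ⟨δ, hδ, hb⟩ := Metric.eventually_nhds_iff.1 (((hτr.isLittleO.def hη).and (hτz.isLittleO.def hη)))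
    obtain ⟨δ', hδ', hb'⟩ := Metric.continuousAt_iff.1 hMc δ hδ
    refine ⟨δ', hδ', fun s hs hsr => ?_⟩
    have h1 := hb (hb' (x := s) (by rw [Real.dist_eq]; exact hsr))
    rw [(hc s hs).1, (hc s hs).2, hρu, hζu] at h1
    simp only [smul_eq_mul, Real.norm_eq_abs] at h1
    rw [mul_comm τr, mul_comm τz]
    exact h1
  have hτ0 : 0 ≤ τr := by
    by_contra hneg
    have hneg : τr < 0 := not_le.1 hneg
    obtain ⟨δ, hδ, hb⟩ := hlin (-τr / 2) (by linarith)
    obtain ⟨s, hs, h1, h2⟩ := hd r (r + δ) hx.le (by linarith)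
    have h3 := (hb s hs (by rw [abs_of_pos (by linarith)]; linarith)).1
    have h4 := hM r s h1.le
    rw [abs_of_pos (show 0 < M s - u by linarith)] at h3
    have := (abs_le.1 h3).2
    have : 0 < M s - u := by linarith
    nlinarith
  obtain ⟨ν0, hν0, hgr⟩ := planar_grad (τr := τr) (τz := τz) hx0 he (hz.trans_le hκ) hτ
  have hν0' : 0 < ‖ν0‖ := norm_pos_iff.2 hν0
  refine ⟨‖ν0‖⁻¹ • ν0, by rw [norm_smul, norm_inv, norm_norm, inv_mul_cancel₀ hν0'.ne'], fun ε hε => ?_⟩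
  obtain ⟨δ1, hδ1, hb1⟩ := hgr (ε * ‖ν0‖ / 2) (by positivity)
  set c := ε * ‖ν0‖ / (2 * (1 + 2 / a0)) with hcd
  have hc0 : 0 < c := by positivity
  obtain ⟨m, hm0, hmm⟩ : ∃ m, 0 < m ∧ ((0 < τr ∧ m = τr) ∨ (τr = 0 ∧ m = |τz|)) := by
    rcases hτ0.lt_or_eq with h1 | h1
    · exact ⟨τr, h1, Or.inl ⟨h1, rfl⟩⟩
    · refine ⟨|τz|, abs_pos.2 ?_, Or.inr ⟨h1.symm, rfl⟩⟩
      rcases hτ with h2 | h2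
      · exact absurd h1.symm h2
      · exact h2
  set T := |τz| + τr with hT
  have hT0 : 0 ≤ T := by positivity
  set η := m / (2 * (T / c + 1)) with hη
  have hη0 : 0 < η := by positivity
  have hηm : (T / c + 1) * η < m := by
    have : (T / c + 1) * η = m / 2 := by rw [hη]; field_simp
    rw [this]; linarith
  obtain ⟨δ2, hδ2, hb2⟩ := hlin η hη0
  obtain ⟨δ3, hδ3, hb3⟩ := near_pt he ha hx hz hδ2
  refine ⟨min δ1 δ3, lt_min hδ1 hδ3, fun y hyN hy => ?_⟩
  obtain ⟨n1, n2, n3, n4⟩ := hb3 y (hy.trans_le (min_le_right _ _))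
  have hg := hb1 y (hy.trans_le (min_le_left _ _))
  obtain ⟨hs, hyF⟩ := hF y hyN n1 n2
  obtain ⟨l1, l2⟩ := hb2 _ hs n4
  have hpq : c * (|‖y‖ - r| + |⟪hatv y, e⟫ - z|) ≤ ε * ‖ν0‖ / 2 * ‖y - x‖ := by
    have e1 : |‖y‖ - r| ≤ ‖y - x‖ := abs_norm_sub_norm_le y x
    have e2 := hat_lip he ha hx.le n1.le
    calc _ ≤ c * ((1 + 2 / a0) * ‖y - x‖) := by gcongr; linarith
      _ = _ := by rw [hcd]; field_simp
  have hpw : 0 ≤ (‖y‖ - r) * (M ‖y‖ - u) := by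
    rcases le_total r ‖y‖ with h1 | h1
    · exact mul_nonneg (by linarith) (by linarith [hM r _ h1])
    · exact mul_nonneg_of_nonpos_of_nonpos (by linarith) (by linarith [hM _ r h1])
  have hin : ⟪y - x, ‖ν0‖⁻¹ • ν0⟫ * ‖ν0‖ = ⟪y - x, ν0⟫ := by
    rw [inner_smul_right]; field_simp
  have hg' := abs_le.1 hg
  constructor
  · intro h1
    have h2 := mul_lt_mul_of_pos_right h1 hν0'
    rw [hin] at h2
    have h3 := cone_core (q := ⟪hatv y, e⟫ - z) hη0 hc0 hτ0 l1 l2 hpw (by linarith [hg'.1]) hηm hmm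
    rw [hyF, not_lt]; linarith
  · intro h1
    have h2 := mul_lt_mul_of_pos_right h1 hν0'
    rw [hin] at h2
    have h3 := cone_core (q := -(⟪hatv y, e⟫ - z)) (τz := -τz) (q' := -(h ‖y‖ - z)) (m := m) hη0 hc0 hτ0 l1 (by rw [show -(h ‖y‖ - z) - -τz * (M ‖y‖ - u) = -((h ‖y‖ - z) - τz * (M ‖y‖ - u)) by ring, abs_neg]; exact l2) hpw
      (by rw [abs_neg]; linarith [hg'.2]) (by rw [abs_neg]; exact hηm) (by rw [abs_neg]; exact hmm)
    rw [hyF]; linarith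

theorem norm_gt_of_inner {x y : Euc n} (h : 0 < ⟪y - x, hatv x⟫) (hx : x ≠ 0) : ‖x‖ < ‖y‖ := by
  have h0 : 0 < ‖x‖ := norm_pos_iff.2 hx
  have h1 : ⟪x, hatv x⟫ = ‖x‖ := by
    rw [hatv, inner_smul_right, real_inner_self_eq_norm_sq]; field_simp
  have h2 : ⟪y, hatv x⟫ ≤ ‖y‖ := by
    have := real_inner_le_norm y (hatv x)
    rwa [norm_hatv hx, mul_one] at this
  rw [inner_sub_left, h1] at h
  linarith

theorem norm_lt_of_inner {x y : Euc n} {ε : ℝ} (h : ⟪y - x, hatv x⟫ < -(ε * ‖y - x‖)) (hx : x ≠ 0) (hd : ‖y - x‖ < ε * ‖x‖) : ‖y‖ < ‖x‖ := by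
  have h0 : 0 < ‖x‖ := norm_pos_iff.2 hx
  have h1 : ⟪y - x, x⟫ = ‖x‖ * ⟪y - x, hatv x⟫ := by
    rw [hatv, inner_smul_right]; field_simp
  have h2 : ‖y‖^2 = ‖y - x‖^2 + 2 * ⟪y - x, x⟫ + ‖x‖^2 := by
    rw [← norm_add_sq_real]; simp
  have h3 := norm_nonneg (y - x)
  have h4 : 2 * ⟪y - x, x⟫ ≤ -(2 * (ε * ‖x‖) * ‖y - x‖) := by rw [h1]; nlinarith
  have h6 : ‖y - x‖ ≠ 0 := by
    intro h6
    have : y - x = 0 := norm_eq_zero.1 h6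
    rw [this] at h; simp at h
  have h7 : 0 < ‖y - x‖ := lt_of_le_of_ne h3 h6.symm
  have h5 : ‖y‖^2 < ‖x‖^2 := by nlinarith
  exact lt_of_pow_lt_pow_left₀ 2 h0.le h5

noncomputable def badU (M ρ ζ : ℝ → ℝ) : Set ℝ :=
  ({u | ¬ DifferentiableAt ℝ ρ u} ∪ {u | ¬ DifferentiableAt ℝ ζ u}) ∪
    (Function.leftLim M '' {r | ¬ ContinuousAt M r} ∪ Function.rightLim M '' {r | ¬ ContinuousAt M r})

theorem badU_null {M ρ ζ : ℝ → ℝ} (hM : Monotone M) (hρ : LipschitzWith 1 ρ) (hζ : LipschitzWith 1 ζ) : volume (badU M ρ ζ) = 0 := by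
  have hD := hM.countable_not_continuousAt
  refine measure_union_null (measure_union_null hρ.ae_differentiableAt hζ.ae_differentiableAt) (measure_union_null ?_ ?_)
  · exact (hD.image _).measure_zero _
  · exact (hD.image _).measure_zero _

theorem planar_point {F N : Set (Euc n)} {e x : Euc n} {R1 : Set ℝ} {M h ρ ζ : ℝ → ℝ} {a0 κ : ℝ} (ha : 0 < a0) (hκ : κ ≤ 1)
    (he : ‖e‖ = 1) (hM : ∀ a b, a ≤ b → b - a ≤ M b - M a) (hρ : LipschitzWith 1 ρ) (hζ : LipschitzWith 1 ζ)
    (hc : ∀ s ∈ R1, ρ (M s) = s ∧ ζ (M s) = h s)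
    (hd : ∀ a b, a0 ≤ a → a < b → ∃ s ∈ R1, a < s ∧ s < b) (hN : volume N = 0)
    (hF : ∀ y, y ∉ N → a0 < ‖y‖ → |⟪hatv y, e⟫| < κ → ‖y‖ ∈ R1 ∧ (y ∈ F ↔ h ‖y‖ < ⟪hatv y, e⟫))
    (hx : a0 < ‖x‖) (hz : |⟪hatv x, e⟫| < κ) :
    x ∈ Tan F N ∨ DZ volume n F x ∨ DZ volume n Fᶜ x ∨
      ∃ u, (u ∈ badU M ρ ζ ∨ (HasDerivAt ρ 0 u ∧ HasDerivAt ζ 0 u)) ∧ ρ u = ‖x‖ ∧ ζ u = ⟪hatv x, e⟫ := by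
  have hmono : Monotone M := fun a b hab => by linarith [hM a b hab]
  obtain ⟨hl, hl'⟩ := curve_left hmono hρ hζ hc hd hx
  obtain ⟨hq, hq'⟩ := curve_right hmono hρ hζ hc hd hx
  set r := ‖x‖ with hr
  set z := ⟪hatv x, e⟫ with hzd
  set l := Function.leftLim M r with hld
  set q := Function.rightLim M r with hqd
  have hx0 : x ≠ 0 := norm_pos_iff.1 (ha.trans hx)
  have hae : ∀ᵐ y ∂(volume : Measure (Euc n)), y ∉ N ∧ ‖y‖ ≠ r := by
    have h1 : ∀ᵐ y ∂(volume : Measure (Euc n)), y ∉ N := by rwa [ae_iff, show {y | ¬ y ∉ N} = N by ext; simp]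
    have h2 : ∀ᵐ y ∂(volume : Measure (Euc n)), ‖y‖ ≠ r := by
      rw [ae_iff]
      have := Measure.addHaar_sphere_of_ne_zero (volume : Measure (Euc n)) 0 (ha.trans hx).ne'
      convert this using 2
      ext y; simp [hr]
    exact h1.and h2
  by_cases hA : ζ l < z ∧ ζ q < z
  · right; right; left
    obtain ⟨δ1, hδ1, hb1⟩ := hl' ((z - ζ l)/2) (by linarith [hA.1])
    obtain ⟨δ2, hδ2, hb2⟩ := hq' ((z - ζ q)/2) (by linarith [hA.2])
    obtain ⟨δ, hδ, hb⟩ := near_pt he ha hx hz (η := min (min δ1 δ2) (min ((z - ζ l)/2) ((z - ζ q)/2)))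
      (lt_min (lt_min hδ1 hδ2) (lt_min (by linarith [hA.1]) (by linarith [hA.2])))
    refine DZ.of_empty_loc hδ ?_
    filter_upwards [hae] with y hy hyb hyF
    obtain ⟨n1, n2, n3, n4⟩ := hb y (by rwa [mem_ball, dist_eq_norm] at hyb)
    simp only [lt_min_iff] at n3 n4
    obtain ⟨hs, hiff⟩ := hF y hy.1 n1 n2
    apply hyF
    rw [hiff]
    have m3 := (abs_lt.1 n3.2.1).1
    have m4 := (abs_lt.1 n3.2.2).1
    have m5 := abs_lt.1 n4.1.1
    have m6 := abs_lt.1 n4.1.2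
    rcases lt_or_gt_of_ne hy.2 with h1 | h1
    · have := abs_lt.1 (hb1 _ hs (by linarith) h1)
      linarith
    · have := abs_lt.1 (hb2 _ hs h1 (by linarith))
      linarith
  by_cases hB : z < ζ l ∧ z < ζ q
  · right; left
    obtain ⟨δ1, hδ1, hb1⟩ := hl' ((ζ l - z)/2) (by linarith [hB.1])
    obtain ⟨δ2, hδ2, hb2⟩ := hq' ((ζ q - z)/2) (by linarith [hB.2])
    obtain ⟨δ, hδ, hb⟩ := near_pt he ha hx hz (η := min (min δ1 δ2) (min ((ζ l - z)/2) ((ζ q - z)/2)))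
      (lt_min (lt_min hδ1 hδ2) (lt_min (by linarith [hB.1]) (by linarith [hB.2])))
    refine DZ.of_empty_loc hδ ?_
    filter_upwards [hae] with y hy hyb hyF
    obtain ⟨n1, n2, n3, n4⟩ := hb y (by rwa [mem_ball, dist_eq_norm] at hyb)
    simp only [lt_min_iff] at n3 n4
    obtain ⟨hs, hiff⟩ := hF y hy.1 n1 n2
    rw [hiff] at hyF
    have m3 := (abs_lt.1 n3.2.1).2
    have m4 := (abs_lt.1 n3.2.2).2
    have m5 := abs_lt.1 n4.1.1
    have m6 := abs_lt.1 n4.1.2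
    rcases lt_or_gt_of_ne hy.2 with h1 | h1
    · have := abs_lt.1 (hb1 _ hs (by linarith) h1)
      linarith
    · have := abs_lt.1 (hb2 _ hs h1 (by linarith))
      linarith
  by_cases hC : ζ l < z ∧ z < ζ q
  · left
    refine ⟨hatv x, norm_hatv hx0, fun ε hε => ?_⟩
    obtain ⟨δ1, hδ1, hb1⟩ := hl' ((z - ζ l)/2) (by linarith [hC.1])
    obtain ⟨δ2, hδ2, hb2⟩ := hq' ((ζ q - z)/2) (by linarith [hC.2])
    obtain ⟨δ, hδ, hb⟩ := near_pt he ha hx hz (η := min (min δ1 δ2) (min ((z - ζ l)/2) ((ζ q - z)/2)))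
      (lt_min (lt_min hδ1 hδ2) (lt_min (by linarith [hC.1]) (by linarith [hC.2])))
    have hr0 : 0 < ε * r := mul_pos hε (ha.trans hx)
    refine ⟨min δ (ε * r), lt_min hδ hr0, fun y hyN hyb => ?_⟩
    obtain ⟨n1, n2, n3, n4⟩ := hb y (hyb.trans_le (min_le_left _ _))
    simp only [lt_min_iff] at n3 n4
    obtain ⟨hs, hiff⟩ := hF y hyN n1 n2
    have m3 := (abs_lt.1 n3.2.1)
    have m4 := (abs_lt.1 n3.2.2)
    have m5 := abs_lt.1 n4.1.1
    have m6 := abs_lt.1 n4.1.2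
    constructor
    · intro h1
      have h2 := norm_gt_of_inner (lt_of_le_of_lt (by positivity) h1) hx0
      have := abs_lt.1 (hb2 _ hs h2 (by linarith))
      rw [hiff, not_lt]; linarith
    · intro h1
      have h2 := norm_lt_of_inner h1 hx0 (hyb.trans_le (min_le_right _ _))
      have := abs_lt.1 (hb1 _ hs (by linarith) h2)
      rw [hiff]; linarith
  by_cases hD : ζ q < z ∧ z < ζ l
  · left
    refine ⟨-hatv x, by rw [norm_neg]; exact norm_hatv hx0, fun ε hε => ?_⟩
    obtain ⟨δ1, hδ1, hb1⟩ := hl' ((ζ l - z)/2) (by linarith [hD.2])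
    obtain ⟨δ2, hδ2, hb2⟩ := hq' ((z - ζ q)/2) (by linarith [hD.1])
    obtain ⟨δ, hδ, hb⟩ := near_pt he ha hx hz (η := min (min δ1 δ2) (min ((ζ l - z)/2) ((z - ζ q)/2)))
      (lt_min (lt_min hδ1 hδ2) (lt_min (by linarith [hD.2]) (by linarith [hD.1])))
    have hr0 : 0 < ε * r := mul_pos hε (ha.trans hx)
    refine ⟨min δ (ε * r), lt_min hδ hr0, fun y hyN hyb => ?_⟩
    obtain ⟨n1, n2, n3, n4⟩ := hb y (hyb.trans_le (min_le_left _ _))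
    simp only [lt_min_iff] at n3 n4
    obtain ⟨hs, hiff⟩ := hF y hyN n1 n2
    have m3 := (abs_lt.1 n3.2.1)
    have m4 := (abs_lt.1 n3.2.2)
    have m5 := abs_lt.1 n4.1.1
    have m6 := abs_lt.1 n4.1.2
    rw [inner_neg_right]
    constructor
    · intro h1
      have h2 := norm_lt_of_inner (by linarith) hx0 (hyb.trans_le (min_le_right _ _))
      have := abs_lt.1 (hb1 _ hs (by linarith) h2)
      rw [hiff, not_lt]; linarith
    · intro h1
      have h2 := norm_gt_of_inner (lt_of_le_of_lt (b := ε * ‖y - x‖) (by positivity) (by linarith)) hx0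
      have := abs_lt.1 (hb2 _ hs h2 (by linarith))
      rw [hiff]; linarith
  have hE : z = ζ l ∨ z = ζ q := by
    by_contra hne
    rw [not_or] at hne
    rcases lt_or_gt_of_ne hne.1 with h1 | h1 <;> rcases lt_or_gt_of_ne hne.2 with h2 | h2
    · exact hB ⟨h1, h2⟩
    · exact hD ⟨h2, h1⟩
    · exact hC ⟨h1, h2⟩
    · exact hA ⟨h1, h2⟩
  by_cases hcont : ContinuousAt M r
  · have hlr : l = M r := hcont.continuousWithinAt.leftLim_eq
    have hqr : q = M r := hcont.continuousWithinAt.rightLim_eq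
    have hzu : ζ (M r) = z := by
      rcases hE with h1 | h1
      · rw [h1, hlr]
      · rw [h1, hqr]
    rw [hlr] at hl
    by_cases hbad : M r ∈ badU M ρ ζ ∨ (HasDerivAt ρ 0 (M r) ∧ HasDerivAt ζ 0 (M r))
    · exact Or.inr (Or.inr (Or.inr ⟨M r, hbad, hl, hzu⟩))
    · left
      rw [not_or] at hbad
      have d1 : DifferentiableAt ℝ ρ (M r) := by
        by_contra h1; exact hbad.1 (Or.inl (Or.inl h1))
      have d2 : DifferentiableAt ℝ ζ (M r) := by
        by_contra h1; exact hbad.1 (Or.inl (Or.inr h1))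
      refine tan_diff ha hκ he hM hc hd hF hx hz hcont hl hzu d1.hasDerivAt d2.hasDerivAt ?_
      by_contra h1
      simp only [ne_eq, not_or, not_not] at h1
      apply hbad.2
      have e1 := d1.hasDerivAt
      have e2 := d2.hasDerivAt
      rw [h1.1] at e1; rw [h1.2] at e2
      exact ⟨e1, e2⟩
  · right; right; right
    rcases hE with h1 | h1
    · exact ⟨l, Or.inl (Or.inr (Or.inl ⟨r, hcont, rfl⟩)), hl, h1.symm⟩
    · exact ⟨q, Or.inl (Or.inr (Or.inr ⟨r, hcont, rfl⟩)), hq, h1.symm⟩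
end planar

end SecA12

section SecA13
open MeasureTheory Metric Set Filter
open scoped ENNReal NNReal Topology RealInnerProductSpace Pointwise
set_option linter.all false
set_option linter.deprecated false

section pullback
variable {n : ℕ}

noncomputable abbrev Hyp2 (e w : Euc n) := (Submodule.span ℝ (Set.range ![e, w]))ᗮ

theorem hyp2_inner {e w : Euc n} (y : Hyp2 e w) : ⟪e, (y : Euc n)⟫ = 0 ∧ ⟪w, (y : Euc n)⟫ = 0 := by
  have h := (Submodule.mem_orthogonal _ _).1 y.2
  exact ⟨h e (Submodule.subset_span ⟨0, rfl⟩), h w (Submodule.subset_span ⟨1, rfl⟩)⟩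

theorem mem_hyp2 {e w y : Euc n} (h1 : ⟪e, y⟫ = 0) (h2 : ⟪w, y⟫ = 0) : y ∈ (Submodule.span ℝ (Set.range ![e, w]))ᗮ := by
  rw [Submodule.mem_orthogonal]
  intro u hu
  induction hu using Submodule.span_induction with
  | mem v hv =>
    obtain ⟨i, rfl⟩ := hv
    fin_cases i
    · exact h1
    · exact h2
  | zero => simp
  | add a b _ _ ha hb => rw [inner_add_left, ha, hb, add_zero]
  | smul c a _ ha => rw [inner_smul_left, ha, mul_zero]

theorem finrank_hyp2 {e w : Euc n} (he : ‖e‖ = 1) (hw : ‖w‖ = 1) (hew : ⟪e, w⟫ = 0) :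
    (Module.finrank ℝ (Hyp2 e w) : ℝ) + 1 = (n : ℝ) - 1 := by
  have ho : Orthonormal ℝ ![e, w] := by
    constructor
    · intro i; fin_cases i
      · exact he
      · exact hw
    · intro i j hij
      fin_cases i <;> fin_cases j
      · exact absurd rfl hij
      · exact hew
      · show ⟪w, e⟫ = 0
        rw [real_inner_comm]; exact hew
      · exact absurd rfl hij
  have h1 := finrank_span_eq_card ho.linearIndependent
  have h2 := Submodule.finrank_add_finrank_orthogonal (Submodule.span ℝ (Set.range ![e, w]))
  rw [h1, finrank_euclideanSpace, Fintype.card_fin, Fintype.card_fin] at h2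
  have h3 : ((2 + Module.finrank ℝ (Hyp2 e w) : ℕ) : ℝ) = n := congrArg Nat.cast h2
  push_cast at h3
  linarith

noncomputable def phiMap (e w : Euc n) (ρ ζ : ℝ → ℝ) (p : ℝ × Hyp2 e w) : Euc n :=
  ρ p.1 • (ζ p.1 • e + Real.sqrt (1 - (ζ p.1)^2) • hatv (w + (p.2 : Euc n)))

theorem norm_chart2 {e w : Euc n} (hw : ‖w‖ = 1) (y : Hyp2 e w) : 1 ≤ ‖w + (y : Euc n)‖ := by
  have h : ‖w + (y : Euc n)‖^2 = 1 + ‖(y : Euc n)‖^2 := by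
    rw [norm_add_sq_real, (hyp2_inner y).2, hw]; ring
  have h1 : 1 ≤ ‖w + (y : Euc n)‖^2 := by rw [h]; nlinarith [sq_nonneg ‖(y : Euc n)‖]
  nlinarith [norm_nonneg (w + (y : Euc n))]

theorem sqrt_lip {ε s t : ℝ} (hε : 0 < ε) (hε1 : ε ≤ 1) (hs : |s| ≤ 1 - ε) (ht : |t| ≤ 1 - ε) :
    |√(1 - s^2) - √(1 - t^2)| ≤ ε⁻¹ * |s - t| := by
  have key : ∀ s : ℝ, |s| ≤ 1 - ε → ε ≤ √(1 - s^2) ∧ √(1 - s^2)^2 = 1 - s^2 := by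
    intro s hs
    have h1 : s^2 ≤ (1-ε)^2 := by rw [← sq_abs]; gcongr
    refine ⟨Real.le_sqrt_of_sq_le (by nlinarith), Real.sq_sqrt (by nlinarith)⟩
  obtain ⟨h1, h2⟩ := key s hs
  obtain ⟨h3, h4⟩ := key t ht
  set S := √(1 - s^2)
  set T := √(1 - t^2)
  have h5 : |S - T| * (S + T) = |s - t| * |s + t| := by
    rw [← abs_of_pos (show 0 < S + T by linarith), ← abs_mul, ← abs_mul]
    rw [show (S - T) * (S + T) = -((s - t) * (s + t)) by nlinarith, abs_neg]
  have h6 : |s + t| ≤ 2 := (abs_add_le _ _).trans (by linarith)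
  have h7 : |S - T| * (2 * ε) ≤ |s - t| * 2 := by
    calc _ ≤ |S - T| * (S + T) := by gcongr; linarith
      _ = _ := h5
      _ ≤ _ := by gcongr
  rw [inv_mul_eq_div, le_div_iff₀ hε]; linarith

theorem phiMap_lip {e w : Euc n} (he : ‖e‖ = 1) (hw : ‖w‖ = 1) {ρ ζ : ℝ → ℝ} {R ε : ℝ} (hε : 0 < ε) (hε1 : ε ≤ 1) (hR : 0 ≤ R)
    {s s' : ℝ} (h1 : |ζ s| ≤ 1 - ε) (h2 : |ζ s'| ≤ 1 - ε) (h3 : |ρ s'| ≤ R) (y y' : Hyp2 e w) :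
    dist (phiMap e w ρ ζ (s, y)) (phiMap e w ρ ζ (s', y')) ≤ (2 + R * (ε⁻¹ + 3)) * (|ρ s - ρ s'| + |ζ s - ζ s'| + dist y y') := by
  have hsq : ∀ t : ℝ, √(1 - t^2) ≤ 1 := fun t => Real.sqrt_le_one.2 (by nlinarith [sq_nonneg t])
  have hS := sqrt_lip hε hε1 h1 h2
  set S := √(1 - (ζ s)^2) with hSd
  set S' := √(1 - (ζ s')^2) with hSd'
  have hS0 : 0 ≤ S := Real.sqrt_nonneg _
  have hS0' : 0 ≤ S' := Real.sqrt_nonneg _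
  have hne : ∀ y : Hyp2 e w, ‖hatv (w + (y : Euc n))‖ = 1 := fun y => norm_hatv (by
    have := norm_chart2 hw y
    intro h; rw [h, norm_zero] at this; linarith)
  have hη : ‖hatv (w + (y : Euc n)) - hatv (w + (y' : Euc n))‖ ≤ 2 * dist y y' := by
    have := norm_hatv_sub_le (a := 1) one_pos (norm_chart2 hw y) (norm_chart2 hw y')
    rw [add_sub_add_left_eq_sub] at this
    rw [Subtype.dist_eq, dist_eq_norm]; linarith
  have hS1 := hsq (ζ s)
  have hS1' := hsq (ζ s')
  have hd : phiMap e w ρ ζ (s, y) - phiMap e w ρ ζ (s', y') =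
      (ρ s - ρ s') • (ζ s • e + S • hatv (w + (y : Euc n))) + ρ s' • ((ζ s - ζ s') • e + (S - S') • hatv (w + (y : Euc n)) + S' • (hatv (w + (y : Euc n)) - hatv (w + (y' : Euc n)))) := by
    simp only [phiMap, ← hSd, ← hSd']
    module
  rw [dist_eq_norm, hd]
  have n1 : ‖ζ s • e + S • hatv (w + (y : Euc n))‖ ≤ 2 := by
    refine (norm_add_le _ _).trans ?_
    rw [norm_smul, norm_smul, he, hne, Real.norm_eq_abs, Real.norm_eq_abs, abs_of_nonneg hS0]; linarith
  have n2 : ‖(ζ s - ζ s') • e + (S - S') • hatv (w + (y : Euc n)) + S' • (hatv (w + (y : Euc n)) - hatv (w + (y' : Euc n)))‖ ≤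
      |ζ s - ζ s'| + ε⁻¹ * |ζ s - ζ s'| + 2 * dist y y' := by
    refine (norm_add_le _ _).trans (add_le_add ((norm_add_le _ _).trans (add_le_add ?_ ?_)) ?_)
    · rw [norm_smul, he, Real.norm_eq_abs, mul_one]
    · rw [norm_smul, hne, Real.norm_eq_abs, mul_one]; exact hS
    · rw [norm_smul, Real.norm_eq_abs, abs_of_nonneg hS0']
      have := norm_nonneg (hatv (w + (y : Euc n)) - hatv (w + (y' : Euc n)))
      nlinarith
  refine (norm_add_le _ _).trans ?_
  rw [norm_smul, norm_smul, Real.norm_eq_abs, Real.norm_eq_abs]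
  have a1 := abs_nonneg (ρ s - ρ s')
  have a2 := abs_nonneg (ζ s - ζ s')
  have a3 : 0 ≤ dist y y' := dist_nonneg
  have a4 : 0 ≤ ε⁻¹ := by positivity
  calc _ ≤ |ρ s - ρ s'| * 2 + R * (|ζ s - ζ s'| + ε⁻¹ * |ζ s - ζ s'| + 2 * dist y y') := by
        gcongr
    _ ≤ _ := by
        have b1 : 0 ≤ R * (ε⁻¹ + 3) := by positivity
        have b2 := mul_nonneg b1 a1
        have b3 := mul_nonneg hR a2
        have b4 := mul_nonneg hR a3
        have b5 := mul_nonneg (mul_nonneg hR a4) a3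
        nlinarith

theorem exists_phi {e x : Euc n} (he : ‖e‖ = 1) (hx : x ≠ 0) (hz : |⟪hatv x, e⟫| < 1) {w : Euc n} (hw : ‖w‖ = 1) (hew : ⟪e, w⟫ = 0) (hxw : 0 < ⟪w, x⟫)
    {ρ ζ : ℝ → ℝ} {u : ℝ} (h1 : ρ u = ‖x‖) (h2 : ζ u = ⟪hatv x, e⟫) : ∃ y : Hyp2 e w, phiMap e w ρ ζ (u, y) = x := by
  set z := ⟪hatv x, e⟫ with hzd
  have hr : 0 < ‖x‖ := norm_pos_iff.2 hx
  have hz1 : z^2 < 1 := (sq_lt_one_iff_abs_lt_one _).2 hz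
  have hee : ⟪e, e⟫ = 1 := by rw [real_inner_self_eq_norm_sq, he]; norm_num
  have hww : ⟪w, w⟫ = 1 := by rw [real_inner_self_eq_norm_sq, hw]; norm_num
  set v := hatv x - z • e with hv
  have hve : ⟪e, v⟫ = 0 := by
    rw [hv, inner_sub_right, inner_smul_right, hee, real_inner_comm, ← hzd]; ring
  have hwv : ⟪w, v⟫ = ‖x‖⁻¹ * ⟪w, x⟫ := by
    rw [hv, inner_sub_right, inner_smul_right, real_inner_comm e w, hew, hatv, inner_smul_right]; ring
  have hwv0 : 0 < ⟪w, v⟫ := by rw [hwv]; positivity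
  have hvn : ‖v‖ = √(1 - z^2) := by
    have : ‖v‖^2 = 1 - z^2 := by
      rw [hv, norm_sub_sq_real, norm_hatv hx, norm_smul, he, inner_smul_right, ← hzd, mul_one, Real.norm_eq_abs, sq_abs]; ring
    rw [← this, Real.sqrt_sq (norm_nonneg _)]
  refine ⟨⟨⟪w, v⟫⁻¹ • v - w, mem_hyp2 ?_ ?_⟩, ?_⟩
  · rw [inner_sub_right, inner_smul_right, hve, hew]; ring
  · rw [inner_sub_right, inner_smul_right, hww, inv_mul_cancel₀ hwv0.ne']; ring
  · simp only [phiMap, add_sub_cancel, h1, h2]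
    have hvn0 : ‖v‖ ≠ 0 := by
      intro h; rw [norm_eq_zero.1 h, inner_zero_right] at hwv0; exact lt_irrefl _ hwv0
    have e1 : hatv (⟪w, v⟫⁻¹ • v) = ‖v‖⁻¹ • v := by
      rw [hatv, norm_smul, norm_inv, Real.norm_eq_abs, abs_of_pos hwv0, smul_smul]
      congr 1; field_simp
    rw [e1, ← hvn, smul_smul, mul_inv_cancel₀ hvn0, one_smul, hv, add_sub_cancel, hatv, smul_smul, mul_inv_cancel₀ hr.ne', one_smul]

theorem pullback_null (hn : 2 ≤ n) {ρ ζ : ℝ → ℝ} (hρ : LipschitzWith 1 ρ) (hζ : LipschitzWith 1 ζ) {Z : Set ℝ} {R ε : ℝ} (hε : 0 < ε) (hε1 : ε ≤ 1)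
    (hZ : volume Z = 0 ∨ ∀ u ∈ Z, HasDerivAt ρ 0 u ∧ HasDerivAt ζ 0 u)
    (hZb : ∀ u ∈ Z, 0 < ρ u ∧ ρ u ≤ R ∧ |ζ u| ≤ 1 - ε) :
    (μH[(n:ℝ) - 1] : Measure (Euc n)) {x : Euc n | x ≠ 0 ∧ ∃ u ∈ Z, ρ u = ‖x‖ ∧ ζ u = ⟪hatv x, e1 n (pos_of_two hn)⟫} = 0 := by
  rcases Z.eq_empty_or_nonempty with rfl | ⟨u0, hu0⟩
  · simp
  have hR : 0 ≤ R := (hZb u0 hu0).1.le.trans (hZb u0 hu0).2.1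
  set e := e1 n (pos_of_two hn) with hed
  have he : ‖e‖ = 1 := by rw [hed, e1]; simp
  let w : Fin n × Bool → Euc n := fun p => EuclideanSpace.single p.1 (if p.2 then (1:ℝ) else -1)
  have hw : ∀ p, ‖w p‖ = 1 := by
    rintro ⟨i, b⟩
    simp only [w, EuclideanSpace.norm_single]
    split_ifs <;> simp
  have hnull : ∀ p, ⟪e, w p⟫ = 0 → (μH[(n:ℝ) - 1] : Measure (Euc n)) (phiMap e (w p) ρ ζ '' (Z ×ˢ univ)) = 0 := by
    intro p hp
    rw [← finrank_hyp2 he (hw p) hp]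
    have hl : ∀ s ∈ Z, ∀ s' ∈ Z, ∀ y y' : Hyp2 e (w p), dist (phiMap e (w p) ρ ζ (s, y)) (phiMap e (w p) ρ ζ (s', y')) ≤
        (2 + R * (ε⁻¹ + 3)) * (|ρ s - ρ s'| + |ζ s - ζ s'| + dist y y') := by
      intro s hs s' hs' y y'
      refine phiMap_lip he (hw p) hε hε1 hR (hZb s hs).2.2 (hZb s' hs').2.2 ?_ y y'
      rw [abs_of_pos (hZb s' hs').1]; exact (hZb s' hs').2.1
    have hK : 0 ≤ 2 + R * (ε⁻¹ + 3) := by positivity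
    rcases hZ with hZ | hZ
    · refine sard_null (K := ⟨2 * (2 + R * (ε⁻¹ + 3)), by positivity⟩) hZ fun s hs s' hs' y y' => ?_
      refine (hl s hs s' hs' y y').trans ?_
      have i1 := hρ.dist_le_mul s s'
      have i2 := hζ.dist_le_mul s s'
      rw [NNReal.coe_one, one_mul, Real.dist_eq, Real.dist_eq] at i1 i2
      show _ ≤ 2 * (2 + R * (ε⁻¹ + 3)) * (|s - s'| + dist y y')
      have : (0:ℝ) ≤ dist y y' := dist_nonneg
      calc _ ≤ (2 + R * (ε⁻¹ + 3)) * (2 * (|s - s'| + dist y y')) := by gcongr; linarith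
        _ = _ := by ring
    · exact sard_crit (K := ⟨2 + R * (ε⁻¹ + 3), hK⟩) (a := ρ) (b := ζ) hl (fun s hs => (hZ s hs).1) (fun s hs => (hZ s hs).2)
  refine measure_mono_null (t := ⋃ p : Fin n × Bool, ⋃ (_ : ⟪e, w p⟫ = 0), phiMap e (w p) ρ ζ '' (Z ×ˢ univ)) ?_
    (measure_iUnion_null fun p => measure_iUnion_null fun hp => hnull p hp)
  rintro x ⟨hx, u, hu, h1, h2⟩
  have hz : |⟪hatv x, e⟫| < 1 := by rw [← h2]; linarith [(hZb u hu).2.2]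
  have hex : ∃ i : Fin n, i ≠ ⟨0, by omega⟩ ∧ x i ≠ 0 := by
    by_contra hno
    simp only [not_exists, not_and, not_not] at hno
    have hxe : x = x ⟨0, by omega⟩ • e := by
      ext i
      by_cases hi : i = ⟨0, by omega⟩
      · subst hi; simp [hed, e1]
      · rw [hno i hi]; simp [hed, e1, hi]
    have hxn : ‖x‖ = |x ⟨0, by omega⟩| := by
      conv_lhs => rw [hxe]
      rw [norm_smul, he, mul_one, Real.norm_eq_abs]
    have : ⟪hatv x, e⟫ = ‖x‖⁻¹ * x ⟨0, by omega⟩ := by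
      rw [hatv, inner_smul_left, hed, e1, EuclideanSpace.inner_single_right]; simp
    rw [this, hxn, abs_mul, abs_inv, abs_abs, inv_mul_cancel₀ (by rw [← hxn]; exact norm_ne_zero_iff.2 hx)] at hz
    exact lt_irrefl _ hz
  obtain ⟨i, hi, hxi⟩ := hex
  have hewi : ∀ b, ⟪e, w (i, b)⟫ = 0 := by
    intro b
    simp only [hed, e1, w, EuclideanSpace.inner_single_left]
    simp [hi.symm]
  obtain ⟨b, hb⟩ : ∃ b, 0 < ⟪w (i, b), x⟫ := by
    rcases lt_or_gt_of_ne hxi with h | h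
    · refine ⟨false, ?_⟩
      simp only [w, EuclideanSpace.inner_single_left]; simpa using h
    · refine ⟨true, ?_⟩
      simp only [w, EuclideanSpace.inner_single_left]; simpa using h
  obtain ⟨y, hy⟩ := exists_phi he hx hz (hw (i, b)) (hewi b) hb h1 h2
  exact mem_iUnion.2 ⟨(i, b), mem_iUnion.2 ⟨hewi b, ⟨(u, y), ⟨hu, trivial⟩, hy⟩⟩⟩
end pullback

end SecA13

section SecA14
open MeasureTheory Metric Set Filter
open scoped ENNReal NNReal Topology RealInnerProductSpace Pointwise
set_option linter.all false
set_option linter.deprecated false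

section offaxis
variable {n : ℕ}

theorem hatv_smul {r : ℝ} (hr : 0 < r) (ω : Sph n) : hatv (r • (ω : Euc n)) = ω := by
  rw [hatv, norm_smul, norm_sph, mul_one, Real.norm_eq_abs, abs_of_pos hr, smul_smul, inv_mul_cancel₀ hr.ne', one_smul]

theorem norm_null (hn : 1 ≤ n) {R0 : Set ℝ} (h : ∀ᵐ r ∂(volume.restrict (Ioi (0:ℝ))), r ∈ R0) :
    volume {y : Euc n | ‖y‖ ∉ R0} = 0 := by
  rw [ae_restrict_iff' measurableSet_Ioi, ae_iff] at h
  obtain ⟨T, hT1, hT2, hT3⟩ := exists_measurable_superset_of_null h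
  have hm : MeasurableSet {y : Euc n | ‖y‖ ∈ T} := measurable_norm hT2
  have hnt : Nontrivial (Euc n) := by
    have : Nonempty (Fin n) := ⟨⟨0, hn⟩⟩
    infer_instance
  have h0 : volume {y : Euc n | ‖y‖ ∈ T} = 0 := by
    rw [polar hn hm]
    have : ∫⁻ r in Ioi (0:ℝ), ENNReal.ofReal (r^(n-1)) * sig n (slc {y : Euc n | ‖y‖ ∈ T} r) = 0 := by
      rw [lintegral_eq_zero_iff' (by
        have := measurable_sig_slc hn hm
        exact ((by fun_prop : Measurable fun r : ℝ => ENNReal.ofReal (r^(n-1))).mul this).aemeasurable)]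
      have hTae : ∀ᵐ r ∂(volume : Measure ℝ), r ∉ T := by rwa [ae_iff, show {r | ¬ r ∉ T} = T by ext; simp]
      rw [EventuallyEq, ae_restrict_iff' measurableSet_Ioi]
      filter_upwards [hTae] with r hr hr0
      have : slc {y : Euc n | ‖y‖ ∈ T} r = ∅ := by
        ext ω
        simp only [slc, mem_setOf_eq, norm_smul, norm_sph, mul_one, Real.norm_eq_abs, abs_of_pos (mem_Ioi.1 hr0), mem_empty_iff_false, iff_false]
        exact hr
      rw [this]; simp
    rw [this, mul_zero]
  refine measure_mono_null (t := {y : Euc n | ‖y‖ ∈ T} ∪ {0}) ?_ (measure_union_null h0 (measure_singleton _))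
  intro y hy
  by_cases hy0 : y = 0
  · exact Or.inr hy0
  · refine Or.inl (hT1 ?_)
    show ¬ (‖y‖ ∈ Ioi 0 → ‖y‖ ∈ R0)
    intro hh; exact hy (hh (norm_pos_iff.2 hy0))

theorem R0_dense {R0 : Set ℝ} (h : ∀ᵐ r ∂(volume.restrict (Ioi (0:ℝ))), r ∈ R0) {a b : ℝ} (ha : 0 ≤ a) (hab : a < b) :
    ∃ s ∈ R0, a < s ∧ s < b := by
  by_contra hno
  rw [ae_restrict_iff' measurableSet_Ioi, ae_iff] at h
  have hsub : Ioo a b ⊆ {r | ¬ (r ∈ Ioi 0 → r ∈ R0)} := by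
    intro s hs hh
    exact hno ⟨s, hh (ha.trans_lt hs.1), hs.1, hs.2⟩
  have := measure_mono_null hsub h
  rw [Real.volume_Ioo, ENNReal.ofReal_eq_zero] at this
  linarith

theorem clampR_lt {ε g z : ℝ} (hz : |z| < 1 - ε) : clampR ε g < z ↔ g < z := by
  have := abs_lt.1 hz
  unfold clampR
  rw [max_lt_iff, min_lt_iff]
  constructor
  · rintro ⟨-, h | h⟩
    · exact h
    · linarith
  · intro h
    exact ⟨by linarith, Or.inl h⟩

theorem slc_cap {F : Set (Euc n)} {e : Euc n} {g : ℝ → ℝ} (hFg : ∀ y, y ≠ 0 → (y ∈ F ↔ g ‖y‖ < ⟪hatv y, e⟫)) {r : ℝ} (hr : 0 < r) :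
    slc F r = capS n e (g r) := by
  ext ω
  have hnorm : ‖r • (ω : Euc n)‖ = r := by rw [norm_smul, norm_sph, mul_one, Real.norm_eq_abs, abs_of_pos hr]
  have h0 : r • (ω : Euc n) ≠ 0 := by
    rw [← norm_pos_iff, hnorm]; exact hr
  show r • (ω : Euc n) ∈ F ↔ _
  rw [hFg _ h0, hnorm, hatv_smul hr]
  rfl

theorem offaxis_null (hn : 2 ≤ n) {F : Set (Euc n)} {g m : ℝ → ℝ} {R0 : Set ℝ} (hm : Monotone m)
    (hR0 : ∀ᵐ r ∂(volume.restrict (Ioi (0:ℝ))), r ∈ R0)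
    (hFg : ∀ y, y ≠ 0 → (y ∈ F ↔ g ‖y‖ < ⟪hatv y, e1 n (pos_of_two hn)⟫))
    (hxi : ∀ a ∈ R0, ∀ b ∈ R0, 0 < a → a ≤ b → |xi F a - xi F b| ≤ (2 / a)^(n-1) * (m b - m a)) :
    (μH[(n:ℝ) - 1] : Measure (Euc n)) {x | x ≠ 0 ∧ |⟪hatv x, e1 n (pos_of_two hn)⟫| < 1 ∧ x ∉ Tan F {y | ‖y‖ ∉ R0} ∧ ¬ DZ volume n F x ∧ ¬ DZ volume n Fᶜ x} = 0 := by
  have hN := norm_null (n := n) (by omega) hR0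
  set e := e1 n (pos_of_two hn) with hed
  have he : ‖e‖ = 1 := by rw [hed, e1]; simp
  set N : Set (Euc n) := {y | ‖y‖ ∉ R0} with hNd
  have piece : ∀ k : ℕ, (μH[(n:ℝ) - 1] : Measure (Euc n)) {x | 1 / ((k:ℝ)+2) < ‖x‖ ∧ ‖x‖ ≤ (k:ℝ) + 1 ∧ |⟪hatv x, e⟫| < 1 - 1 / ((k:ℝ) + 2) ∧ x ∉ Tan F N ∧ ¬ DZ volume n F x ∧ ¬ DZ volume n Fᶜ x} = 0 := by
    intro k
    set ε : ℝ := 1 / ((k:ℝ) + 2) with hε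
    have hε0 : 0 < ε := by positivity
    have hε1 : ε < 1 := by rw [hε, div_lt_one (by positivity)]; have : (0:ℝ) ≤ k := by positivity
                           linarith
    obtain ⟨c, hc0, hcb⟩ := clamp_bound hn hε0 hε1
    set C : ℝ := (2 / ε)^(n-1) / c with hC
    have hC0 : 0 < C := by positivity
    set M : ℝ → ℝ := fun r => r + C * m r with hMd
    set R1 : Set ℝ := R0 ∩ Ioi ε with hR1
    have hM : ∀ a b, a ≤ b → b - a ≤ M b - M a := by
      intro a b hab
      have := mul_le_mul_of_nonneg_left (hm hab) hC0.le
      simp only [hMd]; linarith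
    have hh : ∀ a ∈ R1, ∀ b ∈ R1, a ≤ b → |clampR ε (g b) - clampR ε (g a)| ≤ M b - M a := by
      intro a ha b hb hab
      have ha0 : 0 < a := hε0.trans ha.2
      have hb0 : 0 < b := hε0.trans hb.2
      have h1 := hcb (g a) (g b)
      have h2 := hxi a ha.1 b hb.1 ha0 hab
      rw [xi, xi, slc_cap hFg ha0, slc_cap hFg hb0] at h2
      have h3 : (2 / a)^(n-1) ≤ (2/ε)^(n-1) := by
        have : ε ≤ a := le_of_lt ha.2
        gcongr
      have h4 : 0 ≤ m b - m a := by linarith [hm hab]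
      have h5 : c * |clampR ε (g a) - clampR ε (g b)| ≤ (2/ε)^(n-1) * (m b - m a) :=
        h1.trans (h2.trans (mul_le_mul_of_nonneg_right h3 h4))
      have h6 : |clampR ε (g a) - clampR ε (g b)| ≤ C * (m b - m a) := by
        rw [hC, div_mul_eq_mul_div, le_div_iff₀ hc0]; linarith
      rw [abs_sub_comm]
      simp only [hMd]; linarith
    obtain ⟨ρ, ζ, hρ, hζ, hcur⟩ := exists_curve (h := fun r => clampR ε (g r)) hM hh
    have hd : ∀ a b, ε ≤ a → a < b → ∃ s ∈ R1, a < s ∧ s < b := by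
      intro a b ha hab
      obtain ⟨s, hs, h1, h2⟩ := R0_dense hR0 (hε0.le.trans ha) hab
      exact ⟨s, ⟨hs, ha.trans_lt h1⟩, h1, h2⟩
    have hF : ∀ y, y ∉ N → ε < ‖y‖ → |⟪hatv y, e⟫| < 1 - ε → ‖y‖ ∈ R1 ∧ (y ∈ F ↔ clampR ε (g ‖y‖) < ⟪hatv y, e⟫) := by
      intro y hy h1 h2
      have hy0 : y ≠ 0 := norm_pos_iff.1 (hε0.trans h1)
      refine ⟨⟨?_, h1⟩, ?_⟩
      · by_contra h3; exact hy h3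
      · rw [clampR_lt h2]; exact hFg y hy0
    have hmono : Monotone M := fun a b hab => by linarith [hM a b hab]
    set base : Set ℝ := {u | 0 < ρ u ∧ ρ u ≤ (k:ℝ) + 1 ∧ |ζ u| ≤ 1 - ε} with hbase
    have n1 := pullback_null hn hρ hζ (Z := badU M ρ ζ ∩ base) (R := (k:ℝ)+1) hε0 hε1.le
      (Or.inl (measure_mono_null inter_subset_left (badU_null hmono hρ hζ))) (fun u hu => hu.2)
    have n2 := pullback_null hn hρ hζ (Z := {u | HasDerivAt ρ 0 u ∧ HasDerivAt ζ 0 u} ∩ base) (R := (k:ℝ)+1) hε0 hε1.le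
      (Or.inr fun u hu => hu.1) (fun u hu => hu.2)
    refine measure_mono_null ?_ (measure_union_null n1 n2)
    rintro x ⟨h1, h2, h3, h4, h5, h6⟩
    have hx0 : x ≠ 0 := norm_pos_iff.1 (hε0.trans h1)
    rcases planar_point hε0 (by linarith) he hM hρ hζ hcur hd hN hF h1 h3 with h | h | h | ⟨u, hu, hu1, hu2⟩
    · exact absurd h h4
    · exact absurd h h5
    · exact absurd h h6
    · have hb : u ∈ base := ⟨by rw [hu1]; exact hε0.trans h1, by rw [hu1]; exact h2, by rw [hu2]; exact h3.le⟩
      rcases hu with hu | hu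
      · exact Or.inl ⟨hx0, u, ⟨hu, hb⟩, hu1, hu2⟩
      · exact Or.inr ⟨hx0, u, ⟨hu, hb⟩, hu1, hu2⟩
  refine measure_mono_null ?_ (measure_iUnion_null piece)
  rintro x ⟨h1, h2, h3⟩
  have hx : 0 < ‖x‖ := norm_pos_iff.2 h1
  obtain ⟨k1, hk1⟩ := exists_nat_one_div_lt (lt_min hx (show 0 < 1 - |⟪hatv x, e⟫| by linarith))
  obtain ⟨k2, hk2⟩ := exists_nat_gt ‖x‖
  have hk3 : 1 / (((max k1 k2 : ℕ) : ℝ) + 2) < min ‖x‖ (1 - |⟪hatv x, e⟫|) := by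
    refine lt_of_le_of_lt ?_ hk1
    have : (k1 : ℝ) ≤ ((max k1 k2 : ℕ) : ℝ) := by exact_mod_cast le_max_left _ _
    apply one_div_le_one_div_of_le <;> [positivity; linarith]
  have hk4 : (k2 : ℝ) ≤ ((max k1 k2 : ℕ) : ℝ) := by exact_mod_cast le_max_right _ _
  have h5 := hk3.trans_le (min_le_right _ _)
  exact mem_iUnion.2 ⟨max k1 k2, hk3.trans_le (min_le_left _ _), by linarith, by linarith, h3⟩
end offaxis

end SecA14

section SecA15
open MeasureTheory Metric Set Filter
open scoped ENNReal NNReal Topology RealInnerProductSpace Pointwise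
set_option linter.all false
set_option linter.deprecated false

theorem axis_mem {n : ℕ} {x e : Euc n} (hx : x ≠ 0) (he : ‖e‖ = 1) (h : 1 ≤ |⟪hatv x, e⟫|) : x = ‖x‖ • e ∨ x = ‖x‖ • (-e) := by
  have hn := norm_hatv hx
  have hx0 : ‖x‖ ≠ 0 := norm_ne_zero_iff.2 hx
  have h1 : |⟪hatv x, e⟫| ≤ 1 := by
    have := abs_real_inner_le_norm (hatv x) e
    rwa [hn, he, mul_one] at this
  have hxx : x = ‖x‖ • hatv x := by rw [hatv, smul_smul, mul_inv_cancel₀ hx0, one_smul]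
  rcases eq_or_eq_neg_of_abs_eq (le_antisymm h1 h) with h2 | h2
  · left
    rw [inner_eq_one_iff_of_norm_eq_one hn he] at h2
    rw [← h2]; exact hxx
  · right
    have : ⟪hatv x, -e⟫ = 1 := by rw [inner_neg_right, h2, neg_neg]
    rw [inner_eq_one_iff_of_norm_eq_one hn (by rw [norm_neg]; exact he)] at this
    rw [← this]; exact hxx

theorem axis_line {n : ℕ} (hn : 3 ≤ n) {e : Euc n} (he : ‖e‖ = 1) :
    (μH[(n:ℝ) - 1] : Measure (Euc n)) {x | x ≠ 0 ∧ 1 ≤ |⟪hatv x, e⟫|} = 0 := by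
  have h0 : (μH[(n:ℝ) - 1] : Measure ℝ) univ = 0 := by
    have : dimH (univ : Set ℝ) < ((((n:ℝ) - 1).toNNReal : ℝ≥0) : ℝ≥0∞) := by
      rw [Real.dimH_univ]
      have h3 : (3:ℝ) ≤ n := by exact_mod_cast hn
      have : (1:ℝ≥0) < ((n:ℝ) - 1).toNNReal := by rw [Real.lt_toNNReal_iff_coe_lt]; push_cast; linarith
      exact_mod_cast this
    have h4 := hausdorffMeasure_of_dimH_lt this
    rwa [Real.coe_toNNReal _ (dim_nonneg (by omega))] at h4
  have himg : ∀ v : Euc n, ‖v‖ = 1 → (μH[(n:ℝ) - 1] : Measure (Euc n)) ((fun t : ℝ => t • v) '' univ) = 0 := by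
    intro v hv
    refine haus_image_null (K := 1) (dim_nonneg (by omega)) ?_ h0
    intro a _ b _
    rw [dist_eq_norm, ← sub_smul, norm_smul, hv, Real.dist_eq, NNReal.coe_one]
    simp
  refine measure_mono_null ?_ (measure_union_null (himg e he) (himg (-e) (by rw [norm_neg]; exact he)))
  rintro x ⟨hx, h⟩
  rcases axis_mem hx he h with h1 | h1
  · exact Or.inl ⟨‖x‖, trivial, h1.symm⟩
  · exact Or.inr ⟨‖x‖, trivial, h1.symm⟩

theorem cap_small {e : Euc 2} (he : ‖e‖ = 1) {c : ℝ} (hc : 0 < c) : ∃ t : ℝ, t < 1 ∧ (sig 2 (capS 2 e t)).toReal < c := by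
  have hfin := sig_finite (n := 2) (by omega)
  have hpt : sig 2 (⋂ k : ℕ, capS 2 e (1 - 1 / ((k:ℝ)+1))) = 0 := by
    have hsub : (⋂ k : ℕ, capS 2 e (1 - 1 / ((k:ℝ)+1))) ⊆ {(⟨e, by simp [he]⟩ : Sph 2)} := by
      intro ω hω
      rw [mem_iInter] at hω
      have h1 : 1 ≤ ⟪(ω : Euc 2), e⟫ := by
        by_contra hlt
        have hlt := not_le.1 hlt
        obtain ⟨k, hk⟩ := exists_nat_one_div_lt (show 0 < 1 - ⟪(ω : Euc 2), e⟫ by linarith)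
        have := hω k
        have : 1 - 1 / ((k:ℝ)+1) < ⟪(ω : Euc 2), e⟫ := this
        linarith
      have h2 : ⟪(ω : Euc 2), e⟫ ≤ 1 := by
        have := real_inner_le_norm (ω : Euc 2) e
        rwa [norm_sph, he, mul_one] at this
      have h3 := (inner_eq_one_iff_of_norm_eq_one (norm_sph ω) he).1 (le_antisymm h2 h1)
      exact Subtype.ext h3
    refine measure_mono_null hsub ?_
    have := Measure.nullSingletonClass_hausdorff (Sph 2) (d := (1:ℝ)) one_pos
    have h1 : (((2:ℕ):ℝ) - 1) = 1 := by norm_num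
    rw [sig, h1]
    exact measure_singleton _
  have hanti : Antitone fun k : ℕ => capS 2 e (1 - 1 / ((k:ℝ)+1)) := by
    intro k l hkl ω hω
    have hω : 1 - 1 / ((l:ℝ)+1) < ⟪(ω : Euc 2), e⟫ := hω
    have : 1 / ((l:ℝ)+1) ≤ 1 / ((k:ℝ)+1) := Nat.one_div_le_one_div hkl
    show 1 - 1 / ((k:ℝ)+1) < ⟪(ω : Euc 2), e⟫
    linarith
  have ht := tendsto_measure_iInter_atTop (μ := sig 2) (s := fun k : ℕ => capS 2 e (1 - 1 / ((k:ℝ)+1))) (fun k => (measurableSet_capS 2 e (1 - 1 / ((k:ℝ)+1))).nullMeasurableSet) hanti ⟨0, measure_ne_top _ _⟩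
  rw [hpt] at ht
  obtain ⟨k, hk⟩ := (ht.eventually (gt_mem_nhds (ENNReal.ofReal_pos.2 hc))).exists
  refine ⟨1 - 1 / ((k:ℝ)+1), by have : 0 < 1 / ((k:ℝ)+1) := by positivity
                                linarith, ?_⟩
  exact (ENNReal.lt_ofReal_iff_toReal_lt (measure_ne_top _ _)).1 hk

theorem axis_pt {G : Set (Euc 2)} (hG : MeasurableSet G) {e : Euc 2} (he : ‖e‖ = 1) {R0 : Set ℝ}
    (hR0 : ∀ᵐ r ∂(volume.restrict (Ioi (0:ℝ))), r ∈ R0) {w : ℝ → ℝ} {a0 r : ℝ} (ha0 : 0 ≤ a0) (hr : a0 < r)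
    (hw : ∀ s ∈ R0, a0 < s → (sig 2 (slc G s)).toReal = w s) (hdiff : DifferentiableAt ℝ w r)
    (hup : ∀ y y' : Euc 2, y ≠ 0 → y' ≠ 0 → ‖y‖ = ‖y'‖ → y ∈ G → ⟪hatv y, e⟫ < ⟪hatv y', e⟫ → y' ∈ G) :
    DZ volume 2 G (r • e) ∨ DZ volume 2 Gᶜ (r • e) := by
  have hfin := sig_finite (n := 2) (by omega)
  have hr0 : 0 < r := ha0.trans_lt hr
  have hxn : ‖r • e‖ = r := by rw [norm_smul, he, mul_one, Real.norm_eq_abs, abs_of_pos hr0]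
  have hwpos : ∀ s ∈ R0, a0 < s → 0 ≤ w s := fun s hs h => by rw [← hw s hs h]; exact ENNReal.toReal_nonneg
  have hcont : ∀ η, 0 < η → ∃ δ, 0 < δ ∧ ∀ s, |s - r| < δ → |w s - w r| < η := by
    intro η hη
    obtain ⟨δ, hδ, h⟩ := Metric.continuousAt_iff.1 hdiff.continuousAt η hη
    exact ⟨δ, hδ, fun s hs => by have := h (x := s) (by rwa [Real.dist_eq]); rwa [Real.dist_eq] at this⟩
  have hw0 : 0 ≤ w r := by
    by_contra hneg
    have hneg := not_le.1 hneg
    obtain ⟨δ, hδ, h⟩ := hcont (-w r) (by linarith)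
    obtain ⟨s, hs, h1, h2⟩ := R0_dense hR0 hr0.le (show r < r + δ by linarith)
    have h3 := abs_lt.1 (h s (by rw [abs_of_pos] <;> linarith))
    linarith [hwpos s hs (hr.trans h1)]
  rcases hw0.lt_or_eq with hpos | hzero
  · right
    obtain ⟨t, ht1, ht⟩ := cap_small he (show 0 < w r / 2 by linarith)
    obtain ⟨δ, hδ, h⟩ := hcont (w r / 2) (by linarith)
    have hxh : ⟪hatv (r • e), e⟫ = 1 := by
      rw [hatv, hxn, smul_smul, inv_mul_cancel₀ hr0.ne', one_smul, real_inner_self_eq_norm_sq, he]; norm_num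
    set η := min δ (min (1 - t) (r - a0)) with hη
    have hη0 : 0 < η := lt_min hδ (lt_min (by linarith) (by linarith))
    set b := (r + a0) / 2 with hb
    have hb0 : 0 < b := by positivity
    set δ' := min (η / 2) (b / 2 * η) with hδ'
    have hδ0 : 0 < δ' := lt_min (by linarith) (by positivity)
    refine DZ.of_empty_loc hδ0 ?_
    have hN := norm_null (n := 2) (by omega) hR0
    have hae : ∀ᵐ y ∂(volume : Measure (Euc 2)), ‖y‖ ∈ R0 := hN
    filter_upwards [hae] with y hy hyb hyG
    rw [mem_ball, dist_eq_norm] at hyb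
    have h1 := abs_norm_sub_norm_le y (r • e)
    rw [hxn] at h1
    have m1 : ‖y - r • e‖ < η / 2 := hyb.trans_le (min_le_left _ _)
    have m2 : ‖y - r • e‖ < b / 2 * η := hyb.trans_le (min_le_right _ _)
    have m3 : η ≤ r - a0 := (min_le_right _ _).trans (min_le_right _ _)
    have m4 : η ≤ 1 - t := (min_le_right _ _).trans (min_le_left _ _)
    have m5 : η ≤ δ := min_le_left _ _
    have h1' := abs_le.1 h1
    have hyb' : b ≤ ‖y‖ := by linarith [h1'.1]
    have hy0 : y ≠ 0 := norm_pos_iff.1 (hb0.trans_le hyb')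
    have h2 := hat_lip (x := r • e) (y := y) he hb0 (by rw [hxn]; linarith) hyb'
    have h3 : t < ⟪hatv y, e⟫ := by
      rw [hxh] at h2
      have h4 := (abs_le.1 h2).1
      have h5 : 2 / b * ‖y - r • e‖ < η := by
        calc 2 / b * ‖y - r • e‖ < 2 / b * (b / 2 * η) := by gcongr
          _ = η := by field_simp
      linarith
    have hs := hw ‖y‖ hy (by linarith)
    have h4 := abs_lt.1 (h ‖y‖ (by linarith))
    have h5 : (sig 2 (capS 2 e t)).toReal < (sig 2 (slc G ‖y‖)).toReal := by rw [hs]; linarith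
    have h6 : ¬ slc G ‖y‖ ⊆ capS 2 e t := by
      intro hsub
      have := ENNReal.toReal_mono (measure_ne_top (sig 2) (capS 2 e t)) (measure_mono hsub)
      linarith
    obtain ⟨ω, hω, hωt⟩ := not_subset.1 h6
    have hyp : 0 < ‖y‖ := norm_pos_iff.2 hy0
    have hnω : ‖‖y‖ • (ω : Euc 2)‖ = ‖y‖ := by rw [norm_smul, norm_sph, mul_one, norm_norm]
    refine hyG (hup (‖y‖ • (ω : Euc 2)) y (by rw [← norm_pos_iff, hnω]; exact hyp) hy0 hnω hω ?_)
    rw [hatv_smul hyp]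
    have : ⟪(ω : Euc 2), e⟫ ≤ t := not_lt.1 hωt
    linarith
  · left
    intro ε hε
    -- derivative is zero
    have hL : deriv w r = 0 := by
      have hd := hdiff.hasDerivAt
      set L := deriv w r with hLd
      by_contra hL0
      obtain ⟨δ, hδ, h⟩ := Metric.eventually_nhds_iff.1 (hd.isLittleO.def (show 0 < |L| / 2 by positivity))
      rcases lt_or_gt_of_ne hL0 with hneg | hpos
      · obtain ⟨s, hs, h1, h2⟩ := R0_dense hR0 hr0.le (show r < r + δ by linarith)
        have h3 := h (y := s) (by rw [Real.dist_eq, abs_of_pos] <;> linarith)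
        rw [← hzero, sub_zero, smul_eq_mul, Real.norm_eq_abs, Real.norm_eq_abs, abs_of_neg hneg, abs_of_pos (show 0 < s - r by linarith)] at h3
        have h4 := (abs_le.1 h3).2
        have h5 := hwpos s hs (hr.trans h1)
        nlinarith
      · obtain ⟨s, hs, h1, h2⟩ := R0_dense hR0 (ha0.trans (le_max_left a0 (r - δ))) (max_lt hr (show r - δ < r by linarith))
        have h6 := (le_max_right a0 (r - δ)).trans_lt h1
        have h3 := h (y := s) (by rw [Real.dist_eq, abs_of_neg] <;> linarith)
        rw [← hzero, sub_zero, smul_eq_mul, Real.norm_eq_abs, Real.norm_eq_abs, abs_of_pos hpos, abs_of_neg (show s - r < 0 by linarith)] at h3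
        have h4 := (abs_le.1 h3).2
        have h5 := hwpos s hs ((le_max_left a0 (r - δ)).trans_lt h1)
        nlinarith
    have hd := hdiff.hasDerivAt
    rw [hL] at hd
    set P := (polC 2).toReal with hP
    have hP0 : 0 ≤ P := ENNReal.toReal_nonneg
    have hPe : polC 2 = ENNReal.ofReal P := (ENNReal.ofReal_toReal (polC_ne_top (by omega))).symm
    set η := ε / (4 * r * (P + 1)) with hη
    have hη0 : 0 < η := by positivity
    obtain ⟨δ, hδ, h⟩ := Metric.eventually_nhds_iff.1 (hd.isLittleO.def hη0)
    refine ⟨min δ (r - a0), lt_min hδ (by linarith), fun ρ hρ0 hρ => ?_⟩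
    have hρ1 := hρ.trans_le (min_le_left _ _)
    have hρ2 := hρ.trans_le (min_le_right _ _)
    have hm : MeasurableSet (G ∩ ball (r • e) ρ) := hG.inter measurableSet_ball
    rw [polar (by omega) hm]
    have hbound : ∫⁻ s in Ioi (0:ℝ), ENNReal.ofReal (s^(2-1)) * sig 2 (slc (G ∩ ball (r • e) ρ) s) ≤
        ENNReal.ofReal (2 * r * (η * ρ)) * ENNReal.ofReal (2 * ρ) := by
      calc _ ≤ ∫⁻ s in Ioi (0:ℝ), (Ioo (r - ρ) (r + ρ)).indicator (fun _ => ENNReal.ofReal (2 * r * (η * ρ))) s := by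
            apply lintegral_mono_ae
            filter_upwards [hR0, ae_restrict_mem measurableSet_Ioi] with s hs hs0
            have hs0 : 0 < s := hs0
            by_cases hsI : s ∈ Ioo (r - ρ) (r + ρ)
            · rw [indicator_of_mem hsI]
              have has : a0 < s := by linarith [hsI.1]
              have h1 : sig 2 (slc (G ∩ ball (r • e) ρ) s) ≤ sig 2 (slc G s) := measure_mono fun ω hω => hω.1
              have h2 : sig 2 (slc G s) = ENNReal.ofReal (w s) := by
                rw [← hw s hs has, ENNReal.ofReal_toReal (measure_ne_top _ _)]
              have habs : |s - r| < ρ := by rw [abs_lt]; constructor <;> linarith [hsI.1, hsI.2]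
              have h3 := h (y := s) (by rw [Real.dist_eq]; linarith)
              rw [← hzero, sub_zero, smul_zero, sub_zero, Real.norm_eq_abs, Real.norm_eq_abs] at h3
              have h4 : w s ≤ η * ρ := (le_abs_self _).trans (h3.trans (by gcongr))
              rw [ENNReal.ofReal_mul (by positivity)]
              refine mul_le_mul' (ENNReal.ofReal_le_ofReal ?_) (h1.trans (h2.trans_le (ENNReal.ofReal_le_ofReal h4)))
              have := hsI.2
              norm_num
              linarith
            · have : slc (G ∩ ball (r • e) ρ) s = ∅ := by
                ext ω
                simp only [mem_empty_iff_false, iff_false]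
                rintro ⟨-, hω⟩
                rw [mem_ball, dist_eq_norm] at hω
                apply hsI
                have h1 : |‖s • (ω : Euc 2)‖ - ‖r • e‖| ≤ ‖s • (ω : Euc 2) - r • e‖ := abs_norm_sub_norm_le _ _
                rw [hxn, norm_smul, norm_sph, mul_one, Real.norm_eq_abs, abs_of_pos hs0] at h1
                have := abs_lt.1 (h1.trans_lt hω)
                constructor <;> linarith
              rw [this]; simp
        _ ≤ ∫⁻ s, (Ioo (r - ρ) (r + ρ)).indicator (fun _ => ENNReal.ofReal (2 * r * (η * ρ))) s := setLIntegral_le_lintegral _ _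
        _ = _ := by
            rw [lintegral_indicator measurableSet_Ioo, setLIntegral_const, Real.volume_Ioo]
            congr 2; ring
    calc _ ≤ polC 2 * (ENNReal.ofReal (2 * r * (η * ρ)) * ENNReal.ofReal (2 * ρ)) := by gcongr
      _ = ENNReal.ofReal (P * ((2 * r * (η * ρ)) * (2 * ρ))) := by
          rw [hPe, ← ENNReal.ofReal_mul (by positivity), ← ENNReal.ofReal_mul hP0]
      _ ≤ _ := by
          apply ENNReal.ofReal_le_ofReal
          have : P * ((2 * r * (η * ρ)) * (2 * ρ)) = (P / (P + 1)) * ε * ρ^2 := by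
            rw [hη]; field_simp; ring
          rw [this]
          have h1 : P / (P + 1) ≤ 1 := by rw [div_le_one (by linarith)]; linarith
          have h2 : 0 ≤ ε * ρ^2 := by positivity
          nlinarith

theorem axis_null2 {F : Set (Euc 2)} (hF : MeasurableSet F) {e : Euc 2} (he : ‖e‖ = 1) {g m : ℝ → ℝ} {R0 : Set ℝ} (hm : Monotone m) {Bm : ℝ}
    (hmb : ∀ r, 0 ≤ m r ∧ m r ≤ Bm)
    (hR0 : ∀ᵐ r ∂(volume.restrict (Ioi (0:ℝ))), r ∈ R0)
    (hFg : ∀ y, y ≠ 0 → (y ∈ F ↔ g ‖y‖ < ⟪hatv y, e⟫))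
    (hxi : ∀ a ∈ R0, ∀ b ∈ R0, 0 < a → a ≤ b → |xi F a - xi F b| ≤ (2 / a)^(2-1) * (m b - m a)) :
    (μH[((2:ℕ):ℝ) - 1] : Measure (Euc 2)) {x | x ≠ 0 ∧ 1 ≤ |⟪hatv x, e⟫| ∧ ¬ DZ volume 2 F x ∧ ¬ DZ volume 2 Fᶜ x} = 0 := by
  have hfin := sig_finite (n := 2) (by omega)
  have hxib : ∀ s, 0 ≤ xi F s ∧ xi F s ≤ (sig 2 univ).toReal := fun s => ⟨ENNReal.toReal_nonneg, ENNReal.toReal_mono (measure_ne_top _ _) (measure_mono (subset_univ _))⟩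
  set nice : ℝ → Prop := fun r => ∃ (w : ℝ → ℝ) (a0 : ℝ), 0 ≤ a0 ∧ a0 < r ∧ DifferentiableAt ℝ w r ∧ ∀ s ∈ R0, a0 < s → xi F s = w s with hnice
  have hnull : volume {r : ℝ | 0 < r ∧ ¬ nice r} = 0 := by
    have hk : ∀ k : ℕ, volume {r : ℝ | 1 / ((k:ℝ)+1) < r ∧ ¬ nice r} = 0 := by
      intro k
      set a0 : ℝ := 1 / ((k:ℝ)+1) with ha0
      have ha : 0 < a0 := by positivity
      set C : ℝ := 2 / a0 with hC
      have hC0 : 0 < C := by positivity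
      have hmon : MonotoneOn (fun s => xi F s + C * m s) (R0 ∩ Ioi a0) := by
        intro a haa b hb hab
        have h1 := hxi a haa.1 b hb.1 (ha.trans haa.2) hab
        have h2 : (2 / a)^(2-1) ≤ C := by
          have : a0 ≤ a := le_of_lt haa.2
          norm_num
          rw [hC]; gcongr
        have h3 : 0 ≤ m b - m a := by linarith [hm hab]
        have h4 := (abs_le.1 (h1.trans (mul_le_mul_of_nonneg_right h2 h3))).2
        show xi F a + C * m a ≤ xi F b + C * m b
        linarith
      obtain ⟨p, hp1, hp2⟩ := hmon.exists_monotone_extension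
        ⟨0, by
          rintro _ ⟨s, -, rfl⟩
          exact add_nonneg (hxib s).1 (mul_nonneg hC0.le (hmb s).1)⟩
        ⟨(sig 2 univ).toReal + C * Bm, by
          rintro _ ⟨s, -, rfl⟩
          exact add_le_add (hxib s).2 (mul_le_mul_of_nonneg_left (hmb s).2 hC0.le)⟩
      have hae := hp1.ae_differentiableAt.and hm.ae_differentiableAt
      rw [ae_iff] at hae
      refine measure_mono_null ?_ hae
      rintro r ⟨hr, hnr⟩ hh
      refine hnr ⟨fun s => p s - C * m s, a0, ha.le, hr, hh.1.sub (hh.2.const_mul C), fun s hs hs0 => ?_⟩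
      have := hp2 ⟨hs, hs0⟩
      simp only at this
      linarith
    refine measure_mono_null ?_ (measure_iUnion_null hk)
    rintro r ⟨hr, hnr⟩
    obtain ⟨k, hk⟩ := exists_nat_one_div_lt hr
    exact mem_iUnion.2 ⟨k, hk, hnr⟩
  have himg : ∀ v : Euc 2, ‖v‖ = 1 → (μH[((2:ℕ):ℝ) - 1] : Measure (Euc 2)) ((fun t : ℝ => t • v) '' {r : ℝ | 0 < r ∧ ¬ nice r}) = 0 := by
    intro v hv
    refine haus_image_null (K := 1) (dim_nonneg (by omega)) ?_ ?_
    · intro a _ b _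
      rw [dist_eq_norm, ← sub_smul, norm_smul, hv, Real.dist_eq, NNReal.coe_one]
      simp
    · rw [show (((2:ℕ):ℝ) - 1) = 1 by norm_num, hausdorffMeasure_real]
      exact hnull
  refine measure_mono_null ?_ (measure_union_null (himg e he) (himg (-e) (by rw [norm_neg]; exact he)))
  rintro x ⟨hx, h, hd1, hd2⟩
  have hx0 : 0 < ‖x‖ := norm_pos_iff.2 hx
  rcases axis_mem hx he h with h1 | h1
  · left
    refine ⟨‖x‖, ⟨hx0, ?_⟩, h1.symm⟩
    rintro ⟨w, a0, ha0, har, hwd, hw⟩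
    have := axis_pt hF he hR0 ha0 har hw hwd (by
      intro y y' hy hy' hyy hyF hlt
      rw [hFg y hy, hyy] at hyF
      rw [hFg y' hy']; linarith)
    rw [← h1] at this
    exact this.elim hd1 hd2
  · right
    refine ⟨‖x‖, ⟨hx0, ?_⟩, h1.symm⟩
    rintro ⟨w, a0, ha0, har, hwd, hw⟩
    have := axis_pt (w := fun s => (sig 2 univ).toReal - w s) hF.compl (e := -e) (by rw [norm_neg]; exact he) hR0 ha0 har (by
      intro s hs hsa
      have hc : slc Fᶜ s = (slc F s)ᶜ := rfl
      rw [hc, measure_compl (measurableSet_slc hF s) (measure_ne_top _ _), ENNReal.toReal_sub_of_le (measure_mono (subset_univ _)) (measure_ne_top _ _), ← hw s hs hsa]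
      rfl) (hwd.const_sub _) (by
      intro y y' hy hy' hyy hyF hlt
      rw [mem_compl_iff, hFg y hy, hyy, not_lt] at hyF
      rw [mem_compl_iff, hFg y' hy', not_lt]
      rw [inner_neg_right, inner_neg_right] at hlt
      linarith)
    rw [← h1, compl_compl] at this
    exact this.elim hd2 hd1

end SecA15

section SecA16
open MeasureTheory Metric Set Filter
open scoped ENNReal NNReal Topology RealInnerProductSpace Pointwise
set_option linter.all false
set_option linter.deprecated false

theorem arccos_lt_iff_cos {t a : ℝ} (ht : -1 ≤ t) (ht' : t ≤ 1) (ha : a ∈ Icc (0:ℝ) Real.pi) :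
    Real.arccos t < a ↔ Real.cos a < t := by
  constructor
  · intro h
    have := Real.strictAntiOn_cos ⟨Real.arccos_nonneg t, Real.arccos_le_pi t⟩ ha h
    rwa [Real.cos_arccos ht ht'] at this
  · intro h
    by_contra hc
    have := Real.strictAntiOn_cos.antitoneOn ha ⟨Real.arccos_nonneg t, Real.arccos_le_pi t⟩ (not_lt.1 hc)
    rw [Real.cos_arccos ht ht'] at this
    linarith

theorem norm_e1 (n : ℕ) (h : 0 < n) : ‖e1 n h‖ = 1 := by simp [e1]

theorem hat_inner_bd {n : ℕ} {x e : Euc n} (hx : x ≠ 0) (he : ‖e‖ = 1) : -1 ≤ ⟪hatv x, e⟫ ∧ ⟪hatv x, e⟫ ≤ 1 := by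
  have := abs_real_inner_le_norm (hatv x) e
  rw [norm_hatv hx, he, mul_one] at this
  exact abs_le.1 this

theorem symm_main {n : ℕ} (hn : 2 ≤ n) (hn0 : 0 < n)
    {v : ℝ → ℝ} (hv_meas : Measurable v) (hv_nonneg : ∀ r ∈ Ioi (0:ℝ), 0 ≤ v r)
    {α : ℝ → ℝ} (hα_meas : Measurable α) (hα_mem : ∀ r, α r ∈ Icc (0:ℝ) Real.pi)
    (hα : ∀ᵐ r ∂(volume.restrict (Ioi (0:ℝ))),
      μH[(n : ℝ) - 1] (capSet (e1 n hn0) r (α r)) = ENNReal.ofReal (v r))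
    {E : Set (Euc n)} (hE_meas : MeasurableSet E) (hE_dist : SphDistrib v E)
    (hE_perim : perim E univ < ⊤) (hE_vol : volume E < ⊤) {B : Set ℝ} (hB : MeasurableSet B) :
    perim (sphSymm n α (e1 n hn0)) (sphShell n B) ≤ perim E (sphShell n B) := by
  have hn1 : 1 ≤ n := by omega
  have he : ‖e1 n hn0‖ = 1 := norm_e1 n hn0
  set e := e1 n hn0 with hedef
  set F := sphSymm n α e with hFdef
  have hfin := sig_finite hn1
  set g : ℝ → ℝ := fun r => Real.cos (α r) with hg
  have hFg : ∀ y, y ≠ 0 → (y ∈ F ↔ g ‖y‖ < ⟪hatv y, e⟫) := by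
    intro y hy
    have hb := hat_inner_bd hy he
    rw [← arccos_lt_iff_cos hb.1 hb.2 (hα_mem _)]
    exact ⟨fun h => h.2, fun h => ⟨hy, h⟩⟩
  have hhat : Measurable (hatv : Euc n → Euc n) := by
    unfold hatv
    exact (measurable_norm.inv).smul measurable_id
  have hF : MeasurableSet F := by
    have h1 : Measurable fun x : Euc n => Real.arccos ⟪hatv x, e⟫ :=
      Real.continuous_arccos.measurable.comp (hhat.inner measurable_const)
    exact (measurableSet_singleton (0:Euc n)).compl.inter (measurableSet_lt h1 (hα_meas.comp measurable_norm))
  have hs : ∀ᵐ r ∂(volume.restrict (Ioi (0:ℝ))), sig n (slc E r) = sig n (slc F r) := by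
    filter_upwards [hα, hE_dist, ae_restrict_mem measurableSet_Ioi] with r h1 h2 hr
    have hr : 0 < r := hr
    have h3 : capSet e r (α r) = F ∩ sphere 0 r := by
      ext x
      constructor
      · rintro ⟨hx, h⟩
        have hx' : ‖x‖ = r := by simpa using hx
        refine ⟨⟨?_, ?_⟩, hx⟩
        · rw [← norm_pos_iff, hx']; exact hr
        · rw [hx']; exact h
      · rintro ⟨⟨-, h⟩, hx⟩
        have hx' : ‖x‖ = r := by simpa using hx
        rw [hx'] at h
        exact ⟨hx, h⟩
    rw [h3, sphere_slice hr hn1] at h1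
    rw [sphere_slice hr hn1] at h2
    have h4 := h2.trans h1.symm
    have hp : ENNReal.ofReal (r^(n-1)) ≠ 0 := by
      rw [Ne, ENNReal.ofReal_eq_zero, not_le]; positivity
    exact (ENNReal.mul_right_inj hp ENNReal.ofReal_ne_top).1 h4
  have hFv : volume F ≠ ⊤ := by
    have : volume F = volume E := by
      rw [polar hn1 hF, polar hn1 hE_meas]
      congr 1
      apply lintegral_congr_ae
      filter_upwards [hs] with r hr
      rw [hr]
    rw [this]; exact hE_vol.ne
  have hFp : ∀ u : Euc n, ‖u‖ = 1 → 0 ≤ ⟪u, e⟫ → ∀ x ∈ Hm u, x ∈ F → rfx u x ∈ F := by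
    intro u hu hue x hx hxF
    have hx : ⟪u, x⟫ < 0 := hx
    have hx0 : x ≠ 0 := hxF.1
    have hnr : ‖rfx u x‖ = ‖x‖ := (rfx u).norm_map x
    have hx0' : rfx u x ≠ 0 := by rw [← norm_pos_iff, hnr, norm_pos_iff]; exact hx0
    rw [hFg _ hx0] at hxF
    rw [hFg _ hx0', hnr]
    refine hxF.trans_le ?_
    rw [hatv, hatv, hnr, real_inner_smul_left, real_inner_smul_left]
    refine mul_le_mul_of_nonneg_left ?_ (inv_nonneg.2 (norm_nonneg _))
    rw [rfx_apply hu, inner_sub_left, real_inner_smul_left]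
    nlinarith
  set R0 : Set ℝ := {r | r ∈ goodR E ∧ sig n (slc E r) = sig n (slc F r)} with hR0def
  have hR0 : ∀ᵐ r ∂(volume.restrict (Ioi (0:ℝ))), r ∈ R0 := by
    filter_upwards [goodR_ae hn1 hE_meas, hs] with r h1 h2 using ⟨h1, h2⟩
  have hxi : ∀ a ∈ R0, ∀ b ∈ R0, 0 < a → a ≤ b → |xi F a - xi F b| ≤ (2/a)^(n-1) * (mass E b - mass E a) := by
    intro a ha b hb _ hab
    have := crossing_xi hn1 hE_meas hE_perim ha.1 hb.1 hab
    rw [xi, xi, ha.2, hb.2] at this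
    exact this
  have hN := norm_null hn1 hR0
  obtain ⟨A, hA, hper, hconv⟩ := exists_seq hn1 hE_meas hF hFp hFv hs
  have hT := lsc_shell hn1 hF hN hE_meas hE_perim hA hconv hper hB
  have hoff := offaxis_null hn (mass_mono hE_perim) hR0 hFg hxi
  have hax : μH[(n:ℝ)-1] {x : Euc n | x ≠ 0 ∧ 1 ≤ |⟪hatv x, e⟫| ∧ ¬ DZ volume n F x ∧ ¬ DZ volume n Fᶜ x} = 0 := by
    rcases hn.eq_or_lt with h | h
    · subst h
      exact axis_null2 hF he (mass_mono hE_perim) (fun r => ⟨mass_nonneg E r, mass_le hE_perim r⟩) hR0 hFg hxi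
    · refine measure_mono_null ?_ (axis_line (by omega) he)
      rintro x ⟨h1, h2, -⟩
      exact ⟨h1, h2⟩
  refine le_trans ?_ hT
  rw [perim]
  have hsub : essBoundary F ∩ sphShell n B ⊆ (Tan F {y | ‖y‖ ∉ R0} ∩ sphShell n B) ∪
      ({x | x ≠ 0 ∧ |⟪hatv x, e⟫| < 1 ∧ x ∉ Tan F {y | ‖y‖ ∉ R0} ∧ ¬ DZ volume n F x ∧ ¬ DZ volume n Fᶜ x} ∪
       {x | x ≠ 0 ∧ 1 ≤ |⟪hatv x, e⟫| ∧ ¬ DZ volume n F x ∧ ¬ DZ volume n Fᶜ x}) := by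
    rintro x ⟨hx, hxB⟩
    have hd := (mem_essBoundary_iff hF).1 hx
    by_cases hxT : x ∈ Tan F {y | ‖y‖ ∉ R0}
    · exact Or.inl ⟨hxT, hxB⟩
    · right
      rcases lt_or_ge |⟪hatv x, e⟫| 1 with h | h
      · exact Or.inl ⟨hxB.1, h, hxT, hd.1, hd.2⟩
      · exact Or.inr ⟨hxB.1, h, hd.1, hd.2⟩
  refine (measure_mono hsub).trans ((measure_union_le _ _).trans ?_)
  rw [measure_union_null hoff hax, add_zero]

theorem symm_all {n : ℕ} (hn : 2 ≤ n) (hn0 : 0 < n)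
    {v : ℝ → ℝ} (hv_meas : Measurable v) (hv_nonneg : ∀ r ∈ Ioi (0:ℝ), 0 ≤ v r)
    {α : ℝ → ℝ} (hα_meas : Measurable α) (hα_mem : ∀ r, α r ∈ Icc (0:ℝ) Real.pi)
    (hα : ∀ᵐ r ∂(volume.restrict (Ioi (0:ℝ))),
      μH[(n : ℝ) - 1] (capSet (e1 n hn0) r (α r)) = ENNReal.ofReal (v r))
    {E : Set (Euc n)} (hE_meas : MeasurableSet E) (hE_dist : SphDistrib v E)
    (hE_perim : perim E univ < ⊤) (hE_vol : volume E < ⊤) :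
    BVIoi v ∧
      perim (sphSymm n α (e1 n hn0)) univ < ⊤ ∧
      ∀ B : Set ℝ, MeasurableSet B → B ⊆ Ioi (0:ℝ) →
        perim (sphSymm n α (e1 n hn0)) (sphShell n B) ≤ perim E (sphShell n B) := by
  have key := fun (B : Set ℝ) (hB : MeasurableSet B) => symm_main hn hn0 hv_meas hv_nonneg hα_meas hα_mem hα hE_meas hE_dist hE_perim hE_vol hB
  refine ⟨bv_main hn hv_meas hv_nonneg hE_meas hE_dist hE_perim hE_vol, ?_, fun B hB _ => key B hB⟩
  have h1 := key univ MeasurableSet.univ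
  have hd : (0:ℝ) < (n:ℝ) - 1 := by
    have : (2:ℝ) ≤ n := by exact_mod_cast hn
    linarith
  have := Measure.nullSingletonClass_hausdorff (Euc n) hd
  have h0 : μH[(n:ℝ)-1] ({0} : Set (Euc n)) = 0 := measure_singleton _
  calc perim (sphSymm n α (e1 n hn0)) univ
      ≤ μH[(n:ℝ)-1] ((essBoundary (sphSymm n α (e1 n hn0)) ∩ sphShell n univ) ∪ {0}) := by
        refine measure_mono ?_
        rintro x ⟨hx, -⟩
        by_cases hx0 : x = 0
        · exact Or.inr hx0
        · exact Or.inl ⟨hx, hx0, trivial⟩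
    _ ≤ perim (sphSymm n α (e1 n hn0)) (sphShell n univ) + 0 := by
        rw [← h0]; exact measure_union_le _ _
    _ = perim (sphSymm n α (e1 n hn0)) (sphShell n univ) := add_zero _
    _ ≤ perim E (sphShell n univ) := h1
    _ ≤ perim E univ := measure_mono (inter_subset_inter_right _ (subset_univ _))
    _ < ⊤ := hE_perim

end SecA16

/-- **Theorem 1.1, first part.** The spherical symmetrisation does not increase the
perimeter: if `E` is spherically `v`-distributed with finite perimeter and finite volume,
then `v ∈ BV(0,∞)`, `F_v` has finite perimeter, and
`P(F_v; Φ(B × S^{n-1})) ≤ P(E; Φ(B × S^{n-1}))` for every Borel `B ⊆ (0,∞)`. -/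
theorem spherical_perimeter_inequality
    (n : ℕ) (hn : 2 ≤ n)
    (v : ℝ → ℝ) (hv_meas : Measurable v) (hv_nonneg : ∀ r ∈ Ioi (0:ℝ), 0 ≤ v r)
    (hv_le : ∀ᵐ r ∂(volume.restrict (Ioi (0:ℝ))),
      v r ≤ (n : ℝ) * omegaBall n * r ^ (n - 1))
    (α : ℝ → ℝ) (hα_meas : Measurable α) (hα_mem : ∀ r, α r ∈ Icc (0:ℝ) Real.pi)
    (hα : ∀ᵐ r ∂(volume.restrict (Ioi (0:ℝ))),
      μH[(n : ℝ) - 1] (capSet (e1 n (by omega)) r (α r)) = ENNReal.ofReal (v r))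
    (E : Set (Euc n)) (hE_meas : MeasurableSet E) (hE_dist : SphDistrib v E)
    (hE_perim : perim E univ < ⊤) (hE_vol : volume E < ⊤)
 :
    BVIoi v ∧
      perim (sphSymm n α (e1 n (by omega))) univ < ⊤ ∧
      ∀ B : Set ℝ, MeasurableSet B → B ⊆ Ioi (0:ℝ) →
        perim (sphSymm n α (e1 n (by omega))) (sphShell n B) ≤ perim E (sphShell n B) := by
  exact symm_all hn (lt_of_lt_of_le two_pos hn) hv_meas hv_nonneg hα_meas hα_mem hα hE_meas hE_dist hE_perim hE_vol
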